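/- arXiv:1304.3830 — 2 statements merged into one kernel-verified Lean document; each statement's English description precedes it below -/
import Mathlib

section
/- Let Γ and Δ be countable discrete groups. Let E_Γ be the equivalence relation on Free(ℕ^{Γ*Δ}) where x E_Γ y iff there exists γ ∈ Γ such that γ·x = y, and define E_Δ analogously using Δ. Then E_Γ and E_Δ do not have Borel disjoint complete sections: there do not exist disjoint Borel sets A, B ⊆ Free(ℕ^{Γ*Δ}) such that A meets every E_Γ-class and B meets every E_Δ-class. -/
/-- The left shift action of a group `G` on the product space `G → X`:
`(γ • y) β = y (γ⁻¹ * β)`. -/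
def shift {G : Type*} [Group G] {X : Type*} (γ : G) (y : G → X) : G → X :=
  fun β => y (γ⁻¹ * β)

/-- The free part `Free(X^G)` of the left shift action of `G` on `G → X`. -/
def freePart (G : Type*) [Group G] (X : Type*) : Set (G → X) :=
  {y | ∀ γ : G, γ ≠ 1 → shift γ y ≠ y}

/-- A pruned game tree, presented by its levels of positions and the map sending a position to its
immediate predecessor. Player `false` moves at even levels and player `true` at odd levels. -/
structure GameTree where
  Pos : ℕ → Type
  par : ∀ n, Pos (n + 1) → Pos n
  surj : ∀ n, Function.Surjective (par n)

namespace GameTree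

theorem exists_thread {P : ℕ → Type} (par : ∀ n, P (n + 1) → P n) (Q : ∀ n, P n → Prop) (N : ℕ)
    (p : P N) (hp : Q N p)
    (h : ∀ n, N ≤ n → ∀ q, Q n q → ∃ c, par n c = q ∧ Q (n + 1) c) :
    ∃ x : ∀ n, P n, (∀ n, par n (x (n + 1)) = x n) ∧ x N = p ∧ ∀ n, N ≤ n → Q n (x n) := by
  induction N generalizing P with
  | zero =>
    choose f hf hQ using fun n q hq => h n (Nat.zero_le n) q hq
    let t : ∀ n, {q : P n // Q n q} :=
      fun n => Nat.rec ⟨p, hp⟩ (fun n q => ⟨f n q.1 q.2, hQ n q.1 q.2⟩) n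
    exact ⟨fun n => (t n).1, fun n => hf n _ _, rfl, fun n _ => (t n).2⟩
  | succ N ih =>
    obtain ⟨x, hx, hxN, hxQ⟩ := ih (P := fun n => P (n + 1)) (fun n => par (n + 1))
      (fun n => Q (n + 1)) p hp (fun n hn => h (n + 1) (by omega))
    refine ⟨fun n => Nat.casesOn n (par 0 (x 0)) x, ?_, hxN, ?_⟩
    · rintro (_ | n)
      · rfl
      · exact hx n
    · rintro (_ | n) hn
      · omega
      · exact hxQ n (by omega)

/-- The infinite branches of a game tree. -/
abbrev Run (T : GameTree) := {x : ∀ n, T.Pos n // ∀ n, T.par n (x (n + 1)) = x n}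

/-- A strategy, given as a choice of a child for every position. As a strategy for one of the
players, only its values on the levels at which that player moves matter. -/
abbrev Strat (T : GameTree) := {s : ∀ n, T.Pos n → T.Pos (n + 1) // ∀ n p, T.par n (s n p) = p}

variable {T T' T'' : GameTree}

/-- The run `x` follows the strategy `s` at the moves of player `b`. -/
def Obeys (b : Bool) (s : Strat T) (x : Run T) : Prop :=
  ∀ n, n.bodd = b → x.1 (n + 1) = s.1 n (x.1 n)

theorem Run.ext' {x y : Run T} (h : ∀ n, x.1 n = y.1 n) : x = y := Subtype.ext (funext h)

theorem Run.eq_of_le {x y : Run T} {m n : ℕ} (h : x.1 n = y.1 n) (hmn : m ≤ n) :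
    x.1 m = y.1 m := by
  induction n, hmn using Nat.le_induction with
  | base => exact h
  | succ n _ ih => exact ih (by rw [← x.2 n, ← y.2 n, h])

theorem exists_run_of_step (Q : ∀ n, T.Pos n → Prop) {N : ℕ} (x : Run T) (hx : Q N (x.1 N))
    (h : ∀ n, N ≤ n → ∀ q, Q n q → ∃ c, T.par n c = q ∧ Q (n + 1) c) :
    ∃ y : Run T, y.1 N = x.1 N ∧ ∀ n, N ≤ n → Q n (y.1 n) := by
  obtain ⟨y, hy, h1, h2⟩ := exists_thread T.par Q N (x.1 N) hx h
  exact ⟨⟨y, hy⟩, h1, h2⟩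

theorem exists_run {n : ℕ} (p : T.Pos n) : ∃ x : Run T, x.1 n = p := by
  obtain ⟨x, hx, h1, -⟩ := exists_thread T.par (fun _ _ => True) n p trivial
    (fun m _ q _ => (T.surj m q).imp fun c hc => ⟨hc, trivial⟩)
  exact ⟨⟨x, hx⟩, h1⟩

/-- A chosen run through a position. -/
noncomputable def thru {n : ℕ} (p : T.Pos n) : Run T := (exists_run p).choose

theorem thru_self {n : ℕ} (p : T.Pos n) : (thru p).1 n = p := (exists_run p).choose_spec

theorem thru_of_le (x : Run T) {m n : ℕ} (h : m ≤ n) : (thru (x.1 n)).1 m = x.1 m :=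
  Run.eq_of_le (thru_self _) h

/-- `WinRank b W α p` means that player `b` can force a visit to `W` from the position `p`,
with ordinal rank at most `α`. -/
inductive WinRank (b : Bool) (W : Set (Σ n, T.Pos n)) : Ordinal.{0} → ∀ n, T.Pos n → Prop
  | base (α : Ordinal.{0}) (n : ℕ) (p : T.Pos n) (h : ⟨n, p⟩ ∈ W) : WinRank b W α n p
  | own (α β : Ordinal.{0}) (n : ℕ) (c : T.Pos (n + 1)) (hn : n.bodd = b) (h : β < α)
      (hc : WinRank b W β (n + 1) c) : WinRank b W α n (T.par n c)
  | opp (α : Ordinal.{0}) (n : ℕ) (p : T.Pos n) (f : T.Pos (n + 1) → Ordinal.{0})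
      (hn : n.bodd ≠ b) (h : ∀ c, T.par n c = p → f c < α)
      (hc : ∀ c, T.par n c = p → WinRank b W (f c) (n + 1) c) : WinRank b W α n p

/-- Player `b` can force a visit to `W` from the position `p`. -/
def Win (b : Bool) (W : Set (Σ n, T.Pos n)) (n : ℕ) (p : T.Pos n) : Prop :=
  ∃ α, WinRank b W α n p

variable {b : Bool} {W : Set (Σ n, T.Pos n)} {n : ℕ}

theorem Win.of_mem {p : T.Pos n} (h : ⟨n, p⟩ ∈ W) : Win b W n p := ⟨0, .base _ _ _ h⟩

theorem Win.of_child {c : T.Pos (n + 1)} (hn : n.bodd = b) (h : Win b W (n + 1) c) :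
    Win b W n (T.par n c) :=
  h.elim fun β hβ => ⟨_, .own (Order.succ β) β n c hn (Order.lt_succ β) hβ⟩

theorem Win.of_children {p : T.Pos n} (hn : n.bodd ≠ b)
    (h : ∀ c, T.par n c = p → Win b W (n + 1) c) : Win b W n p := by
  choose! f hf using h
  refine ⟨⨆ c, Order.succ (f c), .opp _ _ _ f hn (fun c _ => ?_) hf⟩
  exact (Order.lt_succ (f c)).trans_le (Ordinal.le_iSup (fun c => Order.succ (f c)) c)

theorem Win.exists_child {p : T.Pos n} (h : Win b W n p) (hp : ⟨n, p⟩ ∉ W) (hn : n.bodd = b) :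
    ∃ c, T.par n c = p ∧ ∀ α, WinRank b W α n p → ∃ β < α, WinRank b W β (n + 1) c := by
  have hmin := WellFounded.min_mem wellFounded_lt {α : Ordinal.{0} | WinRank b W α n p} h
  set α := WellFounded.min wellFounded_lt {α : Ordinal.{0} | WinRank b W α n p} h with hα
  have hle : ∀ γ, WinRank b W γ n p → α ≤ γ := fun γ hγ =>
    not_lt.1 (WellFounded.not_lt_min wellFounded_lt {α : Ordinal.{0} | WinRank b W α n p} hγ)
  clear_value α
  cases (hmin : WinRank b W α n p) with
  | base _ _ _ h => exact absurd h hp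
  | own _ β _ c _ hβ hc => exact ⟨c, rfl, fun γ hγ => ⟨β, hβ.trans_le (hle γ hγ), hc⟩⟩
  | opp _ _ _ f hn' => exact absurd hn hn'

/-- A strategy which decreases the rank of every position won by player `b`. -/
theorem exists_attack (b : Bool) (W : Set (Σ n, T.Pos n)) : ∃ s : Strat T, ∀ (x : Run T) (n : ℕ),
    Win b W n (x.1 n) →
    (∀ m, n ≤ m → m.bodd = b → Win b W m (x.1 m) → x.1 (m + 1) = s.1 m (x.1 m)) →
    ∃ m, n ≤ m ∧ ⟨m, x.1 m⟩ ∈ W := by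
  have key : ∀ (n : ℕ) (p : T.Pos n), ∃ c, T.par n c = p ∧ (Win b W n p → ⟨n, p⟩ ∉ W →
      n.bodd = b → ∀ α, WinRank b W α n p → ∃ β < α, WinRank b W β (n + 1) c) := by
    intro n p
    by_cases h : Win b W n p ∧ ⟨n, p⟩ ∉ W ∧ n.bodd = b
    · obtain ⟨c, hc, h'⟩ := h.1.exists_child h.2.1 h.2.2
      exact ⟨c, hc, fun _ _ _ => h'⟩
    · obtain ⟨c, hc⟩ := T.surj n p
      exact ⟨c, hc, fun h1 h2 h3 => absurd ⟨h1, h2, h3⟩ h⟩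
  choose s hs hs' using key
  refine ⟨⟨s, hs⟩, fun x n hw hx => ?_⟩
  by_contra! hcon
  have : ∀ α : Ordinal.{0}, ∀ m, n ≤ m → ¬ WinRank b W α m (x.1 m) := by
    intro α
    induction α using WellFoundedLT.induction with
    | ind α ih =>
      intro m hm hα
      by_cases hb : m.bodd = b
      · obtain ⟨β, hβ, hc⟩ := hs' m _ ⟨α, hα⟩ (hcon m hm) hb α hα
        exact ih β hβ (m + 1) (by omega) (by rw [hx m hm hb ⟨α, hα⟩]; exact hc)
      · generalize hp : x.1 m = p at hα
        cases hα with
        | base _ _ _ h => exact hcon m hm (hp ▸ h)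
        | own _ β _ c hb' => exact hb hb'
        | opp _ _ _ f _ hf hc =>
          exact ih _ (hf _ (by rw [x.2 m, hp])) (m + 1) (by omega)
            (hc (x.1 (m + 1)) (by rw [x.2 m, hp]))
  obtain ⟨α, hα⟩ := hw
  exact this α n le_rfl hα

/-- A chosen attacking strategy of player `b` towards `W`. -/
noncomputable def attack (b : Bool) (W : Set (Σ n, T.Pos n)) : Strat T := (exists_attack b W).choose

theorem attack_spec (b : Bool) (W : Set (Σ n, T.Pos n)) (x : Run T) (n : ℕ)
    (hw : Win b W n (x.1 n))
    (hx : ∀ m, n ≤ m → m.bodd = b → Win b W m (x.1 m) →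
      x.1 (m + 1) = (attack b W).1 m (x.1 m)) :
    ∃ m, n ≤ m ∧ ⟨m, x.1 m⟩ ∈ W :=
  (exists_attack b W).choose_spec x n hw hx

theorem exists_child_not_win {p : T.Pos n} (hp : ¬ Win b W n p) (hn : n.bodd ≠ b) :
    ∃ c, T.par n c = p ∧ ¬ Win b W (n + 1) c := by
  by_contra! h
  exact hp (Win.of_children hn h)

/-- A set of runs is open if membership is witnessed by a finite initial segment. -/
def OpenSet (U : Set (Run T)) : Prop :=
  ∀ x ∈ U, ∃ n, ∀ y : Run T, y.1 n = x.1 n → y ∈ U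

/-- The game with payoff set `A` for player `false` is determined. -/
def Determined (A : Set (Run T)) : Prop :=
  (∃ s, ∀ x, Obeys false s x → x ∈ A) ∨ ∃ s, ∀ x, Obeys true s x → x ∉ A

theorem exists_winning_of_openSet (b : Bool) {U : Set (Run T)} (hU : OpenSet U)
    (h0 : Subsingleton (T.Pos 0)) :
    (∃ s, ∀ x, Obeys b s x → x ∈ U) ∨ ∃ s, ∀ x, Obeys (!b) s x → x ∉ U := by
  set W : Set (Σ n, T.Pos n) := {q | ∀ y : Run T, y.1 q.1 = q.2 → y ∈ U} with hW
  by_cases h : ∃ r : T.Pos 0, Win b W 0 r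
  · obtain ⟨r, hr⟩ := h
    refine Or.inl ⟨attack b W, fun x hx => ?_⟩
    obtain ⟨m, -, hm⟩ := attack_spec b W x 0 (by rwa [Subsingleton.elim (x.1 0) r])
      (fun m _ hb _ => hx m hb)
    exact hm x rfl
  · push Not at h
    have key : ∀ (n : ℕ) (p : T.Pos n), ∃ c, T.par n c = p ∧ (¬ Win b W n p →
        n.bodd ≠ b → ¬ Win b W (n + 1) c) := by
      intro n p
      by_cases h : ¬ Win b W n p ∧ n.bodd ≠ b
      · obtain ⟨c, hc, h'⟩ := exists_child_not_win h.1 h.2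
        exact ⟨c, hc, fun _ _ => h'⟩
      · obtain ⟨c, hc⟩ := T.surj n p
        exact ⟨c, hc, fun h1 h2 => absurd ⟨h1, h2⟩ h⟩
    choose s hs hs' using key
    refine Or.inr ⟨⟨s, hs⟩, fun x hx hxU => ?_⟩
    have hnw : ∀ n, ¬ Win b W n (x.1 n) := by
      intro n
      induction n with
      | zero => exact h _
      | succ n ih =>
        by_cases hb : n.bodd = b
        · intro hw
          exact ih (x.2 n ▸ Win.of_child hb hw)
        · rw [hx n (by cases b <;> cases hh : n.bodd <;> simp_all)]
          exact hs' n _ ih hb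
    obtain ⟨n, hn⟩ := hU x hxU
    exact hnw n (.of_mem (by simpa [hW] using hn))

theorem determined_of_openSet {A : Set (Run T)} (hA : OpenSet A) (h0 : Subsingleton (T.Pos 0)) :
    Determined A :=
  exists_winning_of_openSet false hA h0

end GameTree

namespace GameTree

/-- A level-preserving map of game trees. -/
structure Hom (T' T : GameTree) where
  f : ∀ n, T'.Pos n → T.Pos n
  comm : ∀ n p, f n (T'.par n p) = T.par n (f (n + 1) p)

variable {T T' T'' : GameTree}

/-- The map on runs induced by a map of game trees. -/
def Hom.map (F : Hom T' T) (x : Run T') : Run T :=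
  ⟨fun n => F.f n (x.1 n), fun n => by rw [← F.comm, x.2]⟩

/-- The composite of two maps of game trees. -/
def Hom.comp (F : Hom T' T) (F' : Hom T'' T') : Hom T'' T :=
  ⟨fun n p => F.f n (F'.f n p), fun n p => by rw [F'.comm, F.comm]⟩

theorem OpenSet.preimage {U : Set (Run T)} (hU : OpenSet U) (F : Hom T' T) :
    OpenSet (F.map ⁻¹' U) := fun x hx => by
  obtain ⟨n, hn⟩ := hU _ hx
  exact ⟨n, fun y hy => hn _ (congrArg (F.f n) hy)⟩

/-- A covering of the game tree `T` by the game tree `T'` which is bijective up to level `k`: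
strategies in `T'` can be transferred to `T` in such a way that each run which follows the
transferred strategy lifts to a run following the original one. -/
structure Covering (k : ℕ) (T' T : GameTree) extends Hom T' T where
  bij : ∀ n ≤ k, Function.Bijective (f n)
  φ : Bool → Strat T' → Strat T
  local_eq : ∀ b s s' n, (∀ m ≤ n, s.1 m = s'.1 m) → (φ b s).1 n = (φ b s').1 n
  agree : ∀ b s n p, n < k → (φ b s).1 n (f n p) = f (n + 1) (s.1 n p)
  lift : ∀ b s x, Obeys b (φ b s) x → ∃ x', Obeys b s x' ∧ toHom.map x' = x

/-- The composite of two coverings. -/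
def Covering.comp {k : ℕ} (C : Covering k T' T) (C' : Covering k T'' T') : Covering k T'' T where
  toHom := C.toHom.comp C'.toHom
  bij n hn := (C.bij n hn).comp (C'.bij n hn)
  φ b s := C.φ b (C'.φ b s)
  local_eq b s s' n h := C.local_eq b _ _ n fun m hm =>
    C'.local_eq b _ _ m fun l hl => h l (hl.trans hm)
  agree b s n p hn := (C.agree b _ n _ hn).trans (congrArg _ (C'.agree b s n p hn))
  lift b s x hx := by
    obtain ⟨y, hy, rfl⟩ := C.lift b _ x hx
    obtain ⟨z, hz, rfl⟩ := C'.lift b _ y hy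
    exact ⟨z, hz, rfl⟩

section Limit

variable {k : ℕ} {T : ℕ → GameTree} (C : ∀ i, Covering (k + i) (T (i + 1)) (T i))

/-- The positions of the inverse limit of a sequence of game trees. -/
abbrev LimPos (n : ℕ) : Type :=
  {p : ∀ i, (T i).Pos n // ∀ i, (C i).f n (p (i + 1)) = p i}

variable {C}

theorem LimPos.ext_of_le {n i : ℕ} (hn : n ≤ k + i) {p q : LimPos C n} (h : p.1 i = q.1 i) :
    p = q := by
  refine Subtype.ext (funext fun j => ?_)
  rcases le_total i j with hj | hj
  · induction j, hj using Nat.le_induction with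
    | base => exact h
    | succ j hj ih => exact ((C j).bij n (by omega)).1 (by rw [p.2, q.2, ih])
  · induction hj using Nat.decreasingInduction with
    | self => exact h
    | of_succ j _ ih => rw [← p.2, ← q.2, ih]

theorem LimPos.exists_eq {n i : ℕ} (hn : n ≤ k + i) (q : (T i).Pos n) :
    ∃ p : LimPos C n, p.1 i = q := by
  obtain ⟨p, hp, hpi, -⟩ := exists_thread (fun i => (C i).f n) (fun _ _ => True) i q trivial
    (fun j hj q _ => (((C j).bij n (by omega)).2 q).imp fun c hc => ⟨hc, trivial⟩)
  exact ⟨⟨p, hp⟩, hpi⟩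

variable (C)

/-- The inverse limit of a sequence of coverings. -/
def limitTree : GameTree where
  Pos := LimPos C
  par n p := ⟨fun i => (T i).par n (p.1 i), fun i => by rw [(C i).comm, p.2]⟩
  surj n p := by
    obtain ⟨c, hc⟩ := (T (n + 1)).surj n (p.1 (n + 1))
    obtain ⟨q, rfl⟩ := LimPos.exists_eq (C := C) (by omega) c
    exact ⟨q, LimPos.ext_of_le (i := n + 1) (by omega) hc⟩

/-- The projections of the inverse limit. -/
def limitProj (i : ℕ) : Hom (limitTree C) (T i) := ⟨fun _ p => p.1 i, fun _ _ => rfl⟩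

theorem exists_project (i n : ℕ) (g : LimPos C n → LimPos C (n + 1))
    (hg : ∀ p, (limitTree C).par n (g p) = p) : ∃ h : (T i).Pos n → (T i).Pos (n + 1),
      (∀ q, (T i).par n (h q) = q) ∧ (n + 1 ≤ k + i → ∀ p, h (p.1 i) = (g p).1 i) := by
  by_cases hn : n + 1 ≤ k + i
  · choose l hl using LimPos.exists_eq (C := C) (n := n) (i := i) (by omega)
    refine ⟨fun q => (g (l q)).1 i, fun q => ?_, fun _ p => ?_⟩
    · exact (congrArg (fun r : LimPos C n => r.1 i) (hg (l q))).trans (hl q)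
    · exact congrArg (fun r => (g r).1 i) (LimPos.ext_of_le (by omega) (hl (p.1 i)))
  · choose h hh using (T i).surj n
    exact ⟨h, hh, fun h' => absurd h' hn⟩

/-- The strategy in `T i` induced by a strategy in the inverse limit on the levels where the
projection is bijective. -/
noncomputable def projStrat (s : Strat (limitTree C)) (i : ℕ) : Strat (T i) :=
  ⟨fun n => (exists_project C i n (s.1 n) (s.2 n)).choose,
    fun n => (exists_project C i n (s.1 n) (s.2 n)).choose_spec.1⟩

theorem projStrat_apply (s : Strat (limitTree C)) {i n : ℕ} (hn : n + 1 ≤ k + i)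
    (p : LimPos C n) : (projStrat C s i).1 n (p.1 i) = (s.1 n p).1 i :=
  (exists_project C i n (s.1 n) (s.2 n)).choose_spec.2 hn p

theorem projStrat_local (s s' : Strat (limitTree C)) {i n : ℕ} (h : s.1 n = s'.1 n) :
    (projStrat C s i).1 n = (projStrat C s' i).1 n := by
  simp only [projStrat, h]

/-- The approximations to the transferred strategy. -/
noncomputable def approxStrat (b : Bool) (s : Strat (limitTree C)) : ℕ → ∀ i, Strat (T i)
  | 0, i => projStrat C s i
  | m + 1, i => (C i).φ b (approxStrat b s m (i + 1))

theorem approxStrat_succ (b : Bool) (s : Strat (limitTree C)) (m i n : ℕ)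
    (h : n + 1 ≤ k + i + m) :
    (approxStrat C b s (m + 1) i).1 n = (approxStrat C b s m i).1 n := by
  induction m generalizing i n with
  | zero =>
    funext q
    obtain ⟨p, rfl⟩ := LimPos.exists_eq (C := C) (n := n) (i := i) (by omega) q
    have h1 := (C i).agree b (projStrat C s (i + 1)) n (p.1 (i + 1)) (by omega)
    rw [p.2 i, projStrat_apply C s (by omega), (s.1 n p).2 i] at h1
    exact h1.trans (projStrat_apply C s (by omega) p).symm
  | succ m ih => exact (C i).local_eq b _ _ n fun n' hn' => ih (i + 1) n' (by omega)

theorem approxStrat_of_le (b : Bool) (s : Strat (limitTree C)) {m m' : ℕ} (i n : ℕ)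
    (h : n + 1 ≤ k + i + m) (hm : m ≤ m') :
    (approxStrat C b s m' i).1 n = (approxStrat C b s m i).1 n := by
  induction m', hm using Nat.le_induction with
  | base => rfl
  | succ m' _ ih => rw [approxStrat_succ C b s m' i n (by omega), ih]

theorem approxStrat_local (b : Bool) (s s' : Strat (limitTree C)) (m i n : ℕ)
    (h : ∀ l ≤ n, s.1 l = s'.1 l) :
    (approxStrat C b s m i).1 n = (approxStrat C b s' m i).1 n := by
  induction m generalizing i n with
  | zero => exact projStrat_local C s s' (h n le_rfl)
  | succ m ih =>
    exact (C i).local_eq b _ _ n fun n' hn' => ih (i + 1) n' fun l hl => h l (hl.trans hn')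

/-- The transfer of a strategy in the inverse limit to the tree `T i`. -/
noncomputable def limStrat (b : Bool) (s : Strat (limitTree C)) (i : ℕ) : Strat (T i) :=
  ⟨fun n => (approxStrat C b s (n + 1) i).1 n, fun n => (approxStrat C b s (n + 1) i).2 n⟩

theorem limStrat_eq (b : Bool) (s : Strat (limitTree C)) (i : ℕ) :
    limStrat C b s i = (C i).φ b (limStrat C b s (i + 1)) := by
  refine Subtype.ext (funext fun n => ?_)
  have h1 := (C i).local_eq b (limStrat C b s (i + 1)) (approxStrat C b s (n + 1) (i + 1)) n
    fun m hm => (approxStrat_of_le C b s (i + 1) m (by omega) (by omega)).symm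
  exact ((h1.trans (approxStrat_succ C b s (n + 1) i n (by omega)))).symm

theorem limStrat_apply (b : Bool) (s : Strat (limitTree C)) {i n : ℕ} (hn : n + 1 ≤ k + i)
    (p : LimPos C n) : (limStrat C b s i).1 n (p.1 i) = (s.1 n p).1 i := by
  rw [← projStrat_apply C s hn p]
  exact congrFun (approxStrat_of_le C b s (m := 0) i n (by omega) (by omega)) _

/-- The inverse limit of a sequence of coverings covers the first tree. -/
noncomputable def limitCovering : Covering k (limitTree C) (T 0) where
  toHom := limitProj C 0
  bij n hn := ⟨fun _ _ h => LimPos.ext_of_le (i := 0) (by omega) h,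
    fun q => LimPos.exists_eq (i := 0) (by omega) q⟩
  φ b s := limStrat C b s 0
  local_eq b s s' n h := approxStrat_local C b s s' (n + 1) 0 n h
  agree b s n p hn := limStrat_apply C b s (by omega) p
  lift b s x hx := by
    obtain ⟨X, hX, hX0, hXs⟩ := exists_thread (fun i => (C i).map)
      (fun i y => Obeys b (limStrat C b s i) y) 0 x hx fun i _ y hy => by
        rw [limStrat_eq] at hy
        obtain ⟨c, h1, h2⟩ := (C i).lift b _ y hy
        exact ⟨c, h2, h1⟩
    refine ⟨⟨fun n => ⟨fun i => (X i).1 n, fun i => ?_⟩, fun n => ?_⟩, fun n hn => ?_, ?_⟩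
    · exact congrArg (fun y : Run (T i) => y.1 n) (hX i)
    · exact Subtype.ext (funext fun i => (X i).2 n)
    · refine LimPos.ext_of_le (i := n + 1) (by omega) ?_
      rw [← limStrat_apply C b s (by omega)]
      exact hXs (n + 1) (by omega) n hn
    · rw [← hX0]
      rfl

theorem map_limitProj_succ (i : ℕ) (x : Run (limitTree C)) :
    (C i).map ((limitProj C (i + 1)).map x) = (limitProj C i).map x :=
  Run.ext' fun n => (x.1 n).2 i

end Limit

end GameTree

namespace GameTree

variable {T : GameTree}

theorem Win.exists_run {b : Bool} {W : Set (Σ n, T.Pos n)} {n : ℕ} {p : T.Pos n}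
    (h : Win b W n p) : ∃ x : Run T, x.1 n = p ∧ ∃ m, n ≤ m ∧ ⟨m, x.1 m⟩ ∈ W := by
  obtain ⟨α, hα⟩ := h
  induction hα with
  | base _ n p h => exact ⟨thru p, thru_self p, n, le_rfl, by rwa [thru_self]⟩
  | own _ _ n c _ _ _ ih =>
    obtain ⟨x, hx, m, hm, h⟩ := ih
    exact ⟨x, by rw [← x.2, hx], m, by omega, h⟩
  | opp _ n p _ _ _ _ ih =>
    obtain ⟨c, hc⟩ := T.surj n p
    obtain ⟨x, hx, m, hm, h⟩ := ih c hc
    exact ⟨x, by rw [← x.2, hx, hc], m, by omega, h⟩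

theorem not_win_empty (b : Bool) {n : ℕ} (p : T.Pos n) : ¬ Win b ∅ n p := fun h => by
  obtain ⟨_, _, _, _, h⟩ := h.exists_run
  exact h

/-- The first element of `V` below the position `p`, if there is one. -/
noncomputable def firstHit (V : Set (Σ n, T.Pos n)) {n : ℕ} (p : T.Pos n) :
    Option (Σ n, T.Pos n) := by
  classical exact
    if h : ∃ m ≤ n, ⟨m, (thru p).1 m⟩ ∈ V then some ⟨Nat.find h, (thru p).1 (Nat.find h)⟩ else none

theorem firstHit_eq_none {V : Set (Σ n, T.Pos n)} {n : ℕ} (x : Run T)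
    (h : ∀ m ≤ n, ⟨m, x.1 m⟩ ∉ V) : firstHit V (x.1 n) = none := by
  refine dif_neg ?_
  rintro ⟨m, hm, hV⟩
  exact h m hm (thru_of_le x hm ▸ hV)

theorem firstHit_eq_some {V : Set (Σ n, T.Pos n)} {m n : ℕ} (x : Run T) (hmn : m ≤ n)
    (hm : ⟨m, x.1 m⟩ ∈ V) (h : ∀ l < m, ⟨l, x.1 l⟩ ∉ V) :
    firstHit V (x.1 n) = some ⟨m, x.1 m⟩ := by
  classical
  have hex : ∃ m ≤ n, ⟨m, (thru (x.1 n)).1 m⟩ ∈ V := ⟨m, hmn, by rwa [thru_of_le x hmn]⟩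
  have hfind : Nat.find hex = m := by
    refine le_antisymm (Nat.find_min' hex ⟨hmn, by rwa [thru_of_le x hmn]⟩) (not_lt.1 fun hlt => ?_)
    have h1 := Nat.find_spec hex
    rw [thru_of_le x h1.1] at h1
    exact h _ hlt h1.2
  have : firstHit V (x.1 n) = some ⟨Nat.find hex, (thru (x.1 n)).1 (Nat.find hex)⟩ := by
    unfold firstHit
    convert dif_pos hex
  rw [this, hfind, thru_of_le x hmn]

section Unravel

variable (C : Set (Run T)) (K : ℕ)

/-- The positions beyond level `K + 1` at which it is decided that the run avoids `C`. -/
def escape : Set (Σ n, T.Pos n) := {q | K + 2 ≤ q.1 ∧ ∀ x : Run T, x.1 q.1 = q.2 → x ∉ C}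

/-- The part of `escape C K` which player `b` aims at, once player `false` has proposed `W`. -/
def aim (W : Set (Σ n, T.Pos n)) (b : Bool) : Set (Σ n, T.Pos n) :=
  if b then escape C K \ W else escape C K ∩ W

/-- Neither player can force a visit to their aim. -/
def Draw (W : Set (Σ n, T.Pos n)) (n : ℕ) (p : T.Pos n) : Prop :=
  ∀ b, ¬ Win b (aim C K W b) n p

variable {C K} in
theorem Draw.exists_child {W : Set (Σ n, T.Pos n)} {n : ℕ} {p : T.Pos n} (h : Draw C K W n p) :
    ∃ c, T.par n c = p ∧ Draw C K W (n + 1) c := by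
  obtain ⟨c, hc, h'⟩ := exists_child_not_win (h (!n.bodd)) (by simp)
  refine ⟨c, hc, fun b => ?_⟩
  by_cases hb : n.bodd = b
  · exact fun hw => h b (hc ▸ hw.of_child hb)
  · rwa [show b = !n.bodd by cases b <;> cases hh : n.bodd <;> simp_all]

/-- The admissible decorations of a run: player `false` proposes `W` at level `K + 1`, and at level
`K + 2` player `true` either announces a position through which the run passes or claims that the
run is a draw forever. -/
structure IsDeco (x : Run T) (W : Set (Σ n, T.Pos n)) (o : Option (Σ n, T.Pos n)) : Prop where
  not_win : ¬ Win true (aim C K W true) (K + 1) (x.1 (K + 1))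
  of_some : ∀ u, o = some u → u ∈ aim C K W false ∧ x.1 u.1 = u.2
  of_none : o = none → ∀ i, K + 2 ≤ i → Draw C K W i (x.1 i)

/-- The decorated position of level `n` on a decorated run. -/
def trunc (x : Run T) (W : Set (Σ n, T.Pos n)) (o : Option (Σ n, T.Pos n)) (n : ℕ) :
    T.Pos n × Set (Σ n, T.Pos n) × Option (Σ n, T.Pos n) :=
  (x.1 n, if K + 1 ≤ n then W else ∅, if K + 2 ≤ n then o else none)

/-- The decorated positions of level `n`. -/
def legal (n : ℕ) : Set (T.Pos n × Set (Σ n, T.Pos n) × Option (Σ n, T.Pos n)) :=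
  {t | ∃ x W o, IsDeco C K x W o ∧ trunc K x W o n = t}

variable {C K}

theorem trunc_of_le (x : Run T) (W : Set (Σ n, T.Pos n)) (o : Option (Σ n, T.Pos n)) {n : ℕ}
    (h : n ≤ K) : trunc K x W o n = (x.1 n, ∅, none) := by
  simp [trunc, show ¬ K + 1 ≤ n by omega, show ¬ K + 2 ≤ n by omega]

theorem trunc_succ (x : Run T) (W : Set (Σ n, T.Pos n)) (o : Option (Σ n, T.Pos n)) :
    trunc K x W o (K + 1) = (x.1 (K + 1), W, none) := by
  simp [trunc]

theorem trunc_of_ge (x : Run T) (W : Set (Σ n, T.Pos n)) (o : Option (Σ n, T.Pos n)) {n : ℕ}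
    (h : K + 2 ≤ n) : trunc K x W o n = (x.1 n, W, o) := by
  simp [trunc, h, show K + 1 ≤ n by omega]

theorem Draw.exists_isDeco {W : Set (Σ n, T.Pos n)} {n : ℕ} (hn : K + 1 ≤ n) {x : Run T}
    (hx : ¬ Win true (aim C K W true) (K + 1) (x.1 (K + 1)))
    (h : ∀ i, K + 2 ≤ i → i ≤ n → Draw C K W i (x.1 i)) (hd : Draw C K W n (x.1 n)) :
    ∃ y : Run T, y.1 n = x.1 n ∧ IsDeco C K y W none := by
  obtain ⟨y, hy, h'⟩ := exists_run_of_step (Draw C K W) x hd fun n _ q hq => hq.exists_child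
  refine ⟨y, hy, by rwa [Run.eq_of_le hy hn], by simp, fun _ i hi => ?_⟩
  rcases le_total i n with hin | hin
  · rw [Run.eq_of_le hy hin]
    exact h i hi hin
  · exact h' i hin

theorem exists_isDeco {W : Set (Σ n, T.Pos n)} {x : Run T}
    (h : ¬ Win true (aim C K W true) (K + 1) (x.1 (K + 1))) :
    ∃ y o, IsDeco C K y W o ∧ y.1 (K + 1) = x.1 (K + 1) := by
  by_cases hw : Win false (aim C K W false) (K + 1) (x.1 (K + 1))
  · obtain ⟨y, hy, m, -, hm⟩ := hw.exists_run
    refine ⟨y, some ⟨m, y.1 m⟩, ⟨by rwa [hy], ?_, by simp⟩, hy⟩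
    rintro u ⟨⟩
    exact ⟨hm, rfl⟩
  · obtain ⟨y, hy, hd⟩ := Draw.exists_isDeco le_rfl h (fun i _ _ => by omega)
      (Bool.forall_bool.2 ⟨hw, h⟩)
    exact ⟨y, none, hd, hy⟩

theorem legal_of_le {n : ℕ} (h : n ≤ K) (p : T.Pos n) : (p, ∅, none) ∈ legal C K n := by
  obtain ⟨y, o, hd, hy⟩ := exists_isDeco (C := C) (K := K) (W := Set.univ) (x := thru p)
    (by simpa [aim] using not_win_empty true _)
  refine ⟨y, _, o, hd, ?_⟩
  rw [trunc_of_le y _ o h, Run.eq_of_le hy (by omega), thru_self]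

variable (K) in
/-- The predecessor of a decorated position. -/
def parDeco (n : ℕ) (t : T.Pos (n + 1) × Set (Σ n, T.Pos n) × Option (Σ n, T.Pos n)) :
    T.Pos n × Set (Σ n, T.Pos n) × Option (Σ n, T.Pos n) :=
  (T.par n t.1, if K + 1 ≤ n then t.2.1 else ∅, if K + 2 ≤ n then t.2.2 else none)

theorem parDeco_trunc (x : Run T) (W : Set (Σ n, T.Pos n)) (o : Option (Σ n, T.Pos n)) (n : ℕ) :
    parDeco K n (trunc K x W o (n + 1)) = trunc K x W o n := by
  simp only [parDeco, trunc, x.2 n]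
  congr 2
  · split_ifs <;> first | rfl | omega
  · split_ifs <;> first | rfl | omega

variable (C K) in
/-- The tree of decorated positions. -/
def decoTree : GameTree where
  Pos n := legal C K n
  par n t := ⟨parDeco K n t.1, by
    obtain ⟨x, W, o, hd, h⟩ := t.2
    exact ⟨x, W, o, hd, by rw [← h, parDeco_trunc]⟩⟩
  surj n t := by
    obtain ⟨x, W, o, hd, h⟩ := t.2
    exact ⟨⟨_, x, W, o, hd, rfl⟩, Subtype.ext ((parDeco_trunc x W o n).trans h)⟩

theorem decoTree_ext {n : ℕ} {t t' : (decoTree C K).Pos n} (h : t.1 = t'.1) : t = t' :=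
  Subtype.ext h

variable (C K) in
/-- The map forgetting the decorations. -/
def forgetDeco : Hom (decoTree C K) T := ⟨fun _ t => t.1.1, fun _ _ => rfl⟩

/-- The run of decorated positions given by a decorated run. -/
def decoRun {x : Run T} {W : Set (Σ n, T.Pos n)} {o : Option (Σ n, T.Pos n)}
    (h : IsDeco C K x W o) : Run (decoTree C K) :=
  ⟨fun n => ⟨trunc K x W o n, x, W, o, h, rfl⟩, fun n => decoTree_ext (parDeco_trunc x W o n)⟩

theorem run_snd (z : Run (decoTree C K)) {n : ℕ} (h : K + 2 ≤ n) :
    (z.1 n).1.2 = (z.1 (K + 2)).1.2 := by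
  induction n, h using Nat.le_induction with
  | base => rfl
  | succ n hn ih =>
    rw [← ih, ← z.2 n]
    simp [decoTree, parDeco, hn, show K + 1 ≤ n by omega]

theorem mem_iff_none (hC : OpenSet Cᶜ) (z : Run (decoTree C K)) :
    (forgetDeco C K).map z ∈ C ↔ (z.1 (K + 2)).1.2.2 = none := by
  set X := (forgetDeco C K).map z with hX
  set W := (z.1 (K + 2)).1.2.1 with hW
  have key : ∀ n, K + 2 ≤ n → ∃ x, IsDeco C K x W (z.1 (K + 2)).1.2.2 ∧ x.1 n = X.1 n := by
    intro n hn
    obtain ⟨x, W', o, hd, h⟩ := (z.1 n).2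
    rw [trunc_of_ge x W' o hn] at h
    have h2 := run_snd z hn
    rw [← h] at h2
    refine ⟨x, ?_, congrArg (fun t => t.1) h⟩
    rw [hW, ← h2]
    exact hd
  constructor
  · intro hXC
    by_contra hne
    obtain ⟨u, hu⟩ := Option.ne_none_iff_exists'.1 hne
    obtain ⟨x0, hx0, -⟩ := key _ le_rfl
    have hue : u ∈ escape C K := (hx0.of_some u hu).1.1
    obtain ⟨x, hx, hxu⟩ := key u.1 hue.1
    exact hue.2 X (hxu.symm.trans (hx.of_some u hu).2) hXC
  · intro hnone
    by_contra hXC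
    obtain ⟨n, hn⟩ := hC X hXC
    set m := max n (K + 2)
    have he : ⟨m, X.1 m⟩ ∈ escape C K :=
      ⟨le_max_right _ _, fun y hy => hn y (Run.eq_of_le hy (le_max_left _ _))⟩
    obtain ⟨x, hx, hxm⟩ := key m (le_max_right _ _)
    have hd := hx.of_none hnone m (le_max_right _ _)
    rw [hxm] at hd
    by_cases hmW : ⟨m, X.1 m⟩ ∈ W
    · exact hd false (.of_mem ⟨he, hmW⟩)
    · exact hd true (.of_mem ⟨he, hmW⟩)

end Unravel

end GameTree

namespace GameTree

section Unravel

variable {T : GameTree} {C : Set (Run T)} {K : ℕ}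

theorem legal_draw {n : ℕ} (hn : K + 2 ≤ n) {p : T.Pos n} {W : Set (Σ n, T.Pos n)}
    (h : (p, W, none) ∈ legal C K n) : Draw C K W n p := by
  obtain ⟨x, W', o, hd, h⟩ := h
  rw [trunc_of_ge x W' o hn] at h
  cases h
  exact hd.of_none rfl n hn

theorem legal_not_win {p : T.Pos (K + 1)} {W : Set (Σ n, T.Pos n)} {o : Option (Σ n, T.Pos n)}
    (h : (p, W, o) ∈ legal C K (K + 1)) : ¬ Win true (aim C K W true) (K + 1) p := by
  obtain ⟨x, W', o, hd, h⟩ := h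
  rw [trunc_succ x W' o] at h
  cases h
  exact hd.not_win

theorem legal_some {n : ℕ} {p : T.Pos n} {W : Set (Σ n, T.Pos n)} {u : Σ n, T.Pos n}
    (h : (p, W, some u) ∈ legal C K n) :
    u ∈ aim C K W false ∧ ∀ x : Run T, x.1 u.1 = u.2 → n ≤ u.1 → p = x.1 n := by
  obtain ⟨y, W', o, hd, h⟩ := h
  have hn : K + 2 ≤ n := by
    by_contra hn
    simp [trunc, hn] at h
  rw [trunc_of_ge y W' o hn] at h
  cases h
  refine ⟨(hd.of_some u rfl).1, fun x hx hnu => Run.eq_of_le ?_ hnu⟩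
  rw [hx, (hd.of_some u rfl).2]

theorem strat_par (s : Strat (decoTree C K)) (n : ℕ) (t : (decoTree C K).Pos n) :
    parDeco K n (s.1 n t).1 = t.1 := congrArg Subtype.val (s.2 n t)

theorem strat_par_fst (s : Strat (decoTree C K)) (n : ℕ) (t : (decoTree C K).Pos n) :
    T.par n (s.1 n t).1.1 = t.1.1 := congrArg Prod.fst (strat_par s n t)

theorem strat_proposal (s : Strat (decoTree C K)) {n : ℕ} (hn : K + 1 ≤ n)
    (t : (decoTree C K).Pos n) : (s.1 n t).1.2.1 = t.1.2.1 := by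
  rw [← strat_par s n t]
  simp [parDeco, hn]

theorem strat_answer (s : Strat (decoTree C K)) {n : ℕ} (hn : K + 2 ≤ n)
    (t : (decoTree C K).Pos n) : (s.1 n t).1.2.2 = t.1.2.2 := by
  rw [← strat_par s n t]
  simp [parDeco, hn]

theorem obeys_decoRun {b : Bool} (s : Strat (decoTree C K)) {x : Run T} {W : Set (Σ n, T.Pos n)}
    {o : Option (Σ n, T.Pos n)} (h : IsDeco C K x W o)
    (h1 : ∀ n, n.bodd = b → x.1 (n + 1) = (s.1 n ((decoRun h).1 n)).1.1)
    (h2 : K.bodd = b → W = (s.1 K ((decoRun h).1 K)).1.2.1)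
    (h3 : (K + 1).bodd = b → o = (s.1 (K + 1) ((decoRun h).1 (K + 1))).1.2.2) :
    Obeys b s (decoRun h) := by
  intro n hn
  refine decoTree_ext (Prod.ext (h1 n hn) (Prod.ext ?_ ?_))
  · rcases lt_trichotomy n K with hk | rfl | hk
    · obtain ⟨y, W', o', -, h'⟩ := (s.1 n ((decoRun h).1 n)).2
      rw [← h', trunc_of_le y W' o' hk]
      exact congrArg (fun t => t.2.1) (trunc_of_le x W o hk)
    · change (trunc n x W o (n + 1)).2.1 = _
      rw [trunc_succ]
      exact h2 hn
    · rw [strat_proposal s hk]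
      simp [decoRun, trunc, hk, show K ≤ n by omega]
  · rcases lt_trichotomy n (K + 1) with hk | rfl | hk
    · obtain ⟨y, W', o', -, h'⟩ := (s.1 n ((decoRun h).1 n)).2
      rw [← h']
      simp [decoRun, trunc, show ¬ K + 1 ≤ n by omega]
    · change (trunc K x W o (K + 2)).2.2 = _
      rw [trunc_of_ge x W o le_rfl]
      exact h3 hn
    · rw [strat_answer s hk]
      simp [decoRun, trunc, show K + 2 ≤ n by omega, show K + 1 ≤ n by omega]

theorem isDeco_none {b : Bool} (s : Strat (decoTree C K)) {x : Run T} {W : Set (Σ n, T.Pos n)}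
    (h0 : ¬ Win true (aim C K W true) (K + 1) (x.1 (K + 1)))
    (h1 : ∀ n, K + 2 ≤ n → n.bodd = b → ∀ h : (x.1 n, W, none) ∈ legal C K n,
      x.1 (n + 1) = (s.1 n ⟨_, h⟩).1.1)
    (h2 : ∀ n, K + 2 ≤ n → ¬ Win b (aim C K W b) n (x.1 n))
    (h3 : ¬ Win (!b) (aim C K W (!b)) (K + 2) (x.1 (K + 2))) : IsDeco C K x W none := by
  have hdraw : ∀ n, ¬ Win b (aim C K W b) n (x.1 n) →
      ¬ Win (!b) (aim C K W (!b)) n (x.1 n) → Draw C K W n (x.1 n) := by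
    intro n h h' b'
    by_cases hb : b' = b
    · rwa [hb]
    · rwa [show b' = !b by cases b <;> cases b' <;> simp_all]
  have key : ∀ n, K + 2 ≤ n → ∀ i, K + 2 ≤ i → i ≤ n → Draw C K W i (x.1 i) := by
    intro n hn
    induction n, hn using Nat.le_induction with
    | base =>
      intro i hi hi'
      obtain rfl : i = K + 2 := by omega
      exact hdraw _ (h2 _ le_rfl) h3
    | succ n hn ih =>
      intro i hi hi'
      rcases Nat.lt_or_ge n i with hin | hin
      swap
      · exact ih i hi hin
      obtain rfl : i = n + 1 := by omega
      have hdn := ih n hn le_rfl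
      refine hdraw _ (h2 _ hi) ?_
      by_cases hb : n.bodd = b
      · obtain ⟨y, hy, hd⟩ := Draw.exists_isDeco (by omega) h0 ih hdn
        have hl : (x.1 n, W, none) ∈ legal C K n := ⟨y, W, none, hd, by rw [trunc_of_ge _ _ _ hn, hy]⟩
        have e : (s.1 n ⟨_, hl⟩).1 = (x.1 (n + 1), W, none) :=
          Prod.ext (h1 n hn hb hl).symm (Prod.ext (strat_proposal s (by omega) _) (strat_answer s hn _))
        have := (s.1 n ⟨_, hl⟩).2
        rw [e] at this
        exact legal_draw hi this _
      · intro hw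
        refine hdn (!b) ?_
        rw [← x.2 n]
        exact hw.of_child (by cases b <;> cases hh : n.bodd <;> simp_all)
  exact ⟨h0, by simp, fun _ i hi => key i hi i hi le_rfl⟩

/-- Play according to a strategy for decorated positions whenever that makes sense. -/
noncomputable def respond {n : ℕ} (g : (decoTree C K).Pos n → (decoTree C K).Pos (n + 1))
    (a : T.Pos n → T.Pos (n + 1)) (p : T.Pos n) (W : Set (Σ n, T.Pos n))
    (o : Option (Σ n, T.Pos n)) : T.Pos (n + 1) := by
  classical exact if h : (p, W, o) ∈ legal C K n then (g ⟨_, h⟩).1.1 else a p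

theorem respond_of_mem {n : ℕ} (g : (decoTree C K).Pos n → (decoTree C K).Pos (n + 1))
    (a : T.Pos n → T.Pos (n + 1)) {p : T.Pos n} {W : Set (Σ n, T.Pos n)}
    {o : Option (Σ n, T.Pos n)} (h : (p, W, o) ∈ legal C K n) :
    respond g a p W o = (g ⟨_, h⟩).1.1 := dif_pos h

theorem respond_of_notMem {n : ℕ} (g : (decoTree C K).Pos n → (decoTree C K).Pos (n + 1))
    (a : T.Pos n → T.Pos (n + 1)) {p : T.Pos n} {W : Set (Σ n, T.Pos n)}
    {o : Option (Σ n, T.Pos n)} (h : (p, W, o) ∉ legal C K n) :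
    respond g a p W o = a p := dif_neg h

theorem par_respond (s : Strat (decoTree C K)) (a : Strat T) {n : ℕ} (p : T.Pos n)
    (W : Set (Σ n, T.Pos n)) (o : Option (Σ n, T.Pos n)) :
    T.par n (respond (s.1 n) (a.1 n) p W o) = p := by
  by_cases h : (p, W, o) ∈ legal C K n
  · rw [respond_of_mem _ _ h]
    exact strat_par_fst s n _
  · rw [respond_of_notMem _ _ h, a.2]

/-- The set proposed by a strategy of player `false` at a position of level `K`. -/
def offer (g : (decoTree C K).Pos K → (decoTree C K).Pos (K + 1)) (r : T.Pos K) :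
    Set (Σ n, T.Pos n) :=
  (g ⟨(r, ∅, none), legal_of_le le_rfl r⟩).1.2.1

/-- The transfer of a strategy of player `false` for decorated positions. -/
noncomputable def playFalse (s : Strat (decoTree C K)) : Strat T :=
  ⟨fun n p =>
    let W := if K + 1 ≤ n then offer (s.1 K) ((thru p).1 K) else ∅
    respond (s.1 n) ((attack false (aim C K W false)).1 n) p W (firstHit (aim C K W false) p),
  fun _ _ => par_respond s _ _ _ _⟩

theorem firstHit_empty {n : ℕ} (p : T.Pos n) : firstHit ∅ p = none := by
  rw [← thru_self p]
  exact firstHit_eq_none _ fun _ _ h => h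

theorem playFalse_of_le (s : Strat (decoTree C K)) {n : ℕ} (hn : n ≤ K) (p : T.Pos n) :
    (playFalse s).1 n p = (s.1 n ⟨(p, ∅, none), legal_of_le hn p⟩).1.1 := by
  have h : aim C K ∅ false = ∅ := by simp [aim]
  simp only [playFalse, show ¬ K + 1 ≤ n by omega, if_false, h, firstHit_empty]
  exact respond_of_mem _ _ _

theorem playFalse_of_ge (s : Strat (decoTree C K)) {n : ℕ} (hn : K + 1 ≤ n) (x : Run T) :
    (playFalse s).1 n (x.1 n) =
      respond (s.1 n) ((attack false (aim C K (offer (s.1 K) (x.1 K)) false)).1 n) (x.1 n)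
        (offer (s.1 K) (x.1 K)) (firstHit (aim C K (offer (s.1 K) (x.1 K)) false) (x.1 n)) := by
  simp only [playFalse, hn, if_true, thru_of_le x (show K ≤ n by omega)]

theorem playFalse_local (s s' : Strat (decoTree C K)) (n : ℕ) (h : ∀ m ≤ n, s.1 m = s'.1 m) :
    (playFalse s).1 n = (playFalse s').1 n := by
  by_cases hn : K + 1 ≤ n
  · simp only [playFalse, hn, if_true, h n le_rfl, h K (by omega)]
  · simp only [playFalse, hn, if_false, h n le_rfl]

theorem playFalse_lift (hK : K.bodd = false) (s : Strat (decoTree C K)) (x : Run T)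
    (hx : Obeys false (playFalse s) x) :
    ∃ z, Obeys false s z ∧ (forgetDeco C K).map z = x := by
  classical
  set W := offer (s.1 K) (x.1 K) with hW
  have hlow : ∀ n (hn : n ≤ K), n.bodd = false →
      x.1 (n + 1) = (s.1 n ⟨(x.1 n, ∅, none), legal_of_le hn _⟩).1.1 := fun n hn hb => by
    rw [hx n hb, playFalse_of_le s hn]
  have h0 : ¬ Win true (aim C K W true) (K + 1) (x.1 (K + 1)) := by
    rw [hlow K le_rfl hK]
    refine legal_not_win (o := (s.1 K ⟨(x.1 K, ∅, none), legal_of_le le_rfl _⟩).1.2.2) ?_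
    exact (s.1 K ⟨(x.1 K, ∅, none), legal_of_le le_rfl _⟩).2
  have main : ∀ {o} (hd : IsDeco C K x W o), (∀ n, K + 2 ≤ n → n.bodd = false →
      ∀ h : (x.1 n, W, o) ∈ legal C K n, x.1 (n + 1) = (s.1 n ⟨_, h⟩).1.1) →
      ∃ z, Obeys false s z ∧ (forgetDeco C K).map z = x := by
    intro o hd h
    have hlow' : ∀ n (hn : n ≤ K), (decoRun hd).1 n = ⟨(x.1 n, ∅, none), legal_of_le hn _⟩ :=
      fun n hn => decoTree_ext (trunc_of_le x W o hn)
    refine ⟨decoRun hd, obeys_decoRun s hd (fun n hn => ?_) (fun _ => ?_) ?_, rfl⟩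
    · rcases le_or_gt n K with hk | hk
      · rw [hlow' n hk]
        exact hlow n hk hn
      · have hk2 : K + 2 ≤ n := by
          rcases Nat.lt_or_eq_of_le hk with h | h
          · omega
          · subst h
            simp [hK] at hn
        have e : trunc K x W o n = (x.1 n, W, o) := trunc_of_ge x W o hk2
        have hl : (x.1 n, W, o) ∈ legal C K n := e ▸ ((decoRun hd).1 n).2
        rw [h n hk2 hn hl]
        exact congrArg (fun t => (s.1 n t).1.1) (decoTree_ext e.symm)
    · rw [hlow' K le_rfl]
      rfl
    · simp [hK]
  by_cases hit : ∃ m, ⟨m, x.1 m⟩ ∈ aim C K W false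
  · set m := Nat.find hit with hm
    have hmW : ⟨m, x.1 m⟩ ∈ aim C K W false := Nat.find_spec hit
    have hd : IsDeco C K x W (some ⟨m, x.1 m⟩) :=
      ⟨h0, by rintro u ⟨⟩; exact ⟨hmW, rfl⟩, by simp⟩
    refine main hd fun n hn hb hl => ?_
    rcases le_or_gt m n with hmn | hmn
    · have e := hx n hb
      rw [playFalse_of_ge s (by omega),
        firstHit_eq_some x hmn hmW fun l hl => Nat.find_min hit hl, respond_of_mem _ _ hl] at e
      exact e
    · have hl' := (s.1 n ⟨_, hl⟩).2
      have e : (s.1 n ⟨_, hl⟩).1 = ((s.1 n ⟨_, hl⟩).1.1, W, some ⟨m, x.1 m⟩) :=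
        Prod.ext rfl (Prod.ext (strat_proposal s (by omega) _) (strat_answer s hn _))
      rw [e] at hl'
      exact ((legal_some hl').2 x rfl hmn).symm
  · push Not at hit
    have hplay : ∀ n, K + 1 ≤ n → n.bodd = false → x.1 (n + 1) =
        respond (s.1 n) ((attack false (aim C K W false)).1 n) (x.1 n) W none := fun n hn hb => by
      rw [hx n hb, playFalse_of_ge s hn, firstHit_eq_none x fun m _ => hit m]
    have h1 : ∀ n, K + 2 ≤ n → n.bodd = false → ∀ h : (x.1 n, W, none) ∈ legal C K n,
        x.1 (n + 1) = (s.1 n ⟨_, h⟩).1.1 := fun n hn hb h => by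
      rw [hplay n (by omega) hb, respond_of_mem _ _ h]
    refine main (isDeco_none s h0 h1 (fun n hn hw => ?_) ?_) h1
    · obtain ⟨m, -, hm⟩ := attack_spec false (aim C K W false) x n hw fun m hm hb hw => by
        rw [hplay m (by omega) hb, respond_of_notMem]
        exact fun hl => legal_draw (by omega) hl _ hw
      exact hit m hm
    · intro hw
      refine h0 ?_
      rw [← x.2 (K + 1)]
      exact hw.of_child (by simp [hK])

end Unravel

end GameTree

namespace GameTree

section Unravel

variable {T : GameTree} {C : Set (Run T)} {K : ℕ}

/-- The positions which a strategy of player `true` announces in response to some proposal at the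
position `q` of level `K + 1`. -/
def accepted (g : (decoTree C K).Pos (K + 1) → (decoTree C K).Pos (K + 2)) (q : T.Pos (K + 1)) :
    Set (Σ n, T.Pos n) :=
  {u | ∃ W, ∃ h : (q, W, none) ∈ legal C K (K + 1), (g ⟨_, h⟩).1.2.2 = some u}

/-- A proposal in response to which the position `o` is announced, or the proposal of everything
that is never announced. -/
noncomputable def proposal (g : (decoTree C K).Pos (K + 1) → (decoTree C K).Pos (K + 2))
    (q : T.Pos (K + 1)) (o : Option (Σ n, T.Pos n)) : Set (Σ n, T.Pos n) := by
  classical exact o.elim (accepted g q)ᶜ fun u => if h : u ∈ accepted g q then h.choose else ∅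

theorem proposal_some {g : (decoTree C K).Pos (K + 1) → (decoTree C K).Pos (K + 2)}
    {q : T.Pos (K + 1)} {u : Σ n, T.Pos n} (hu : u ∈ accepted g q) :
    ∃ h : (q, proposal g q (some u), none) ∈ legal C K (K + 1), (g ⟨_, h⟩).1.2.2 = some u := by
  have : proposal g q (some u) = hu.choose := dif_pos hu
  rw [this]
  exact hu.choose_spec

/-- The transfer of a strategy of player `true` for decorated positions. -/
noncomputable def playTrue (s : Strat (decoTree C K)) : Strat T :=
  ⟨fun n p =>
    let U := if K + 1 ≤ n then accepted (s.1 (K + 1)) ((thru p).1 (K + 1)) else ∅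
    let W := if K + 1 ≤ n then
      proposal (s.1 (K + 1)) ((thru p).1 (K + 1)) (firstHit U p) else ∅
    respond (s.1 n) ((attack true U).1 n) p W (firstHit U p),
  fun _ _ => par_respond s _ _ _ _⟩

theorem playTrue_of_le (s : Strat (decoTree C K)) {n : ℕ} (hn : n ≤ K) (p : T.Pos n) :
    (playTrue s).1 n p = (s.1 n ⟨(p, ∅, none), legal_of_le hn p⟩).1.1 := by
  simp only [playTrue, show ¬ K + 1 ≤ n by omega, if_false, firstHit_empty]
  exact respond_of_mem _ _ _

theorem playTrue_of_ge (s : Strat (decoTree C K)) {n : ℕ} (hn : K + 1 ≤ n) (x : Run T) :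
    (playTrue s).1 n (x.1 n) =
      respond (s.1 n) ((attack true (accepted (s.1 (K + 1)) (x.1 (K + 1)))).1 n) (x.1 n)
        (proposal (s.1 (K + 1)) (x.1 (K + 1))
          (firstHit (accepted (s.1 (K + 1)) (x.1 (K + 1))) (x.1 n)))
        (firstHit (accepted (s.1 (K + 1)) (x.1 (K + 1))) (x.1 n)) := by
  simp only [playTrue, hn, if_true, thru_of_le x hn]

theorem playTrue_local (s s' : Strat (decoTree C K)) (n : ℕ) (h : ∀ m ≤ n, s.1 m = s'.1 m) :
    (playTrue s).1 n = (playTrue s').1 n := by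
  by_cases hn : K + 1 ≤ n
  · simp only [playTrue, hn, if_true, h n le_rfl, h (K + 1) hn]
  · simp only [playTrue, hn, if_false, h n le_rfl]

theorem playTrue_lift (hK : K.bodd = false) (s : Strat (decoTree C K)) (x : Run T)
    (hx : Obeys true (playTrue s) x) :
    ∃ z, Obeys true s z ∧ (forgetDeco C K).map z = x := by
  classical
  set U := accepted (s.1 (K + 1)) (x.1 (K + 1)) with hU
  have main : ∀ {W o} (hd : IsDeco C K x W o),
      (∀ h : (x.1 (K + 1), W, none) ∈ legal C K (K + 1),
        (s.1 (K + 1) ⟨_, h⟩).1.1 = x.1 (K + 2) ∧ (s.1 (K + 1) ⟨_, h⟩).1.2.2 = o) →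
      (∀ n, K + 2 ≤ n → n.bodd = true →
        ∀ h : (x.1 n, W, o) ∈ legal C K n, x.1 (n + 1) = (s.1 n ⟨_, h⟩).1.1) →
      ∃ z, Obeys true s z ∧ (forgetDeco C K).map z = x := by
    intro W o hd h' h
    have e1 : trunc K x W o (K + 1) = (x.1 (K + 1), W, none) := trunc_succ x W o
    have hl1 : (x.1 (K + 1), W, none) ∈ legal C K (K + 1) := e1 ▸ ((decoRun hd).1 (K + 1)).2
    have e2 : (decoRun hd).1 (K + 1) = ⟨_, hl1⟩ := decoTree_ext e1
    refine ⟨decoRun hd, obeys_decoRun s hd (fun n hn => ?_) ?_ (fun _ => ?_), rfl⟩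
    · rcases le_or_gt n K with hk | hk
      · rw [show (decoRun hd).1 n = ⟨(x.1 n, ∅, none), legal_of_le hk _⟩ from
          decoTree_ext (trunc_of_le x W o hk), hx n hn, playTrue_of_le s hk]
      · rcases Nat.lt_or_eq_of_le hk with hk2 | rfl
        · have e : trunc K x W o n = (x.1 n, W, o) := trunc_of_ge x W o hk2
          have hl : (x.1 n, W, o) ∈ legal C K n := e ▸ ((decoRun hd).1 n).2
          rw [h n hk2 hn hl]
          exact congrArg (fun t => (s.1 n t).1.1) (decoTree_ext e.symm)
        · rw [e2]
          exact (h' hl1).1.symm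
    · simp [hK]
    · rw [e2]
      exact (h' hl1).2.symm
  by_cases hit : ∃ m, ⟨m, x.1 m⟩ ∈ U
  · set m := Nat.find hit with hm
    have hmU : ⟨m, x.1 m⟩ ∈ U := Nat.find_spec hit
    obtain ⟨hl1, hs⟩ := proposal_some hmU
    set W := proposal (s.1 (K + 1)) (x.1 (K + 1)) (some ⟨m, x.1 m⟩) with hW
    have hl2 := (s.1 (K + 1) ⟨_, hl1⟩).2
    have e : (s.1 (K + 1) ⟨_, hl1⟩).1 = ((s.1 (K + 1) ⟨_, hl1⟩).1.1, W, some ⟨m, x.1 m⟩) :=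
      Prod.ext rfl (Prod.ext (strat_proposal s le_rfl _) hs)
    rw [e] at hl2
    obtain ⟨hmW, hforced⟩ := legal_some hl2
    have hKm : K + 2 ≤ m := hmW.1.1
    have hd : IsDeco C K x W (some ⟨m, x.1 m⟩) :=
      ⟨legal_not_win hl1, by rintro u ⟨⟩; exact ⟨hmW, rfl⟩, by simp⟩
    refine main hd (fun _ => ⟨hforced x rfl hKm, hs⟩) fun n hn hb hl => ?_
    rcases le_or_gt m n with hmn | hmn
    · have e := hx n hb
      rw [playTrue_of_ge s (by omega),
        firstHit_eq_some x hmn hmU fun l hl => Nat.find_min hit hl, respond_of_mem _ _ hl] at e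
      exact e
    · have hl' := (s.1 n ⟨_, hl⟩).2
      have e : (s.1 n ⟨_, hl⟩).1 = ((s.1 n ⟨_, hl⟩).1.1, W, some ⟨m, x.1 m⟩) :=
        Prod.ext rfl (Prod.ext (strat_proposal s (by omega) _) (strat_answer s hn _))
      rw [e] at hl'
      exact ((legal_some hl').2 x rfl hmn).symm
  · push Not at hit
    have hUE : U ⊆ escape C K := by
      rintro u ⟨W, h, hs⟩
      have hl2 := (s.1 (K + 1) ⟨_, h⟩).2
      have e : (s.1 (K + 1) ⟨_, h⟩).1 = ((s.1 (K + 1) ⟨_, h⟩).1.1, W, some u) :=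
        Prod.ext rfl (Prod.ext (strat_proposal s le_rfl _) hs)
      rw [e] at hl2
      exact (legal_some hl2).1.1
    have haim : aim C K Uᶜ true = U := by
      ext u
      have := @hUE u
      simp only [aim, if_true, Set.mem_sdiff, Set.mem_compl_iff, not_not]
      tauto
    have hplay : ∀ n, K + 1 ≤ n → n.bodd = true → x.1 (n + 1) =
        respond (s.1 n) ((attack true U).1 n) (x.1 n) Uᶜ none := fun n hn hb => by
      rw [hx n hb, playTrue_of_ge s hn, firstHit_eq_none x fun m _ => hit m]
      rfl
    have hnw : ∀ n, K + 1 ≤ n → ¬ Win true (aim C K Uᶜ true) n (x.1 n) := by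
      intro n hn hw
      rw [haim] at hw
      obtain ⟨m, -, hm⟩ := attack_spec true U x n hw fun m hm hb hw => by
        rw [hplay m (by omega) hb, respond_of_notMem]
        intro hl
        rcases Nat.lt_or_eq_of_le (hn.trans hm) with h | rfl
        · exact legal_draw h hl true (by rwa [haim])
        · exact legal_not_win hl (by rwa [haim])
      exact hit m hm
    have h1 : ∀ n, K + 2 ≤ n → n.bodd = true → ∀ h : (x.1 n, Uᶜ, none) ∈ legal C K n,
        x.1 (n + 1) = (s.1 n ⟨_, h⟩).1.1 := fun n hn hb h => by
      rw [hplay n (by omega) hb, respond_of_mem _ _ h]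
    have hl1 : (x.1 (K + 1), Uᶜ, none) ∈ legal C K (K + 1) := by
      obtain ⟨y, o, hd, hy⟩ := exists_isDeco (hnw (K + 1) le_rfl)
      exact ⟨y, _, o, hd, by rw [trunc_succ, hy]⟩
    have hfst : x.1 (K + 2) = (s.1 (K + 1) ⟨_, hl1⟩).1.1 := by
      rw [hplay (K + 1) le_rfl (by simp [hK]), respond_of_mem _ _ hl1]
    have hnone : (s.1 (K + 1) ⟨_, hl1⟩).1.2.2 = none := by
      by_contra hne
      obtain ⟨u, hu⟩ := Option.ne_none_iff_exists'.1 hne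
      have hl2 := (s.1 (K + 1) ⟨_, hl1⟩).2
      have e : (s.1 (K + 1) ⟨_, hl1⟩).1 = ((s.1 (K + 1) ⟨_, hl1⟩).1.1, Uᶜ, some u) :=
        Prod.ext rfl (Prod.ext (strat_proposal s le_rfl _) hu)
      rw [e] at hl2
      exact (legal_some hl2).1.2 ⟨_, hl1, hu⟩
    have hdraw : Draw C K Uᶜ (K + 2) (x.1 (K + 2)) := by
      have hl2 := (s.1 (K + 1) ⟨_, hl1⟩).2
      have e : (s.1 (K + 1) ⟨_, hl1⟩).1 = (x.1 (K + 2), Uᶜ, none) :=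
        Prod.ext hfst.symm (Prod.ext (strat_proposal s le_rfl _) hnone)
      rw [e] at hl2
      exact legal_draw le_rfl hl2
    exact main (isDeco_none s (hnw _ le_rfl) h1 (fun n hn => hnw n (by omega)) (hdraw _))
      (fun _ => ⟨hfst.symm, hnone⟩) h1

/-- The tree of decorated positions covers the original tree. -/
noncomputable def decoCovering {k : ℕ} (hk : k ≤ K) (hK : K.bodd = false) :
    Covering k (decoTree C K) T where
  toHom := forgetDeco C K
  bij n hn := by
    have h : ∀ t : (decoTree C K).Pos n, t.1 = (t.1.1, ∅, none) := fun t => by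
      obtain ⟨x, W, o, -, h⟩ := t.2
      rw [← h, trunc_of_le x W o (by omega)]
    refine ⟨fun t t' e => decoTree_ext ?_,
      fun p => ⟨⟨(p, ∅, none), legal_of_le (by omega) p⟩, rfl⟩⟩
    rw [h t, h t']
    exact Prod.ext e rfl
  φ b s := if b then playTrue s else playFalse s
  local_eq b s s' n h := by
    cases b
    · exact playFalse_local s s' n h
    · exact playTrue_local s s' n h
  agree b s n p hn := by
    have h : p = ⟨(p.1.1, ∅, none), legal_of_le (by omega) _⟩ := by
      obtain ⟨x, W, o, -, h⟩ := p.2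
      refine decoTree_ext ?_
      change p.1 = (p.1.1, _, _)
      rw [← h, trunc_of_le x W o (by omega)]
    conv_rhs => rw [h]
    cases b
    · exact playFalse_of_le s (by omega) _
    · exact playTrue_of_le s (by omega) _
  lift b s x hx := by
    cases b
    · exact playFalse_lift hK s x hx
    · exact playTrue_lift hK s x hx

end Unravel

/-- Closed sets can be unraveled: there is a covering for which the preimage is clopen. -/
theorem exists_covering_of_isClosed {T : GameTree} {C : Set (Run T)} (hC : OpenSet Cᶜ) (k : ℕ) :
    ∃ (T' : GameTree) (D : Covering k T' T),
      OpenSet (D.map ⁻¹' C) ∧ OpenSet (D.map ⁻¹' C)ᶜ := by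
  refine ⟨decoTree C (2 * k), decoCovering (by omega) (by simp), fun z hz => ?_, fun z hz => ?_⟩
  · refine ⟨2 * k + 2, fun y hy => (mem_iff_none hC y).2 ?_⟩
    rw [hy]
    exact (mem_iff_none hC z).1 hz
  · refine ⟨2 * k + 2, fun y hy hyC => hz ((mem_iff_none hC z).2 ?_)⟩
    rw [← hy]
    exact (mem_iff_none hC y).1 hyC

end GameTree

namespace GameTree

variable {T T' T'' : GameTree}

/-- The identity map of a game tree. -/
def Hom.id (T : GameTree) : Hom T T := ⟨fun _ p => p, fun _ _ => rfl⟩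

/-- A set of runs which, even after pulling it back to another game tree, becomes clopen in some
covering that is trivial up to any prescribed level. -/
def Unravelable (A : Set (Run T)) : Prop :=
  ∀ (T' : GameTree) (F : Hom T' T) (k : ℕ), ∃ (T'' : GameTree) (D : Covering k T'' T'),
    OpenSet ((F.comp D.toHom).map ⁻¹' A) ∧ OpenSet ((F.comp D.toHom).map ⁻¹' A)ᶜ

theorem OpenSet.unravelable {A : Set (Run T)} (h : OpenSet Aᶜ) : Unravelable A := fun _ F k =>
  exists_covering_of_isClosed (C := F.map ⁻¹' A) (h.preimage F) k

theorem Unravelable.compl {A : Set (Run T)} (h : Unravelable A) : Unravelable Aᶜ :=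
  fun T' F k => by
    obtain ⟨T'', D, h1, h2⟩ := h T' F k
    refine ⟨T'', D, h2, ?_⟩
    rwa [← Set.preimage_compl, compl_compl]

theorem OpenSet.iUnion {A : ℕ → Set (Run T)} (h : ∀ i, OpenSet (A i)) : OpenSet (⋃ i, A i) :=
  fun x hx => by
    obtain ⟨i, hi⟩ := Set.mem_iUnion.1 hx
    obtain ⟨n, hn⟩ := h i x hi
    exact ⟨n, fun y hy => Set.mem_iUnion.2 ⟨i, hn y hy⟩⟩

theorem Unravelable.iUnion {A : ℕ → Set (Run T)} (h : ∀ i, Unravelable (A i)) :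
    Unravelable (⋃ i, A i) := by
  intro T' F k
  choose S D hD hD' using fun (i : ℕ) (S : Σ S : GameTree, Hom S T') =>
    h i S.1 (F.comp S.2) (k + i)
  let st : ℕ → Σ S : GameTree, Hom S T' := fun n =>
    Nat.rec ⟨T', Hom.id T'⟩ (fun i R => ⟨S i R, R.2.comp (D i R).toHom⟩) n
  let C : ∀ i, Covering (k + i) (st (i + 1)).1 (st i).1 := fun i => D i (st i)
  let L : GameTree := limitTree (T := fun i => (st i).1) C
  let E : Covering k L T' := limitCovering (T := fun i => (st i).1) C
  let π : ∀ i, Hom L (st i).1 := limitProj (T := fun i => (st i).1) C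
  have hmap : ∀ i (x : Run L), (st i).2.map ((π i).map x) =
      E.map x := by
    intro i x
    induction i with
    | zero => rfl
    | succ i ih =>
      exact (congrArg (st i).2.map (map_limitProj_succ (T := fun i => (st i).1) C i x)).trans ih
  have hA : ∀ i, (F.comp E.toHom).map ⁻¹' A i = (π (i + 1)).map ⁻¹'
      ((F.comp (st i).2).comp (D i (st i)).toHom).map ⁻¹' A i := by
    intro i
    ext x
    have : (F.comp E.toHom).map x =
        ((F.comp (st i).2).comp (D i (st i)).toHom).map ((π (i + 1)).map x) :=
      congrArg F.map (hmap (i + 1) x).symm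
    rw [Set.mem_preimage, this]
    rfl
  have hopen : OpenSet ((F.comp E.toHom).map ⁻¹' ⋃ i, A i) := by
    rw [Set.preimage_iUnion]
    refine OpenSet.iUnion fun i => ?_
    rw [hA]
    exact (hD i (st i)).preimage _
  obtain ⟨T'', D', h1, h2⟩ := exists_covering_of_isClosed
    (C := ((F.comp E.toHom).map ⁻¹' ⋃ i, A i)ᶜ) (by rwa [compl_compl]) k
  refine ⟨T'', E.comp D', ?_, h1⟩
  rw [← Set.preimage_compl, compl_compl] at h2
  exact h2

theorem Unravelable.determined {A : Set (Run T)} (h : Unravelable A)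
    (h0 : Subsingleton (T.Pos 0)) : Determined A := by
  obtain ⟨T'', D, h1, -⟩ := h T (Hom.id T) 0
  have h0' : Subsingleton (T''.Pos 0) :=
    ⟨fun p q => (D.bij 0 le_rfl).1 (Subsingleton.elim _ _)⟩
  rcases determined_of_openSet h1 h0' with ⟨s, hs⟩ | ⟨s, hs⟩
  · refine Or.inl ⟨D.φ false s, fun x hx => ?_⟩
    obtain ⟨z, hz, rfl⟩ := D.lift false s x hx
    exact hs z hz
  · refine Or.inr ⟨D.φ true s, fun x hx => ?_⟩
    obtain ⟨z, hz, rfl⟩ := D.lift true s x hx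
    exact hs z hz

/-- Borel determinacy, for payoff sets given by a Borel set of functions whose values are read off
from finite initial segments of the run. -/
theorem determined_of_measurableSet {G : Type} (h0 : Subsingleton (T.Pos 0))
    (ev : Run T → G → ℕ) (hev : ∀ g x, ∃ n, ∀ y : Run T, y.1 n = x.1 n → ev y g = ev x g)
    {M : Set (G → ℕ)} (hM : MeasurableSet M) : Determined (ev ⁻¹' M) := by
  have hopen : ∀ g (s : Set ℕ), OpenSet {x : Run T | ev x g ∈ s} := fun g s x hx => by
    obtain ⟨n, hn⟩ := hev g x
    refine ⟨n, fun y hy => ?_⟩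
    rw [Set.mem_ofPred_eq, hn y hy]
    exact hx
  let _ : MeasurableSpace (Run T) :=
    { MeasurableSet' := Unravelable
      measurableSet_empty := OpenSet.unravelable fun x _ => ⟨0, fun _ _ h => h⟩
      measurableSet_compl := fun _ h => h.compl
      measurableSet_iUnion := fun _ h => Unravelable.iUnion h }
  have hmeas : Measurable ev := measurable_pi_iff.2 fun g =>
    measurable_to_countable' fun n => OpenSet.unravelable (hopen g {n}ᶜ)
  exact Unravelable.determined (hmeas hM) h0

end GameTree

namespace FreeProd

open Monoid Monoid.CoprodI

variable {ι : Type} {H : ι → Type} [∀ i, Group (H i)] [DecidableEq ι] [∀ i, DecidableEq (H i)]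

/-- The first letter of `g` if it lies in the `i`-th factor, and `1` otherwise. -/
def hd (i : ι) (g : CoprodI H) : H i := (Word.equivPair i (Word.equiv g)).head

/-- The element `g` with its first letter removed if that lies in the `i`-th factor. -/
def tl (i : ι) (g : CoprodI H) : CoprodI H := (Word.equivPair i (Word.equiv g)).tail.prod

/-- The number of letters of the reduced word representing `g`. -/
def len (g : CoprodI H) : ℕ := (Word.equiv g).toList.length

theorem equiv_mul (m g : CoprodI H) : Word.equiv (m * g) = m • Word.equiv g := by
  change (m * g) • (Word.empty : Word H) = m • g • (Word.empty : Word H)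
  exact mul_smul _ _ _

theorem prod_equiv (g : CoprodI H) : (Word.equiv g).prod = g := Word.equiv.symm_apply_apply g

theorem equiv_tl (i : ι) (g : CoprodI H) :
    Word.equiv (tl i g) = (Word.equivPair i (Word.equiv g)).tail := Word.equiv.apply_symm_apply _

theorem rcons_equivPair (i : ι) (g : CoprodI H) :
    Word.rcons (Word.equivPair i (Word.equiv g)) = Word.equiv g :=
  (Word.equivPair i).symm_apply_apply _

theorem hd_mul_tl (i : ι) (g : CoprodI H) : of (hd i g) * tl i g = g := by
  rw [hd, tl, ← Word.prod_rcons, rcons_equivPair, prod_equiv]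

theorem equivPair_of_mul (i : ι) (m : H i) (g : CoprodI H) :
    Word.equivPair i (Word.equiv (of m * g)) = ⟨m * hd i g, (Word.equivPair i (Word.equiv g)).tail,
      (Word.equivPair i (Word.equiv g)).fstIdx_ne⟩ := by
  rw [equiv_mul, Word.equivPair_smul_same]
  rfl

@[simp] theorem hd_of_mul (i : ι) (m : H i) (g : CoprodI H) : hd i (of m * g) = m * hd i g := by
  rw [hd, equivPair_of_mul]

@[simp] theorem tl_of_mul (i : ι) (m : H i) (g : CoprodI H) : tl i (of m * g) = tl i g := by
  rw [tl, equivPair_of_mul, tl]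

@[simp] theorem hd_tl (i : ι) (g : CoprodI H) : hd i (tl i g) = 1 := by
  have h := hd_of_mul i (hd i g) (tl i g)
  rw [hd_mul_tl] at h
  exact mul_eq_left.1 h.symm

theorem tl_of_hd {i : ι} {g : CoprodI H} (h : hd i g = 1) : tl i g = g := by
  have := hd_mul_tl i g
  rwa [h, map_one, one_mul] at this

theorem len_eq (i : ι) (g : CoprodI H) :
    len g = len (tl i g) + if hd i g = 1 then 0 else 1 := by
  have h1 := congrArg (fun w => w.toList.length) (rcons_equivPair i g)
  rw [len, len, equiv_tl, ← h1]
  by_cases h : (Word.equivPair i (Word.equiv g)).head = 1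
  · rw [Word.rcons, dif_pos h, if_pos (show hd i g = 1 from h), Nat.add_zero]
  · rw [Word.rcons, dif_neg h, if_neg (show ¬hd i g = 1 from h)]
    rfl

theorem hd_eq_one {i j : ι} {g : CoprodI H} (h : hd i g ≠ 1) (hij : j ≠ i) : hd j g = 1 := by
  have h1 := rcons_equivPair i g
  have h2 : (Word.equivPair i (Word.equiv g)).head ≠ 1 := h
  rw [Word.rcons, dif_neg h2] at h1
  rw [hd, Word.equivPair_eq_of_fstIdx_ne]
  rw [← h1, Word.fstIdx_cons]
  simpa using hij.symm

theorem equiv_one : Word.equiv (1 : CoprodI H) = Word.empty := by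
  change (1 : CoprodI H) • (Word.empty : Word H) = Word.empty
  exact one_smul _ _

@[simp] theorem hd_one (i : ι) : hd i (1 : CoprodI H) = 1 := by
  rw [hd, equiv_one, Word.equivPair_eq_of_fstIdx_ne]
  simp [Word.fstIdx, Word.empty]

@[simp] theorem tl_one (i : ι) : tl i (1 : CoprodI H) = 1 := tl_of_hd (hd_one i)

@[simp] theorem hd_of (i : ι) (m : H i) : hd i (of m) = m := by
  have := hd_of_mul i m 1
  rwa [mul_one, hd_one, mul_one] at this

@[simp] theorem tl_of (i : ι) (m : H i) : tl i (of m) = 1 := by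
  have := tl_of_mul i m 1
  rwa [mul_one, tl_one] at this

theorem hd_of_ne {i j : ι} (hij : j ≠ i) (m : H i) : hd j (of m) = 1 := by
  by_cases hm : m = 1
  · simp [hm]
  · exact hd_eq_one (by rwa [hd_of]) hij

theorem len_eq_zero {g : CoprodI H} : len g = 0 ↔ g = 1 := by
  constructor
  · intro h
    have h1 : Word.equiv g = Word.empty := Word.ext (List.length_eq_zero_iff.1 h)
    rw [← prod_equiv g, h1, Word.prod_empty]
  · rintro rfl
    rw [len, equiv_one]
    rfl

theorem exists_hd_ne {g : CoprodI H} (h : g ≠ 1) : ∃ i, hd i g ≠ 1 := by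
  by_contra! hcon
  refine h ?_
  rw [← prod_equiv g]
  induction hw : Word.equiv g using Word.consRecOn with
  | empty => rfl
  | cons i m w h1 h2 _ =>
    have h3 := hcon i
    have h4 : Word.cons m w h1 h2 = (Word.equivPair i).symm ⟨m, w, h1⟩ := by
      rw [Word.equivPair_symm, Word.rcons, dif_neg h2]
    rw [hd, hw, h4, Equiv.apply_symm_apply] at h3
    exact absurd h3 h2

theorem len_tl_lt {i : ι} {g : CoprodI H} (h : hd i g ≠ 1) : len (tl i g) < len g := by
  rw [len_eq i g, if_neg h]
  exact Nat.lt_succ_self _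

/-- Multiplication on the right by an element of a factor does not change the first letter of a
word, unless the word has no other letters. -/
theorem hd_mul_of {k : ι} (m : H k) (g : CoprodI H) (i : ι) :
    hd i (g * of m) = hd i g ∨ (tl i g = 1 ∧ tl i (g * of m) = 1) := by
  induction hn : len g using Nat.strong_induction_on generalizing g i with
  | _ n ih =>
    subst hn
    by_cases hg : g = 1
    · subst hg
      by_cases hik : i = k
      · subst hik
        simp
      · left
        rw [one_mul, hd_of_ne hik, hd_one]
    obtain ⟨j, hj⟩ := exists_hd_ne hg
    have hmul : g * of m = of (hd j g) * (tl j g * of m) := by rw [← mul_assoc, hd_mul_tl]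
    have h := ih _ (len_tl_lt hj) (tl j g) j rfl
    rw [hd_tl, tl_of_hd (hd_tl j g)] at h
    by_cases hij : i = j
    · subst hij
      rcases h with h | ⟨h1, h2⟩
      · left
        rw [hmul, hd_of_mul, h, mul_one]
      · right
        rw [hmul, tl_of_mul]
        exact ⟨h1, h2⟩
    · left
      rw [hd_eq_one hj hij]
      rcases h with h | ⟨h1, h2⟩
      · refine hd_eq_one (i := j) ?_ hij
        rwa [hmul, hd_of_mul, h, mul_one]
      · rw [← hd_mul_tl j (g * of m), hmul, tl_of_mul, h2, mul_one, hd_of_ne hij]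

theorem len_of_mul_le (i : ι) (m : H i) (g : CoprodI H) : len (of m * g) ≤ len g + 1 := by
  rw [len_eq i (of m * g), len_eq i g, tl_of_mul]
  split_ifs <;> omega

theorem len_mul_le (g g' : CoprodI H) : len (g * g') ≤ len g + len g' := by
  induction hn : len g using Nat.strong_induction_on generalizing g with
  | _ n ih =>
    subst hn
    by_cases hg : g = 1
    · simp [hg]
    · obtain ⟨j, hj⟩ := exists_hd_ne hg
      have h1 := ih _ (len_tl_lt hj) (tl j g) rfl
      have h2 := len_of_mul_le j (hd j g) (tl j g * g')
      rw [← mul_assoc, hd_mul_tl] at h2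
      have h3 := len_tl_lt hj
      omega

theorem len_of_le (i : ι) (m : H i) : len (of m) ≤ 1 := by
  have := len_of_mul_le i m 1
  rwa [mul_one, len_eq_zero.2 rfl] at this

theorem len_inv_le (g : CoprodI H) : len g⁻¹ ≤ len g := by
  induction hn : len g using Nat.strong_induction_on generalizing g with
  | _ n ih =>
    subst hn
    by_cases hg : g = 1
    · simp [hg]
    · obtain ⟨j, hj⟩ := exists_hd_ne hg
      have h1 := ih _ (len_tl_lt hj) (tl j g) rfl
      have h2 := len_mul_le (tl j g)⁻¹ (of (hd j g)⁻¹)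
      rw [map_inv, ← mul_inv_rev, hd_mul_tl] at h2
      have h3 := len_tl_lt hj
      have h4 := len_of_le j (hd j g)⁻¹
      rw [map_inv] at h4
      omega

theorem len_inv (g : CoprodI H) : len g⁻¹ = len g :=
  le_antisymm (len_inv_le g) (by simpa using len_inv_le g⁻¹)

end FreeProd

theorem shift_one {G X : Type} [Group G] (y : G → X) : shift 1 y = y := by
  funext β
  simp [shift]

theorem shift_mul {G X : Type} [Group G] (a b : G) (y : G → X) :
    shift (a * b) y = shift a (shift b y) := by
  funext β
  simp [shift, mul_assoc]

theorem measurable_shift {G : Type} [Group G] (a : G) : Measurable (shift a : (G → ℕ) → G → ℕ) :=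
  measurable_pi_iff.2 fun _ => measurable_pi_apply _

namespace FreeProd

open Monoid Monoid.CoprodI

instance countable {ι : Type} {H : ι → Type} [∀ i, Group (H i)] [Countable ι]
    [∀ i, Countable (H i)] : Countable (CoprodI H) := by
  classical
  have h : Function.Injective fun g : CoprodI H => (Word.equiv g).toList := fun g g' h =>
    Word.equiv.injective (Word.ext h)
  exact h.countable

variable {H : Bool → Type} [∀ i, Group (H i)]

/-- The labellings which are injective on the left cosets of the two factors. -/
def Proper (y : CoprodI H → ℕ) : Prop :=
  ∀ (g : CoprodI H) (k : Bool) (m : H k), y g = y (g * of m) → m = 1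

theorem Proper.shift {y : CoprodI H → ℕ} (hy : Proper y) (a : CoprodI H) : Proper (shift a y) :=
  fun g k m h => hy (a⁻¹ * g) k m (by simpa [_root_.shift, mul_assoc] using h)

theorem Proper.eq_one {y : CoprodI H → ℕ} (hy : Proper y) {k : Bool} {m : H k}
    (h : _root_.shift (of m) y 1 = y 1) : m = 1 := by
  have := hy 1 k m⁻¹ (by simpa [_root_.shift] using h.symm)
  simpa using this

/-- One may pass from the state `(x, i)` to `(h • x, !i)` whenever `h` is in the factor `!i` and
`h • x` and `x` take different values at `1`. -/
def Step (s t : (CoprodI H → ℕ) × Bool) : Prop :=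
  t.2 = !s.2 ∧ ∃ h : H t.2, t.1 = shift (of h) s.1 ∧ t.1 1 ≠ s.1 1

theorem step_iff {x x' : CoprodI H → ℕ} {i j : Bool} :
    Step (x, i) (x', j) ↔ j = !i ∧ ∃ h : H j, x' = shift (of h) x ∧ x' 1 ≠ x 1 := Iff.rfl

/-- There is a chain of transitions from `s` to `t` with the given sequence of labels. -/
def Walk : List (ℕ × Bool) → (CoprodI H → ℕ) × Bool → (CoprodI H → ℕ) × Bool → Prop
  | [], s, t => s = t
  | a :: l, s, t => a = (s.1 1, s.2) ∧ ∃ s', Step s s' ∧ Walk l s' t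

theorem walk_append {l l' : List (ℕ × Bool)} {s t : (CoprodI H → ℕ) × Bool} :
    Walk (l ++ l') s t ↔ ∃ u, Walk l s u ∧ Walk l' u t := by
  induction l generalizing s with
  | nil => simp [Walk]
  | cons a l ih =>
    simp only [List.cons_append, Walk, ih]
    constructor
    · rintro ⟨h1, s', h2, u, h3, h4⟩
      exact ⟨u, ⟨h1, s', h2, h3⟩, h4⟩
    · rintro ⟨u, ⟨h1, s', h2, h3⟩, h4⟩
      exact ⟨h1, s', h2, u, h3, h4⟩

/-- The sequence of labels `l` is read along a nontrivial closed walk from `s`. -/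
def Loop (l : List (ℕ × Bool)) (s : (CoprodI H → ℕ) × Bool) : Prop := l ≠ [] ∧ Walk l s s

theorem Loop.head {l : List (ℕ × Bool)} {s : (CoprodI H → ℕ) × Bool} (h : Loop l s) :
    l.head? = some (s.1 1, s.2) := by
  rcases l with _ | ⟨a, l⟩
  · exact absurd rfl h.1
  · rw [List.head?_cons, h.2.1]

theorem Loop.rotate {l : List (ℕ × Bool)} {s : (CoprodI H → ℕ) × Bool} (h : Loop l s) :
    ∃ s', Step s s' ∧ Loop (l.rotate 1) s' := by
  rcases l with _ | ⟨a, l⟩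
  · exact absurd rfl h.1
  · obtain ⟨-, h1, s', h2, h3⟩ := h
    refine ⟨s', h2, by simp, ?_⟩
    rw [List.rotate_cons_succ, List.rotate_zero]
    exact walk_append.2 ⟨s, h3, h1, s', h2, rfl⟩

/-- A code `(n, c, k)` of a state `s` says that after `n` transitions one can get from `s` to a
state from which the `k`-th rotation of the `c`-th sequence of labels is read along a loop. -/
def Coded : ℕ → ℕ → ℕ → (CoprodI H → ℕ) × Bool → Prop
  | 0, c, k, s => Loop (((Encodable.decode c : Option (List (ℕ × Bool))).getD []).rotate k) s
  | n + 1, c, k, s => ∃ s', Step s s' ∧ Coded n c k s'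

theorem Coded.step {n c k : ℕ} {s : (CoprodI H → ℕ) × Bool} (h : Coded n c k s) :
    ∃ s', Step s s' ∧ Coded (n - 1) c (if n = 0 then k + 1 else k) s' := by
  rcases n with _ | n
  · obtain ⟨s', h1, h2⟩ := Loop.rotate h
    rw [List.rotate_rotate] at h2
    exact ⟨s', h1, h2⟩
  · exact h

/-- The state `s` has the code `m`; codes are ordered lexicographically. -/
def HasCode (m : ℕ ×ₗ ℕ ×ₗ ℕ) (s : (CoprodI H → ℕ) × Bool) : Prop :=
  Coded (ofLex m).1 (ofLex (ofLex m).2).1 (ofLex (ofLex m).2).2 s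

/-- The state `(x, i)` has a code which is minimal among the codes of the states `(h • x, i)` for
`h` in the factor `i`. -/
def Claimed (s : (CoprodI H → ℕ) × Bool) : Prop :=
  ∃ m, HasCode m s ∧ ∀ (h : H s.2) (m' : ℕ ×ₗ ℕ ×ₗ ℕ), HasCode m' (shift (of h) s.1, s.2) → m ≤ m'

/-- The code obtained after a transition. -/
def nextCode (n c k : ℕ) : ℕ ×ₗ ℕ ×ₗ ℕ := toLex (n - 1, toLex (c, if n = 0 then k + 1 else k))

theorem not_claimed_both (x : CoprodI H → ℕ) (i : Bool) (h1 : Claimed (x, i))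
    (h2 : Claimed (x, !i)) : False := by
  obtain ⟨m, hm, hmin⟩ := h1
  obtain ⟨m', hm', hmin'⟩ := h2
  obtain ⟨n, c, k⟩ := m
  obtain ⟨n', c', k'⟩ := m'
  change Coded n c k _ at hm
  change Coded n' c' k' _ at hm'
  obtain ⟨⟨x1, j1⟩, h1, hs⟩ := hm.step
  obtain ⟨⟨x2, j2⟩, h2, hs'⟩ := hm'.step
  obtain ⟨rfl, h, rfl, hne⟩ := step_iff.1 h1
  obtain ⟨hj, h', rfl, hne'⟩ := step_iff.1 h2
  obtain rfl : j2 = i := by rw [hj, Bool.not_not]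
  have e1 := hmin' h (nextCode n c k) hs
  have e2 := hmin h' (nextCode n' c' k') hs'
  change toLex (n', toLex (c', k')) ≤ _ at e1
  change toLex (n, toLex (c, k)) ≤ _ at e2
  simp only [nextCode, Prod.Lex.toLex_le_toLex] at e1 e2
  have hn : n = 0 := by
    by_contra hn
    by_cases hn' : n' = 0
    · simp only [hn'] at e2
      omega
    · omega
  have hn' : n' = 0 := by omega
  subst hn hn'
  have hc : c = c' := by omega
  subst hc
  simp only [if_true] at e1 e2 hs hs'
  have hk : k = k' ∨ k' = k + 1 ∨ k = k' + 1 := by omega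
  rcases hk with rfl | rfl | rfl
  · have := (Loop.head hm).symm.trans (Loop.head hm')
    simp at this
  · have := (Loop.head hs).symm.trans (Loop.head hm')
    simp only [Option.some.injEq, Prod.mk.injEq] at this
    exact hne this.1
  · have := (Loop.head hs').symm.trans (Loop.head hm)
    simp only [Option.some.injEq, Prod.mk.injEq] at this
    exact hne' this.1

/-- The state `s` has some code. -/
def Reach (s : (CoprodI H → ℕ) × Bool) : Prop := ∃ m, HasCode m s

theorem Loop.reach {l : List (ℕ × Bool)} {s : (CoprodI H → ℕ) × Bool} (h : Loop l s) :
    Reach s := by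
  refine ⟨toLex (0, toLex (Encodable.encode l, 0)), ?_⟩
  change Loop (((Encodable.decode (Encodable.encode l) : Option (List (ℕ × Bool))).getD []).rotate 0) s
  rwa [Encodable.encodek, Option.getD_some, List.rotate_zero]

theorem reach_iff {s : (CoprodI H → ℕ) × Bool} : Reach s ↔ ∃ s', Step s s' ∧ Reach s' := by
  constructor
  · rintro ⟨m, hm⟩
    obtain ⟨s', h1, h2⟩ := Coded.step hm
    exact ⟨s', h1, nextCode _ _ _, h2⟩
  · rintro ⟨s', h1, ⟨n, c, k⟩, h2⟩
    exact ⟨toLex (n + 1, toLex (c, k)), s', h1, h2⟩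

/-- For either factor some translate of `x` by an element of it has a code. -/
def Good (x : CoprodI H → ℕ) : Prop := ∀ i, ∃ h : H i, Reach (shift (of h) x, i)

theorem step_of {y : CoprodI H → ℕ} (hy : Proper y) {i j : Bool} (hij : j = !i) {h : H j}
    (hh : h ≠ 1) : Step (y, i) (shift (of h) y, j) :=
  ⟨hij, h, rfl, fun e => hh (hy.eq_one e)⟩

theorem good_of_reach {x : CoprodI H → ℕ} {i : Bool} (h : Reach (x, i)) : Good x := by
  obtain ⟨⟨x', j⟩, h1, h2⟩ := reach_iff.1 h
  obtain ⟨hj, g, rfl, -⟩ := step_iff.1 h1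
  intro k
  by_cases hk : k = i
  · subst hk
    exact ⟨1, by rwa [map_one, shift_one]⟩
  · obtain rfl : k = j := by rw [hj]; cases k <;> cases i <;> simp_all
    exact ⟨g, h2⟩

theorem Good.shift {x : CoprodI H → ℕ} (hx : Proper x) (h : Good x) {j : Bool} (t : H j) :
    Good (shift (of t) x) := by
  obtain ⟨g, hg⟩ := h j
  by_cases hgt : g = t
  · subst hgt
    exact good_of_reach hg
  · refine good_of_reach (i := !j) (reach_iff.2 ⟨_, step_of (hx.shift _) (by simp)
      (h := g * t⁻¹) (fun e => hgt (mul_inv_eq_one.1 e)), ?_⟩)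
    rwa [← shift_mul, ← map_mul, inv_mul_cancel_right]

theorem Good.exists_claimed {x : CoprodI H → ℕ} (h : Good x) (i : Bool) :
    ∃ h : H i, Claimed (_root_.shift (of h) x, i) := by
  obtain ⟨g, m, hm⟩ := h i
  obtain ⟨m₀, ⟨g₀, h1⟩, h2⟩ := wellFounded_lt.has_min
    {m : ℕ ×ₗ ℕ ×ₗ ℕ | ∃ g : H i, HasCode m (_root_.shift (of g) x, i)} ⟨m, g, hm⟩
  refine ⟨g₀, m₀, h1, fun g' m' h' => not_lt.1 (h2 m' ⟨g' * g₀, ?_⟩)⟩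
  rwa [map_mul, shift_mul]

section
variable [∀ i, DecidableEq (H i)]

theorem hd_inv_tl_ne {i j : Bool} {γ : CoprodI H} (hj : hd j γ⁻¹ ≠ 1) (ht : tl i γ ≠ 1) :
    hd j (tl i γ)⁻¹ ≠ 1 := by
  have h : (tl i γ)⁻¹ * of (hd i γ)⁻¹ = γ⁻¹ := by
    rw [map_inv, ← mul_inv_rev, hd_mul_tl]
  rcases hd_mul_of (hd i γ)⁻¹ (tl i γ)⁻¹ j with h1 | ⟨h1, -⟩
  · rwa [← h1, h]
  · intro h2
    rw [tl_of_hd h2, inv_eq_one] at h1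
    exact ht h1

theorem exists_walk {x : CoprodI H → ℕ} (hx : Proper x) (j : Bool) (γ : CoprodI H) (i : Bool)
    (hi : hd i γ ≠ 1) (hj : hd j γ⁻¹ ≠ 1) :
    ∃ l, l ≠ [] ∧ Walk l (x, !j) (shift γ x, i) := by
  induction hn : len γ using Nat.strong_induction_on generalizing γ i with
  | _ n ih =>
    subst hn
    have hs : Step (shift (tl i γ) x, !i) (shift γ x, i) := by
      conv => arg 2; rw [← hd_mul_tl i γ, shift_mul]
      exact step_of (hx.shift _) (by simp) hi
    by_cases ht : tl i γ = 1
    · have hij : j = i := by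
        by_contra hij
        have h1 := hd_mul_tl i γ
        rw [ht, mul_one] at h1
        rw [← h1, ← map_inv, hd_of_ne hij] at hj
        exact hj rfl
      subst hij
      rw [ht, shift_one] at hs
      exact ⟨[_], by simp, rfl, _, hs, rfl⟩
    · have hi' : hd (!i) (tl i γ) ≠ 1 := by
        obtain ⟨k, hk⟩ := exists_hd_ne ht
        have hki : k ≠ i := by
          rintro rfl
          exact hk (hd_tl _ _)
        rwa [show (!i) = k by cases i <;> cases k <;> simp_all]
      obtain ⟨l, -, hl⟩ := ih _ (len_tl_lt hi) (tl i γ) (!i) hi' (hd_inv_tl_ne hj ht) rfl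
      exact ⟨l ++ [_], by simp, walk_append.2 ⟨_, hl, rfl, _, hs, rfl⟩⟩

theorem good_of_shift_eq {x : CoprodI H → ℕ} (hx : Proper x) {γ : CoprodI H} (hγ : γ ≠ 1)
    (h : shift γ x = x) : Good x := by
  induction hn : len γ using Nat.strong_induction_on generalizing γ x with
  | _ n ih =>
    subst hn
    obtain ⟨i, hi⟩ := exists_hd_ne hγ
    obtain ⟨j, hj⟩ := exists_hd_ne (inv_ne_one.2 hγ)
    by_cases hij : j = i
    · subst hij
      set m := hd j γ with hm
      set t := tl j γ with ht
      have hmt : of m * t = γ := hd_mul_tl j γ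
      have ht1 : t ≠ 1 := by
        intro ht1
        rw [ht1, mul_one] at hmt
        rw [← hmt] at h
        exact hi (hx.eq_one (congrFun h 1))
      have hlen : len (t * of m) < len γ := by
        have h1 : hd j t⁻¹ ≠ 1 := hd_inv_tl_ne hj ht1
        have h2 : len t < len γ := len_tl_lt hi
        have h3 := len_eq j (of m⁻¹ * t⁻¹)
        have h4 := len_eq j t⁻¹
        rw [tl_of_mul] at h3
        rw [if_neg h1, len_inv] at h4
        rw [map_inv, ← mul_inv_rev, len_inv] at h3
        split_ifs at h3 <;> omega
      have hfix : shift (t * of m) (shift (of m⁻¹) x) = shift (of m⁻¹) x := by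
        rw [← shift_mul, mul_assoc, ← map_mul, mul_inv_cancel, map_one, mul_one]
        conv_rhs => rw [← h, ← hmt, shift_mul, ← shift_mul, ← map_mul, inv_mul_cancel, map_one,
          shift_one]
      have hne : t * of m ≠ 1 := by
        intro e
        have := mul_eq_one_iff_eq_inv.1 e
        rw [← hmt, this, mul_inv_cancel] at hγ
        exact hγ rfl
      have := (ih _ hlen (hx.shift (of m⁻¹)) hne hfix rfl).shift (hx.shift _) m
      rwa [← shift_mul, ← map_mul, mul_inv_cancel, map_one, shift_one] at this
    · obtain ⟨l, h1, h2⟩ := exists_walk hx j γ i hi hj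
      rw [h, show (!j) = i by cases i <;> cases j <;> simp_all] at h2
      exact good_of_reach (Loop.reach ⟨h1, h2⟩)

end

section
variable [∀ i, Countable (H i)]

theorem measurable_walk (l : List (ℕ × Bool)) (g g' : CoprodI H) (i i' : Bool) :
    Measurable fun x => Walk l (shift g x, i) (shift g' x, i') := by
  induction l generalizing g i with
  | nil =>
    simp only [Walk, Prod.mk.injEq, funext_iff, shift]
    refine Measurable.and (Measurable.forall fun a => ?_) measurable_const
    exact measurableSet_setOfPred.1 (measurableSet_eq_fun (measurable_pi_apply _)
      (measurable_pi_apply _))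
  | cons a l ih =>
    have h : ∀ x, Walk (a :: l) (shift g x, i) (shift g' x, i') ↔ a = (x (g⁻¹ * 1), i) ∧
        ∃ h : H (!i), x ((of h * g)⁻¹ * 1) ≠ x (g⁻¹ * 1) ∧
          Walk l (shift (of h * g) x, !i) (shift g' x, i') := fun x => by
      refine and_congr Iff.rfl ?_
      constructor
      · rintro ⟨⟨x', j⟩, h1, h3⟩
        obtain ⟨rfl, h, rfl, h2⟩ := step_iff.1 h1
        rw [← shift_mul] at h2 h3
        exact ⟨h, h2, h3⟩
      · rintro ⟨h, h2, h3⟩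
        refine ⟨(_, _), step_iff.2 ⟨rfl, h, rfl, ?_⟩, ?_⟩
        · rw [← shift_mul]
          exact h2
        · rw [← shift_mul]
          exact h3
    simp only [h]
    refine Measurable.and ?_ (Measurable.exists fun h => Measurable.and (Measurable.not ?_) (ih _ _))
    · exact measurableSet_setOfPred.1 (measurableSet_eq_fun measurable_const
        ((measurable_pi_apply _).prodMk measurable_const))
    · exact measurableSet_setOfPred.1 (measurableSet_eq_fun (measurable_pi_apply _)
        (measurable_pi_apply _))

theorem measurable_coded (n c k : ℕ) (g : CoprodI H) (i : Bool) :
    Measurable fun x => Coded n c k (shift g x, i) := by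
  induction n generalizing g i with
  | zero => exact Measurable.and measurable_const (measurable_walk _ g g i i)
  | succ n ih =>
    have h : ∀ x, Coded (n + 1) c k (shift g x, i) ↔
        ∃ h : H (!i), x ((of h * g)⁻¹ * 1) ≠ x (g⁻¹ * 1) ∧
          Coded n c k (shift (of h * g) x, !i) := fun x => by
      constructor
      · rintro ⟨⟨x', j⟩, h1, h3⟩
        obtain ⟨rfl, h, rfl, h2⟩ := step_iff.1 h1
        rw [← shift_mul] at h2 h3
        exact ⟨h, h2, h3⟩
      · rintro ⟨h, h2, h3⟩
        refine ⟨(_, _), step_iff.2 ⟨rfl, h, rfl, ?_⟩, ?_⟩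
        · rw [← shift_mul]
          exact h2
        · rw [← shift_mul]
          exact h3
    simp only [h]
    refine Measurable.exists fun h => Measurable.and (Measurable.not ?_) (ih _ _)
    exact measurableSet_setOfPred.1 (measurableSet_eq_fun (measurable_pi_apply _)
      (measurable_pi_apply _))

theorem measurable_claimed (i : Bool) :
    Measurable fun x : CoprodI H → ℕ => Claimed (x, i) := by
  have h1 : ∀ n c k, Measurable fun x : CoprodI H → ℕ => Coded n c k (x, i) := fun n c k => by
    have h := measurable_coded (H := H) n c k 1 i
    simp only [shift_one] at h
    exact h
  have h2 : ∀ (n c k : ℕ) (m : ℕ ×ₗ ℕ ×ₗ ℕ), Measurable fun x : CoprodI H → ℕ =>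
      ∀ h : H i, Coded n c k (shift (of h) x, i) → m ≤ toLex (n, toLex (c, k)) :=
    fun n c k m => Measurable.forall fun h => (measurable_coded n c k (of h) i).imp measurable_const
  have h3 : ∀ x : CoprodI H → ℕ, Claimed (x, i) ↔ ∃ n c k, Coded n c k (x, i) ∧ ∀ n' c' k',
      ∀ h : H i, Coded n' c' k' (shift (of h) x, i) →
        toLex (n, toLex (c, k)) ≤ toLex (n', toLex (c', k')) := fun x => by
    constructor
    · rintro ⟨⟨n, c, k⟩, h4, h5⟩
      exact ⟨n, c, k, h4, fun n' c' k' h h6 => h5 h (toLex (n', toLex (c', k'))) h6⟩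
    · rintro ⟨n, c, k, h4, h5⟩
      exact ⟨toLex (n, toLex (c, k)), h4, fun h m' h6 => h5 _ _ _ h h6⟩
  simp only [h3]
  exact Measurable.exists fun n => Measurable.exists fun c => Measurable.exists fun k =>
    (h1 n c k).and <| Measurable.forall fun n' => Measurable.forall fun c' =>
      Measurable.forall fun k' => h2 n' c' k' _

theorem measurableSet_freePart {G : Type} [Group G] [Countable G] :
    MeasurableSet (freePart G ℕ) := by
  have : freePart G ℕ = ⋂ γ : G, ⋂ _ : γ ≠ 1, {y | shift γ y = y}ᶜ := by
    ext y
    simp [freePart]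
  rw [this]
  exact MeasurableSet.iInter fun γ => MeasurableSet.iInter fun _ =>
    (measurableSet_eq_fun (measurable_shift γ) measurable_id).compl

/-- A Borel set of labellings extends from the free part so that, off the free part, neither it nor
its complement contains an orbit of the corresponding factor. -/
theorem exists_payoff {A : Set (CoprodI H → ℕ)} (hA : MeasurableSet A) :
    ∃ M : Set (CoprodI H → ℕ), MeasurableSet M ∧ (∀ y ∈ freePart (CoprodI H) ℕ, y ∈ M ↔ y ∈ A) ∧
      ∀ y, Proper y → y ∉ freePart (CoprodI H) ℕ →
        (∃ h : H false, shift (of h) y ∈ M) ∧ ∃ h : H true, shift (of h) y ∉ M := by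
  classical
  refine ⟨(freePart _ ℕ).ite A {x | Claimed (x, false)}, measurableSet_freePart.ite hA
    (measurableSet_setOfPred.2 (measurable_claimed false)), fun y hy => ?_, fun y hy hfree => ?_⟩
  · simp [Set.ite, hy]
  · have hshift : ∀ a, shift a y ∉ freePart (CoprodI H) ℕ := fun a ha => hfree fun γ hγ e => by
      refine ha (a * γ * a⁻¹) (by simpa using hγ) ?_
      rw [← shift_mul, inv_mul_cancel_right, shift_mul, e]
    have hgood : Good y := by
      simp only [freePart, Set.mem_ofPred_eq, not_forall, not_not] at hfree
      obtain ⟨γ, hγ, e⟩ := hfree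
      exact good_of_shift_eq hy hγ e
    obtain ⟨g, hg⟩ := hgood.exists_claimed false
    obtain ⟨h, hh⟩ := hgood.exists_claimed true
    refine ⟨⟨g, ?_⟩, h, ?_⟩
    · simpa [Set.ite, hshift] using hg
    · simpa [Set.ite, hshift] using fun h1 => not_claimed_both _ false h1 hh

end

end FreeProd

namespace FreeProd

open Monoid Monoid.CoprodI GameTree

variable {H : Bool → Type} [∀ i, Group (H i)]

theorem exists_proper [∀ i, Countable (H i)] (a : ℕ) :
    ∃ y : CoprodI H → ℕ, Proper y ∧ y 1 = a := by
  obtain ⟨e, he⟩ := exists_injective_nat (CoprodI H)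
  refine ⟨fun g => Equiv.swap (e 1) a (e g), fun g k m h => ?_, Equiv.swap_apply_left _ _⟩
  have h1 := he ((Equiv.swap (e 1) a).injective h)
  exact of_injective k (by rw [map_one]; exact mul_eq_left.1 h1.symm)

variable [∀ i, DecidableEq (H i)]

/-- The stage of the game at which the value at `g` is played. Player `j` plays the values at the
words whose first letter is in the factor `j`. -/
def stage (g : CoprodI H) : ℕ := 2 * len g - if hd false g = 1 then 0 else 1

theorem len_tl_le (i : Bool) (g : CoprodI H) : len (tl i g) ≤ len g := by
  rw [len_eq i g]
  exact Nat.le_add_right _ _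

theorem len_tl_le_of_stage_le {j : Bool} {t : ℕ} {w : CoprodI H}
    (h : stage w ≤ 2 * t + j.toNat) : len (tl (!j) w) ≤ t := by
  have h1 := len_tl_le (!j) w
  have h2 := len_eq false w
  rw [stage] at h
  cases j
  · simp only [Bool.toNat_false, Bool.not_false] at *
    split_ifs at * <;> omega
  · simp only [Bool.toNat_true, Bool.not_true] at *
    split_ifs at * <;> omega

theorem stage_le {j : Bool} {t : ℕ} {w : CoprodI H} (h : len w ≤ t) :
    stage w ≤ 2 * t + j.toNat := by
  rw [stage]
  omega

theorem of_stage_eq {j : Bool} {t : ℕ} {w : CoprodI H} (h : stage w = 2 * t + j.toNat + 1) :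
    hd (!j) w = 1 ∧ len w = t + 1 := by
  rw [stage] at h
  cases j
  · simp only [Bool.toNat_false] at *
    split_ifs at h with h1
    · omega
    · exact ⟨hd_eq_one h1 (by simp), by omega⟩
  · simp only [Bool.toNat_true] at *
    split_ifs at h with h1
    · exact ⟨h1, by omega⟩
    · omega

/-- The part of `y` which is played up to the stage `n`. -/
def trunc (n : ℕ) (y : CoprodI H → ℕ) : CoprodI H → ℕ := fun w => if stage w ≤ n then y w else 0

theorem trunc_trunc {m n : ℕ} (h : m ≤ n) (y : CoprodI H → ℕ) :
    trunc m (trunc n y) = trunc m y := by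
  funext w
  simp only [trunc]
  split_ifs <;> first | rfl | omega

variable (H) in
/-- The game in which the players construct a proper labelling whose value at `1` is `a`. -/
def labelGame (a : ℕ) : GameTree where
  Pos n := {f : CoprodI H → ℕ // ∃ y, Proper y ∧ y 1 = a ∧ trunc n y = f}
  par n p := ⟨trunc n p.1, by
    obtain ⟨f, y, h1, h2, rfl⟩ := p
    exact ⟨y, h1, h2, (trunc_trunc n.le_succ y).symm⟩⟩
  surj n p := by
    obtain ⟨f, y, h1, h2, rfl⟩ := p
    exact ⟨⟨trunc (n + 1) y, y, h1, h2, rfl⟩, Subtype.ext (trunc_trunc n.le_succ y)⟩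

/-- The position reached at the stage `n` if the labelling `y` is played. -/
def posOf {a : ℕ} (n : ℕ) (y : CoprodI H → ℕ) (hy : Proper y) (ha : y 1 = a) :
    (labelGame H a).Pos n := ⟨trunc n y, y, hy, ha, rfl⟩

/-- The run in which the labelling `y` is played. -/
def runOf {a : ℕ} (y : CoprodI H → ℕ) (hy : Proper y) (ha : y 1 = a) : Run (labelGame H a) :=
  ⟨fun n => posOf n y hy ha, fun n => Subtype.ext (trunc_trunc n.le_succ y)⟩

/-- The labelling constructed in a run. -/
def result {a : ℕ} (x : Run (labelGame H a)) : CoprodI H → ℕ := fun g => (x.1 (stage g)).1 g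

theorem result_runOf {a : ℕ} (y : CoprodI H → ℕ) (hy : Proper y) (ha : y 1 = a) :
    result (runOf y hy ha) = y := by
  funext g
  exact if_pos le_rfl

theorem pos_eq_zero {a n : ℕ} (p : (labelGame H a).Pos n) {w : CoprodI H} (h : n < stage w) :
    p.1 w = 0 := by
  obtain ⟨f, y, h1, h2, rfl⟩ := p
  exact if_neg (not_le.2 h)

theorem par_apply {a n : ℕ} (p : (labelGame H a).Pos (n + 1)) {w : CoprodI H} (h : stage w ≤ n) :
    ((labelGame H a).par n p).1 w = p.1 w := if_pos h

theorem subsingleton_pos_zero (a : ℕ) : Subsingleton ((labelGame H a).Pos 0) := by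
  refine ⟨fun p q => Subtype.ext (funext fun w => ?_)⟩
  by_cases hw : 0 < stage w
  · rw [pos_eq_zero p hw, pos_eq_zero q hw]
  · have : w = 1 := by
      rw [← len_eq_zero]
      have h1 := len_tl_le_of_stage_le (j := false) (t := 0) (w := w) (by omega)
      have h2 := len_tl_le_of_stage_le (j := true) (t := 0) (w := w) (by omega)
      have h3 := len_eq false w
      rw [stage] at hw
      simp only [Bool.not_true] at h2
      split_ifs at h3 hw <;> omega
    subst this
    obtain ⟨f, y, h1, h2, rfl⟩ := p
    obtain ⟨f', y', h1', h2', rfl⟩ := q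
    simp only [trunc, h2, h2']

/-- Combining proper labellings with distinct values at `1` yields a proper labelling. -/
theorem proper_glue {i : Bool} {α : H i → ℕ} (hα : Function.Injective α)
    (z : H i → CoprodI H → ℕ) (hz : ∀ γ, Proper (z γ)) (h1 : ∀ γ, z γ 1 = α γ) :
    Proper fun g => z (hd i g) (tl i g) := by
  intro g k m h
  dsimp only at h
  rcases hd_mul_of m g i with h2 | ⟨h2, h3⟩
  · have h3 : tl i (g * of m) = tl i g * of m := by
      have h4 := hd_mul_tl i (g * of m)
      rw [h2] at h4
      rw [← mul_right_inj (of (hd i g)), h4, ← mul_assoc, hd_mul_tl]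
    rw [h2, h3] at h
    exact hz _ _ _ _ h
  · rw [h2, h3, h1, h1] at h
    have h4 := hd_mul_tl i g
    have h5 := hd_mul_tl i (g * of m)
    rw [h3, ← hα h, ← h2, h4] at h5
    exact of_injective k (by rw [map_one]; exact mul_eq_left.1 h5.symm)

/-- The proper labellings with prescribed values on the factor `i`. -/
abbrev Labelling {i : Bool} (α : H i → ℕ) := {y : CoprodI H → ℕ // Proper y ∧ ∀ γ, y (of γ) = α γ}

/-- The position reached at the stage `n` in the game associated with the element `γ` of the factor
`i`. -/
def node {i : Bool} {α : H i → ℕ} (y : Labelling α) (γ : H i) (n : ℕ) :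
    (labelGame H (α γ)).Pos n :=
  posOf n (shift (of γ)⁻¹ y.1) (y.2.1.shift _) (by simpa [shift] using y.2.2 γ)

theorem node_apply {i : Bool} {α : H i → ℕ} (y : Labelling α) (γ : H i) {n : ℕ} {w : CoprodI H}
    (h : stage w ≤ n) : (node y γ n).1 w = y.1 (of γ * w) := by
  simp [node, posOf, trunc, h, shift]

theorem node_congr {i : Bool} {α : H i → ℕ} {y y' : Labelling α} {γ : H i} {n : ℕ}
    (h : ∀ w, stage w ≤ n → y.1 (of γ * w) = y'.1 (of γ * w)) : node y γ n = node y' γ n := by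
  refine Subtype.ext (funext fun w => ?_)
  by_cases hw : stage w ≤ n
  · rw [node_apply y γ hw, node_apply y' γ hw, h w hw]
  · rw [pos_eq_zero _ (not_le.1 hw), pos_eq_zero _ (not_le.1 hw)]

theorem strat_apply {a n : ℕ} (s : Strat (labelGame H a)) (p : (labelGame H a).Pos n)
    {w : CoprodI H} (h : stage w ≤ n) : (s.1 n p).1 w = p.1 w := by
  rw [← par_apply _ h, s.2]

theorem exists_labelling_extending {i : Bool} {α : H i → ℕ} (hα : Function.Injective α) (n : ℕ)
    (p : ∀ γ, (labelGame H (α γ)).Pos n) :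
    ∃ y : Labelling α, ∀ γ w, hd i w = 1 → stage w ≤ n → y.1 (of γ * w) = (p γ).1 w := by
  choose z hz h1 hp using fun γ => (p γ).2
  refine ⟨⟨_, proper_glue hα z hz h1, fun γ => ?_⟩, fun γ w hw hn => ?_⟩
  · rw [hd_of, tl_of, h1]
  · dsimp only
    rw [hd_of_mul, tl_of_mul, hw, mul_one, tl_of_hd hw, ← hp, trunc, if_pos hn]

/-- If player `j` has strategies in the games associated with the elements of the other factor, then
there is a labelling which follows all of these strategies simultaneously. -/
theorem exists_labelling_obeys [∀ i, Countable (H i)] {j : Bool} {α : H (!j) → ℕ}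
    (hα : Function.Injective α) (s : ∀ γ, Strat (labelGame H (α γ))) :
    ∃ y : Labelling α, ∀ γ n, n.bodd = j → node y γ (n + 1) = (s γ).1 n (node y γ n) := by
  choose z hz h1 using fun γ => exists_proper (H := H) (α γ)
  obtain ⟨y₀, -⟩ := exists_labelling_extending hα 0 fun γ => posOf 0 (z γ) (hz γ) (h1 γ)
  choose next hnext using fun (t : ℕ) (y : Labelling α) =>
    exists_labelling_extending hα (2 * t + j.toNat + 1) fun γ =>
      (s γ).1 (2 * t + j.toNat) (node y γ (2 * t + j.toNat))
  let Y : ℕ → Labelling α := fun t => Nat.rec y₀ next t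
  have hY : ∀ t, Y (t + 1) = next t (Y t) := fun _ => rfl
  have hstep : ∀ t g, len (tl (!j) g) ≤ t → (Y (t + 1)).1 g = (Y t).1 g := fun t g hg => by
    have h2 : stage (tl (!j) g) ≤ 2 * t + j.toNat := stage_le hg
    have h3 := hnext t (Y t) (hd (!j) g) (tl (!j) g) (hd_tl _ _) (h2.trans (Nat.le_succ _))
    rwa [← hY, hd_mul_tl, strat_apply _ _ h2, node_apply _ _ h2, hd_mul_tl] at h3
  have hstable : ∀ g t, len (tl (!j) g) ≤ t → (Y t).1 g = (Y (len (tl (!j) g))).1 g :=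
    fun g t ht => by
      induction t, ht using Nat.le_induction with
      | base => rfl
      | succ t ht ih => rw [hstep t g ht, ih]
  let y : Labelling α := ⟨fun g => (Y (len (tl (!j) g))).1 g, fun g k m h => by
    dsimp only at h
    rw [← hstable g _ (le_max_left _ (len (tl (!j) (g * of m)))),
      ← hstable (g * of m) _ (le_max_right (len (tl (!j) g)) _)] at h
    exact (Y _).2.1 g k m h, fun γ => (Y _).2.2 γ⟩
  have hy : ∀ g t, len (tl (!j) g) ≤ t → y.1 g = (Y t).1 g := fun g t ht => (hstable g t ht).symm
  refine ⟨y, fun γ n hn => ?_⟩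
  obtain ⟨t, rfl⟩ : ∃ t, n = 2 * t + j.toNat :=
    ⟨n.div2, by rw [← hn, add_comm, Nat.bodd_add_div2]⟩
  have hnode : node y γ (2 * t + j.toNat) = node (Y t) γ (2 * t + j.toNat) :=
    node_congr fun w hw => hy _ _ (by rw [tl_of_mul]; exact len_tl_le_of_stage_le hw)
  refine Subtype.ext (funext fun w => ?_)
  rcases lt_trichotomy (stage w) (2 * t + j.toNat + 1) with hw | hw | hw
  · have hw' := Nat.lt_succ_iff.1 hw
    rw [node_apply _ _ hw.le, strat_apply _ _ hw', node_apply _ _ hw']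
  · obtain ⟨h2, h3⟩ := of_stage_eq hw
    rw [node_apply _ _ hw.le, hnode]
    exact (hy _ (t + 1) (by rw [tl_of_mul, tl_of_hd h2, h3])).trans (hnext t (Y t) γ w h2 hw.le)
  · rw [pos_eq_zero _ hw, pos_eq_zero _ hw]

theorem exists_proper_orbit [∀ i, Countable (H i)] {M : Set (CoprodI H → ℕ)}
    (hM : MeasurableSet M) :
    ∃ y, Proper y ∧ ((∀ h : H true, shift (of h) y ∈ M) ∨ ∀ h : H false, shift (of h) y ∉ M) := by
  let W (j : Bool) : Set ℕ :=
    {a | ∃ s : Strat (labelGame H a), ∀ x, Obeys j s x → (result x ∈ M ↔ j = false)}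
  have hW : W false ∪ W true = Set.univ := by
    refine Set.eq_univ_of_forall fun a => ?_
    rcases determined_of_measurableSet (subsingleton_pos_zero (H := H) a) result
      (fun g x => ⟨stage g, fun y hy => by rw [result, hy, result]⟩) hM with ⟨s, hs⟩ | ⟨s, hs⟩
    · exact Or.inl ⟨s, fun x hx => by simpa using hs x hx⟩
    · exact Or.inr ⟨s, fun x hx => by simpa using hs x hx⟩
  obtain ⟨j, hj⟩ : ∃ j, (W j).Infinite := by
    have h := Set.infinite_univ (α := ℕ)
    rw [← hW, Set.infinite_union] at h
    exact h.elim (fun h => ⟨_, h⟩) fun h => ⟨_, h⟩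
  obtain ⟨e, he⟩ := exists_injective_nat (H (!j))
  have hα : Function.Injective fun γ => (hj.natEmbedding (W j) (e γ)).1 :=
    Subtype.val_injective.comp ((hj.natEmbedding (W j)).injective.comp he)
  choose s hs using fun γ => (hj.natEmbedding (W j) (e γ)).2
  obtain ⟨y, hy⟩ := exists_labelling_obeys hα s
  have key : ∀ γ : H (!j), shift (of γ) y.1 ∈ M ↔ j = false := fun γ => by
    have h1 := hs γ⁻¹ (runOf (shift (of γ⁻¹)⁻¹ y.1) (y.2.1.shift _)
      (by simpa [shift] using y.2.2 γ⁻¹)) fun n hn => hy γ⁻¹ n hn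
    rwa [result_runOf, map_inv, inv_inv] at h1
  refine ⟨y.1, y.2.1, ?_⟩
  cases j
  · exact Or.inl fun h => (key h).2 rfl
  · exact Or.inr fun h h1 => absurd ((key h).1 h1) (by simp)

/-- A Borel subset of the free part cannot both meet every orbit of the first factor and have a
complement meeting every orbit of the second factor. -/
theorem false_of_meets {H : Bool → Type} [∀ i, Group (H i)] [∀ i, Countable (H i)]
    {A : Set (CoprodI H → ℕ)} (hA : MeasurableSet A)
    (h1 : ∀ y ∈ freePart (CoprodI H) ℕ, ∃ h : H false, shift (of h) y ∈ A)
    (h2 : ∀ y ∈ freePart (CoprodI H) ℕ, ∃ h : H true, shift (of h) y ∉ A) : False := by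
  classical
  obtain ⟨M, hM, hfree, hnonfree⟩ := exists_payoff hA
  obtain ⟨y, hy, h3⟩ := exists_proper_orbit hM
  by_cases hf : y ∈ freePart (CoprodI H) ℕ
  · have hshift : ∀ a, shift a y ∈ freePart (CoprodI H) ℕ := fun a γ hγ e => by
      refine hf (a⁻¹ * γ * a) (fun h => hγ ?_) ?_
      · rw [mul_assoc, inv_mul_eq_one] at h
        exact mul_eq_right.1 h.symm
      · rw [mul_assoc, shift_mul, shift_mul, e, ← shift_mul, inv_mul_cancel, shift_one]
    rcases h3 with h3 | h3
    · obtain ⟨h, hh⟩ := h2 y hf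
      exact hh ((hfree _ (hshift _)).1 (h3 h))
    · obtain ⟨h, hh⟩ := h1 y hf
      exact h3 h ((hfree _ (hshift _)).2 hh)
  · obtain ⟨⟨g, hg⟩, h, hh⟩ := hnonfree y hy hf
    exact h3.elim (fun h3 => hh (h3 h)) fun h3 => h3 g hg

/-- The family consisting of two groups. -/
abbrev Pair (Γ Δ : Type) (i : Bool) : Type := Bool.rec Γ Δ i

instance (Γ Δ : Type) [Group Γ] [Group Δ] : ∀ i, Group (Pair Γ Δ i)
  | false => inferInstanceAs (Group Γ)
  | true => inferInstanceAs (Group Δ)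

instance (Γ Δ : Type) [Countable Γ] [Countable Δ] : ∀ i, Countable (Pair Γ Δ i)
  | false => inferInstanceAs (Countable Γ)
  | true => inferInstanceAs (Countable Δ)

theorem exists_coprodEquiv (Γ Δ : Type) [Group Γ] [Group Δ] :
    ∃ e : Coprod Γ Δ ≃* CoprodI (Pair Γ Δ),
      (∀ γ : Γ, e (Coprod.inl γ) = of (i := false) γ) ∧
      ∀ δ : Δ, e (Coprod.inr δ) = of (i := true) δ := by
  let f : Coprod Γ Δ →* CoprodI (Pair Γ Δ) :=
    Coprod.lift (of (M := Pair Γ Δ) (i := false)) (of (M := Pair Γ Δ) (i := true))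
  let k : ∀ i, Pair Γ Δ i →* Coprod Γ Δ
    | false => Coprod.inl
    | true => Coprod.inr
  refine ⟨f.toMulEquiv (CoprodI.lift k) ?_ ?_, fun γ => ?_, fun δ => ?_⟩
  · refine Coprod.hom_ext (MonoidHom.ext fun x => ?_) (MonoidHom.ext fun x => ?_)
    · simp [f, k]
    · simp [f, k]
  · refine CoprodI.ext_hom _ _ fun i => MonoidHom.ext fun x => ?_
    cases i
    · simp [f, k]
    · simp [f, k]
  · simp [f]
  · simp [f]

end FreeProd

/-- Let `E_Γ` and `E_Δ` be the orbit equivalence relations on `Free(ℕ^{Γ*Δ})` of the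
restrictions of the left shift action to `Γ` and `Δ` respectively. Then `E_Γ` and `E_Δ`
do not have Borel disjoint complete sections: there are no disjoint Borel sets `A`, `B`
such that `A` meets every `E_Γ`-class and `B` meets every `E_Δ`-class. -/
theorem stmt_7 (Γ Δ : Type) [Group Γ] [Group Δ] [Countable Γ] [Countable Δ] :
    ¬∃ A B : Set ↥(freePart (Monoid.Coprod Γ Δ) ℕ),
      MeasurableSet A ∧ MeasurableSet B ∧ Disjoint A B ∧
      (∀ x : ↥(freePart (Monoid.Coprod Γ Δ) ℕ), ∃ y ∈ A, ∃ γ : Γ,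
        shift (Monoid.Coprod.inl γ) (x : Monoid.Coprod Γ Δ → ℕ) =
          (y : Monoid.Coprod Γ Δ → ℕ)) ∧
      (∀ x : ↥(freePart (Monoid.Coprod Γ Δ) ℕ), ∃ y ∈ B, ∃ δ : Δ,
        shift (Monoid.Coprod.inr δ) (x : Monoid.Coprod Γ Δ → ℕ) =
          (y : Monoid.Coprod Γ Δ → ℕ)) := by
  rintro ⟨_, B, ⟨A, hA, rfl⟩, -, hAB, h1, h2⟩
  obtain ⟨e, hl, hr⟩ := FreeProd.exists_coprodEquiv Γ Δ
  have hshift : ∀ a (y : Monoid.CoprodI (FreeProd.Pair Γ Δ) → ℕ),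
      shift a (y ∘ e) = shift (e a) y ∘ e := fun a y => by
    funext g
    simp [shift]
  have hfree : ∀ y ∈ freePart (Monoid.CoprodI (FreeProd.Pair Γ Δ)) ℕ,
      y ∘ e ∈ freePart (Monoid.Coprod Γ Δ) ℕ := fun y hy a ha h => by
    rw [hshift] at h
    exact hy (e a) (by simpa using ha) (e.surjective.injective_comp_right h)
  have hmeas : Measurable fun y : Monoid.CoprodI (FreeProd.Pair Γ Δ) → ℕ => y ∘ e :=
    measurable_pi_iff.2 fun g => measurable_pi_apply (e g)
  refine FreeProd.false_of_meets (hA.preimage hmeas) (fun y hy => ?_) fun y hy => ?_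
  · obtain ⟨z, hz, γ, h⟩ := h1 ⟨_, hfree y hy⟩
    refine ⟨γ, ?_⟩
    rw [Set.mem_preimage, ← hl, ← hshift]
    dsimp only at h
    rw [h]
    exact hz
  · obtain ⟨z, hz, δ, h⟩ := h2 ⟨_, hfree y hy⟩
    refine ⟨δ, fun h3 => ?_⟩
    rw [Set.mem_preimage, ← hr, ← hshift] at h3
    dsimp only at h
    rw [h] at h3
    exact Set.disjoint_left.1 hAB h3 hz
end

section
/- For every n > 1, there exists an n-regular acyclic Borel bipartite graph with no Borel perfect matching. -/
/-- The Borel chromatic number of a (graph given by a) relation `G` on a measurable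
space `X`: the least cardinality of a standard Borel space `Y` admitting a Borel
(measurable) coloring `c : X → Y` with `c x ≠ c y` whenever `G x y`. -/
noncomputable def borelChromaticNumber {X : Type} [mX : MeasurableSpace X]
    (G : X → X → Prop) : Cardinal :=
  sInf {κ : Cardinal | ∃ (Y : Type) (mY : MeasurableSpace Y),
    @StandardBorelSpace Y mY ∧ Cardinal.mk Y = κ ∧
    ∃ c : X → Y, @Measurable X Y mX mY c ∧ ∀ x y, G x y → c x ≠ c y}

/-- The adjacency relation of the graph `G(Γ, X)` on the free part `Free(X^Γ)` determined
by a set `S` of generators of `Γ`: `x` and `y` are adjacent iff some `γ ∈ S` shifts `x`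
to `y` or `y` to `x`. -/
def cayleyAdj {Γ : Type} [Group Γ] (S : Set Γ) (X : Type) :
    ↥(freePart Γ X) → ↥(freePart Γ X) → Prop :=
  fun x y => ∃ γ ∈ S,
    shift γ (x : Γ → X) = (y : Γ → X) ∨ shift γ (y : Γ → X) = (x : Γ → X)

section

open MeasureTheory Set

/-- A probability space with two measure-preserving maps of order `n` equipped with equivariant
labels in `Fin n`, in which every set of a countable generating family is approximated in `L¹` by
sums of a function invariant under the first map and a function invariant under the second. -/
structure RigidSystem (n : ℕ) [NeZero n] (X J : Type) [mX : MeasurableSpace X] where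
  μ : Measure X
  isProb : IsProbabilityMeasure μ
  T : Bool → X → X
  label : Bool → X → Fin n
  C : J → Set X
  T_pres : ∀ b, MeasurePreserving (T b) μ μ
  T_iter : ∀ b x, (T b)^[n] x = x
  label_meas : ∀ b, Measurable (label b)
  label_T : ∀ b x, label b (T b x) = label b x + 1
  C_meas : ∀ j, MeasurableSet (C j)
  C_gen : mX = MeasurableSpace.generateFrom (range C)
  C_pi : IsPiSystem (range C)
  C_univ : ∃ j, C j = univ
  C_sep : ∀ (x : X) (F : Finset X), x ∉ F → ∃ j, x ∈ C j ∧ ∀ y ∈ F, y ∉ C j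
  rigid : ∀ (j : J) (ε : ℝ), 0 < ε → ∃ f : Bool → X → ℝ, (∀ b, Integrable (f b) μ) ∧
    (∀ b x, f b (T b x) = f b x) ∧
    ∫ x, |(C j).indicator 1 x - f false x - f true x| ∂μ < ε

namespace RigidSystem

variable {n : ℕ} [NeZero n] {X J : Type} [MeasurableSpace X] (S : RigidSystem n X J)

/-- The point reached after `k` moves along the orbits of `T b`, `T !b`, `T b`, …, the `k`-th move
using the exponent `i k`. -/
def path (b : Bool) (i : ℕ → ℕ) : ℕ → X → X
  | 0, x => x
  | k + 1, x => (S.T (xor b k.bodd))^[i k] (path b i k x)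

lemma path_pres (b : Bool) (i : ℕ → ℕ) (k : ℕ) :
    MeasurePreserving (S.path b i k) S.μ S.μ := by
  induction k with
  | zero => exact MeasurePreserving.id _
  | succ k ih => exact ((S.T_pres _).iterate _).comp ih

lemma invariant_iterate {α : Type*} {f : X → α} {b : Bool} (hf : ∀ x, f (S.T b x) = f x)
    (k : ℕ) (x : X) : f ((S.T b)^[k] x) = f x := by
  induction k generalizing x with
  | zero => rfl
  | succ k ih => rw [Function.iterate_succ_apply, ih, hf]

lemma alternating_sum_same {f : X → ℝ} {b : Bool} (hf : ∀ x, f (S.T b x) = f x)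
    (i : ℕ → ℕ) (r : ℕ) (x : X) :
    ∑ k ∈ Finset.range (2 * r), (-1) ^ k * f (S.path b i k x) = 0 := by
  induction r with
  | zero => simp
  | succ r ih =>
    have h : f (S.path b i (2 * r + 1) x) = f (S.path b i (2 * r) x) := by
      simp only [path, Nat.bodd_mul, Nat.bodd_two, Bool.false_and, Bool.xor_false]
      exact S.invariant_iterate hf _ _
    rw [show 2 * (r + 1) = 2 * r + 1 + 1 by ring, Finset.sum_range_succ, Finset.sum_range_succ, ih,
      h, pow_succ, pow_mul]
    simp

lemma alternating_sum_other {f : X → ℝ} {b : Bool} (hf : ∀ x, f (S.T (!b) x) = f x)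
    (i : ℕ → ℕ) (r : ℕ) (x : X) :
    ∑ k ∈ Finset.range (2 * r), (-1) ^ k * f (S.path b i k x) =
      f x - f (S.path b i (2 * r) x) := by
  induction r with
  | zero => simp [path]
  | succ r ih =>
    have h : f (S.path b i (2 * r + 1 + 1) x) = f (S.path b i (2 * r + 1) x) := by
      rw [path]
      have : (xor b (2 * r + 1).bodd) = !b := by simp
      rw [this]
      exact S.invariant_iterate hf _ _
    rw [show 2 * (r + 1) = 2 * r + 1 + 1 by ring, Finset.sum_range_succ, Finset.sum_range_succ, ih,
      h, pow_succ, pow_mul]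
    simp [sub_eq_add_neg]

lemma alternating_sum_closed {f : Bool → X → ℝ} (hf : ∀ b x, f b (S.T b x) = f b x)
    (b : Bool) (i : ℕ → ℕ) (r : ℕ) {x : X} (hx : S.path b i (2 * r) x = x) (c : Bool) :
    ∑ k ∈ Finset.range (2 * r), (-1) ^ k * f c (S.path b i k x) = 0 := by
  by_cases hc : c = b
  · subst hc
    exact S.alternating_sum_same (hf c) i r x
  · obtain rfl : c = !b := by cases c <;> cases b <;> simp_all
    rw [S.alternating_sum_other (hf _) i r x, hx, sub_self]

lemma measure_closed_path_avoiding_eq_zero (b : Bool) (i : ℕ → ℕ) (r : ℕ) (hr : 0 < r) (j : J) :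
    S.μ {x | S.path b i (2 * r) x = x ∧ x ∈ S.C j ∧
      ∀ k, 0 < k → k < 2 * r → S.path b i k x ∉ S.C j} = 0 := by
  have := S.isProb
  set A := {x | S.path b i (2 * r) x = x ∧ x ∈ S.C j ∧
      ∀ k, 0 < k → k < 2 * r → S.path b i k x ∉ S.C j} with hA
  by_contra hne
  obtain ⟨ε, hε, hεA⟩ : ∃ ε : ℝ, 0 < ε ∧ 2 * r * ε ≤ S.μ.real A := by
    have h1 : 0 < S.μ.real A := ENNReal.toReal_pos hne (by finiteness)
    have h2 : (0 : ℝ) < 2 * r := by positivity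
    exact ⟨S.μ.real A / (2 * r), by positivity, by field_simp; exact le_refl _⟩
  obtain ⟨f, hfi, hf, hlt⟩ := S.rigid j ε hε
  set err : X → ℝ := fun x => (S.C j).indicator 1 x - f false x - f true x with herr
  have hint : Integrable err S.μ :=
    (((integrable_const (1 : ℝ)).indicator (S.C_meas j)).sub (hfi false)).sub (hfi true)
  have hintk : ∀ k, Integrable (fun x => |err (S.path b i k x)|) S.μ := fun k =>
    ((S.path_pres b i k).integrable_comp_of_integrable hint).abs
  have hpt : ∀ x ∈ A, 1 ≤ ∑ k ∈ Finset.range (2 * r), |err (S.path b i k x)| := by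
    rintro x ⟨hx, hxC, hxk⟩
    have h1 : ∑ k ∈ Finset.range (2 * r),
        (-1 : ℝ) ^ k * (S.C j).indicator 1 (S.path b i k x) = 1 := by
      rw [Finset.sum_eq_single 0]
      · simp [path, hxC]
      · intro k hk hk0
        simp [hxk k (Nat.pos_of_ne_zero hk0) (Finset.mem_range.1 hk)]
      · intro h
        simp at h
        omega
    have h2 : ∑ k ∈ Finset.range (2 * r), (-1 : ℝ) ^ k * err (S.path b i k x) = 1 := by
      simp only [herr, mul_sub, Finset.sum_sub_distrib, h1,
        S.alternating_sum_closed hf b i r hx, sub_zero]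
    rw [← h2]
    refine Finset.sum_le_sum fun k _ => (le_abs_self _).trans ?_
    simp [abs_mul]
  have hmul : S.μ.real A * 1 ≤ ∫ x, ∑ k ∈ Finset.range (2 * r), |err (S.path b i k x)| ∂S.μ := by
    have h3 := mul_meas_ge_le_integral_of_nonneg (μ := S.μ)
      (f := fun x => ∑ k ∈ Finset.range (2 * r), |err (S.path b i k x)|)
      (Filter.Eventually.of_forall fun x => Finset.sum_nonneg fun _ _ => abs_nonneg _)
      (integrable_finsetSum _ fun k _ => hintk k) 1
    rw [one_mul] at h3
    rw [mul_one]
    exact (measureReal_mono hpt (by finiteness)).trans h3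
  rw [integral_finsetSum _ fun k _ => hintk k] at hmul
  have hk : ∀ k ∈ Finset.range (2 * r), ∫ x, |err (S.path b i k x)| ∂S.μ = ∫ x, |err x| ∂S.μ := by
    intro k _
    have hp := S.path_pres b i k
    rw [← integral_map (f := fun x => |err x|) hp.measurable.aemeasurable, hp.map_eq]
    rw [hp.map_eq]
    exact hint.abs.aestronglyMeasurable
  rw [Finset.sum_congr rfl hk, Finset.sum_const, Finset.card_range, nsmul_eq_mul] at hmul
  have h2 : (0 : ℝ) < 2 * r := by positivity
  have := mul_lt_mul_of_pos_left hlt h2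
  push_cast at hmul
  linarith

/-- The points lying on a closed alternating path that does not return to them earlier. -/
def bad : Set X :=
  {x | ∃ (b : Bool) (L : List ℕ) (r : ℕ), 0 < r ∧
    S.path b (fun k => L.getD k 0) (2 * r) x = x ∧
    ∀ k, 0 < k → k < 2 * r → S.path b (fun k => L.getD k 0) k x ≠ x}

lemma bad_subset : S.bad ⊆ ⋃ (b : Bool) (L : List ℕ) (r : {r : ℕ // 0 < r}) (j : J),
    {x | S.path b (fun k => L.getD k 0) (2 * r) x = x ∧ x ∈ S.C j ∧
      ∀ k, 0 < k → k < 2 * r.1 → S.path b (fun k => L.getD k 0) k x ∉ S.C j} := by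
  classical
  rintro x ⟨b, L, r, hr, hx, hk⟩
  obtain ⟨j, hj, hF⟩ := S.C_sep x ((Finset.Ioo 0 (2 * r)).image
    fun k => S.path b (fun k => L.getD k 0) k x) (by
      simp only [Finset.mem_image, Finset.mem_Ioo, not_exists, not_and, and_imp]
      exact hk)
  simp only [mem_iUnion]
  refine ⟨b, L, ⟨r, hr⟩, j, hx, hj, fun k h0 h1 => hF _ ?_⟩
  exact Finset.mem_image_of_mem _ (Finset.mem_Ioo.2 ⟨h0, h1⟩)

lemma measure_bad [Countable J] : S.μ S.bad = 0 := by
  refine measure_mono_null S.bad_subset ?_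
  simp only [measure_iUnion_null_iff]
  exact fun b L r j => S.measure_closed_path_avoiding_eq_zero b _ r r.2 j

variable [StandardBorelSpace X]

lemma measurableSet_bad : MeasurableSet S.bad := by
  have h : S.bad = ⋃ (b : Bool) (L : List ℕ) (r : {r : ℕ // 0 < r}),
      {x | S.path b (fun k => L.getD k 0) (2 * r) x = x} ∩
        ⋂ k ∈ Ioo 0 (2 * r.1), {x | S.path b (fun k => L.getD k 0) k x = x}ᶜ := by
    ext x
    simp [bad, and_left_comm]
  rw [h]
  refine .iUnion fun b => .iUnion fun L => .iUnion fun r => ?_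
  refine .inter (measurableSet_eq_fun (S.path_pres _ _ _).measurable measurable_id) ?_
  exact .biInter (to_countable _) fun k _ =>
    (measurableSet_eq_fun (S.path_pres _ _ _).measurable measurable_id).compl

omit [StandardBorelSpace X]

/-- The largest set that is closed under both maps and avoids `bad`. -/
def good : Set X := {x | ∀ w : List Bool, w.foldl (fun y b => S.T b y) x ∉ S.bad}

lemma T_mem_good {x : X} (hx : x ∈ S.good) (b : Bool) : S.T b x ∈ S.good := fun w => hx (b :: w)

lemma iterate_mem_good {x : X} (hx : x ∈ S.good) (b : Bool) (k : ℕ) :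
    (S.T b)^[k] x ∈ S.good := by
  induction k with
  | zero => exact hx
  | succ k ih => rw [Function.iterate_succ_apply']; exact S.T_mem_good ih b

lemma foldl_pres (w : List Bool) :
    MeasurePreserving (fun x => w.foldl (fun y b => S.T b y) x) S.μ S.μ := by
  induction w with
  | nil => exact MeasurePreserving.id _
  | cons b w ih => exact ih.comp (S.T_pres b)

lemma good_eq : S.good = ⋂ w : List Bool, (fun x => w.foldl (fun y b => S.T b y) x) ⁻¹' S.badᶜ := by
  ext x
  simp [good]

lemma measurableSet_good [StandardBorelSpace X] : MeasurableSet S.good := by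
  rw [good_eq]
  exact .iInter fun w => (S.foldl_pres w).measurable S.measurableSet_bad.compl

lemma ae_mem_good [Countable J] : ∀ᵐ x ∂S.μ, x ∈ S.good := by
  simp only [good, mem_ofPred_eq, ae_all_iff]
  intro w
  exact (S.foldl_pres w).quasiMeasurePreserving.ae (measure_eq_zero_iff_ae_notMem.1 S.measure_bad)


lemma val_label_iterate (b : Bool) (k : ℕ) (x : X) :
    (S.label b ((S.T b)^[k] x) : ℕ) = ((S.label b x : ℕ) + k) % n := by
  induction k with
  | zero => simp [Nat.mod_eq_of_lt]
  | succ k ih =>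
    rw [Function.iterate_succ_apply', S.label_T, Fin.val_add, ih, Fin.val_one', Nat.mod_add_mod,
      Nat.add_mod_mod, add_assoc]

lemma iterate_modEq {b : Bool} {i j : ℕ} (h : i ≡ j [MOD n]) (x : X) :
    (S.T b)^[i] x = (S.T b)^[j] x := by
  have hp : Function.IsPeriodicPt (S.T b) n x := S.T_iter b x
  rw [← hp.iterate_mod_apply i, ← hp.iterate_mod_apply j, h]

lemma modEq_of_iterate_eq {b : Bool} {i j : ℕ} {x : X} (h : (S.T b)^[i] x = (S.T b)^[j] x) :
    i ≡ j [MOD n] := by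
  have h1 := congrArg (fun y => (S.label b y : ℕ)) h
  simp only [val_label_iterate] at h1
  exact Nat.ModEq.add_left_cancel' _ h1

/-- The point of label `0` in the orbit of `x` under `T b`. -/
def root (b : Bool) (x : X) : X := (S.T b)^[n - S.label b x] x

lemma label_root (b : Bool) (x : X) : S.label b (S.root b x) = 0 := by
  apply Fin.ext
  rw [root, val_label_iterate, Nat.add_sub_cancel' (S.label b x).2.le]
  simp

lemma iterate_root (b : Bool) (x : X) : (S.T b)^[S.label b x] (S.root b x) = x := by
  rw [root, ← Function.iterate_add_apply, Nat.add_sub_cancel' (S.label b x).2.le, S.T_iter]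

lemma root_of_label_eq_zero {b : Bool} {x : X} (h : S.label b x = 0) : S.root b x = x := by
  rw [root, h]
  exact S.T_iter b x

lemma root_T (b : Bool) (x : X) : S.root b (S.T b x) = S.root b x := by
  rw [root, root, ← Function.iterate_succ_apply]
  apply S.iterate_modEq
  apply Nat.ModEq.add_left_cancel' (S.label b x : ℕ)
  have h1 := S.val_label_iterate b 1 x
  simp only [Function.iterate_one] at h1
  have h2 : (S.label b x : ℕ) + (n - S.label b (S.T b x)).succ =
      (S.label b x + 1) + (n - S.label b (S.T b x)) := by omega
  rw [h2, Nat.add_sub_cancel' (S.label b x).2.le]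
  refine (((Nat.mod_modEq _ n).symm.trans (by rw [h1])).add_right _).trans
    (b := (S.label b (S.T b x) : ℕ) + (n - S.label b (S.T b x))) ?_
  rw [Nat.add_sub_cancel' (S.label b _).2.le]

lemma root_iterate (b : Bool) (k : ℕ) (x : X) : S.root b ((S.T b)^[k] x) = S.root b x :=
  S.invariant_iterate (S.root_T b) k x

lemma exists_iterate_of_root_eq {b : Bool} {x y : X} (h : S.root b x = S.root b y) :
    ∃ k, (S.T b)^[k] x = y := by
  refine ⟨S.label b y + (n - S.label b x), ?_⟩
  rw [Function.iterate_add_apply]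
  conv_rhs => rw [← S.iterate_root b y, ← h, root]

lemma measurable_root (b : Bool) : Measurable (S.root b) := by
  have h : ∀ k : Fin n, Measurable ((S.T b)^[n - k]) := fun k => (S.T_pres b).measurable.iterate _
  have := measurable_from_prod_countable_left (f := fun p : X × Fin n => (S.T b)^[n - p.2] p.1) h
  exact this.comp (measurable_id.prodMk (S.label_meas b))

lemma root_mem_good {x : X} (hx : x ∈ S.good) (b : Bool) : S.root b x ∈ S.good :=
  S.iterate_mem_good hx b _

lemma not_mem_bad_of_mem_good {x : X} (hx : x ∈ S.good) : x ∉ S.bad := hx []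

/-- A sequence of points, consecutive ones lying in a common orbit of `T b`, `T !b`, …
alternately, is an alternating path. -/
lemma exists_path_eq (b : Bool) (m : ℕ) (e : ℕ → X)
    (h : ∀ k < m, S.root (xor b k.bodd) (e k) = S.root (xor b k.bodd) (e (k + 1))) :
    ∃ L : List ℕ, ∀ k ≤ m, S.path b (fun k => L.getD k 0) k (e 0) = e k := by
  have h' : ∀ k, ∃ i, k < m → (S.T (xor b k.bodd))^[i] (e k) = e (k + 1) := by
    intro k
    by_cases hk : k < m
    · obtain ⟨i, hi⟩ := S.exists_iterate_of_root_eq (h k hk)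
      exact ⟨i, fun _ => hi⟩
    · exact ⟨0, fun h => absurd h hk⟩
  choose i hi using h'
  refine ⟨(List.range m).map i, fun k => ?_⟩
  induction k with
  | zero => intro _; rfl
  | succ k ih =>
    intro hk
    rw [path, ih (by omega), ← hi k (by omega)]
    simp [List.getD, show k < m by omega]

lemma mem_bad_of_closed {b : Bool} {r : ℕ} (hr : 0 < r) {e : ℕ → X}
    (h : ∀ k < 2 * r, S.root (xor b k.bodd) (e k) = S.root (xor b k.bodd) (e (k + 1)))
    (hclosed : e (2 * r) = e 0) (hne : ∀ k, 0 < k → k < 2 * r → e k ≠ e 0) : e 0 ∈ S.bad := by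
  obtain ⟨L, hL⟩ := S.exists_path_eq b _ e h
  refine ⟨b, L, r, hr, (hL _ le_rfl).trans hclosed, fun k h0 h1 => ?_⟩
  rw [hL k h1.le]
  exact hne k h0 h1

lemma eq_of_root_eq {x y : X} (hx : x ∈ S.good) (h : ∀ b, S.root b x = S.root b y) : x = y := by
  by_contra hne
  refine S.not_mem_bad_of_mem_good hx (S.mem_bad_of_closed (b := false) (r := 1) one_pos
    (e := fun k => if k = 1 then y else x) ?_ (by simp) ?_)
  · intro k hk
    interval_cases k
    · simpa using h _
    · simpa using (h _).symm
  · intro k h0 h1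
    obtain rfl : k = 1 := by omega
    simpa using Ne.symm hne

/-- The orbits of `T false` and of `T true` consisting of good points, each represented by its
point of label `0`. -/
abbrev Vertex : Type := {p : X × Bool // p.1 ∈ S.good ∧ S.label p.2 p.1 = 0}

/-- The orbit of `z` under `T b`. -/
def vert (b : Bool) (z : X) (hz : z ∈ S.good) : S.Vertex :=
  ⟨(S.root b z, b), S.root_mem_good hz b, S.label_root b _⟩

/-- The intersection graph of the orbits. -/
def graph : SimpleGraph S.Vertex where
  Adj p q := p.1.2 ≠ q.1.2 ∧ ∃ z, S.root p.1.2 z = p.1.1 ∧ S.root q.1.2 z = q.1.1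
  symm := ⟨fun _ _ ⟨h, z, h1, h2⟩ => ⟨h.symm, z, h2, h1⟩⟩
  loopless := ⟨fun _ h => h.1 rfl⟩

lemma mem_good_of_root_eq {p : S.Vertex} {z : X} (h : S.root p.1.2 z = p.1.1) : z ∈ S.good := by
  rw [← S.iterate_root p.1.2 z, h]
  exact S.iterate_mem_good p.2.1 _ _

lemma vert_adj (b : Bool) (z : X) (hz : z ∈ S.good) :
    S.graph.Adj (S.vert b z hz) (S.vert (!b) z hz) :=
  ⟨by simp [vert], z, rfl, rfl⟩

lemma exists_of_adj {p q : S.Vertex} (h : S.graph.Adj p q) :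
    ∃ (z : X) (hz : z ∈ S.good), p = S.vert p.1.2 z hz ∧ q = S.vert (!p.1.2) z hz := by
  obtain ⟨hne, z, h1, h2⟩ := h
  have hq : (!p.1.2) = q.1.2 := by
    cases hp : p.1.2 <;> cases hq : q.1.2 <;> simp_all
  refine ⟨z, S.mem_good_of_root_eq h1, Subtype.ext (Prod.ext h1.symm rfl),
    Subtype.ext (Prod.ext ?_ ?_)⟩
  · simp only [vert]
    rw [hq, h2]
  · exact hq.symm

lemma vert_injective {b : Bool} {z z' : X} {hz : z ∈ S.good} {hz' : z' ∈ S.good}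
    (h : S.vert b z hz = S.vert b z' hz') (h' : S.vert (!b) z hz = S.vert (!b) z' hz') :
    z = z' := by
  have h1 : S.root b z = S.root b z' := congrArg (fun p => p.1.1) h
  have h2 : S.root (!b) z = S.root (!b) z' := congrArg (fun p => p.1.1) h'
  refine S.eq_of_root_eq hz fun c => ?_
  cases b <;> cases c <;> assumption

lemma vert_iterate (b : Bool) (k : ℕ) {z : X} (hz : z ∈ S.good) :
    S.vert b ((S.T b)^[k] z) (S.iterate_mem_good hz b k) = S.vert b z hz :=
  Subtype.ext (Prod.ext (S.root_iterate b k z) rfl)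

lemma vert_self (p : S.Vertex) : S.vert p.1.2 p.1.1 p.2.1 = p :=
  Subtype.ext (Prod.ext (S.root_of_label_eq_zero p.2.2) rfl)

lemma exists_fin_iterate {b : Bool} {z z' : X} {hz : z ∈ S.good} {hz' : z' ∈ S.good}
    (h : S.vert b z hz = S.vert b z' hz') : ∃ i : Fin n, (S.T b)^[i] z = z' := by
  obtain ⟨k, hk⟩ := S.exists_iterate_of_root_eq (congrArg (fun p => p.1.1) h : S.root b z = _)
  exact ⟨⟨k % n, Nat.mod_lt _ (NeZero.pos n)⟩,
    (S.iterate_modEq (Nat.mod_modEq k n) z).trans hk⟩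

lemma fin_iterate_injective (b : Bool) (z : X) :
    Function.Injective fun i : Fin n => (S.T b)^[i] z := by
  intro i j h
  exact Fin.ext (Nat.ModEq.eq_of_lt_of_lt (S.modEq_of_iterate_eq h) i.2 j.2)

lemma encard_neighborSet (p : S.Vertex) : (S.graph.neighborSet p).encard = n := by
  set g : Fin n → S.Vertex := fun i =>
    S.vert (!p.1.2) ((S.T p.1.2)^[i] p.1.1) (S.iterate_mem_good p.2.1 _ _) with hg
  have hinj : Function.Injective g := by
    intro i j h
    refine S.fin_iterate_injective p.1.2 p.1.1 (S.vert_injective (b := p.1.2) ?_ h)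
    rw [vert_iterate, vert_iterate]
    exact p.2.1
  have hrange : S.graph.neighborSet p = range g := by
    ext q
    constructor
    · intro h
      obtain ⟨z, hz, hp, hq⟩ := S.exists_of_adj h
      obtain ⟨i, hi⟩ := S.exists_fin_iterate ((S.vert_self p).trans hp)
      refine ⟨i, ?_⟩
      rw [hq]
      simp only [hg, hi]
    · rintro ⟨i, rfl⟩
      have := S.vert_adj p.1.2 _ (S.iterate_mem_good p.2.1 p.1.2 i)
      rwa [vert_iterate _ _ _ p.2.1, vert_self] at this
  rw [hrange, ← image_univ, hinj.encard_image]
  simp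

lemma isAcyclic : S.graph.IsAcyclic := by
  intro v c hc
  set m := c.length with hm
  have hm3 : 3 ≤ m := hc.three_le_length
  set g := c.getVert with hg
  have hadj : ∀ k, k < m → S.graph.Adj (g k) (g (k + 1)) := fun k hk => c.adj_getVert_succ hk
  have hg0 : g 0 = v := c.getVert_zero
  have hgm : g m = v := c.getVert_length
  have hpar : ∀ k, k ≤ m → (g k).1.2 = xor v.1.2 k.bodd := by
    intro k
    induction k with
    | zero => intro _; simp [hg0]
    | succ k ih =>
      intro hk
      have h1 := (hadj k hk).1
      rw [ih (by omega)] at h1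
      rw [Nat.bodd_succ]
      revert h1
      cases (g (k + 1)).1.2 <;> cases v.1.2 <;> cases k.bodd <;> simp
  have heven : m.bodd = false := by
    have h1 := hpar m le_rfl
    rw [hgm] at h1
    revert h1
    cases v.1.2 <;> cases m.bodd <;> simp
  obtain ⟨r, hr⟩ : ∃ r, m = 2 * r := by
    refine ⟨m.div2, ?_⟩
    have := Nat.bodd_add_div2 m
    rw [heven] at this
    simpa using this.symm
  have hedge : ∀ k, ∃ z, k < m →
      S.root (g k).1.2 z = (g k).1.1 ∧ S.root (g (k + 1)).1.2 z = (g (k + 1)).1.1 := by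
    intro k
    by_cases hk : k < m
    · obtain ⟨_, z, hz⟩ := hadj k hk
      exact ⟨z, fun _ => hz⟩
    · exact ⟨v.1.1, fun h => absurd h hk⟩
  choose z hz using hedge
  set e : ℕ → X := fun k => if k = m then z 0 else z k with he
  have he0 : e 0 = z 0 := by simp [he]
  have hem : e m = z 0 := by simp [he]
  have hek : ∀ k, k < m → e k = z k := fun k hk => by simp [he, hk.ne]
  have hgood : e 0 ∈ S.good := by
    rw [he0]
    exact S.mem_good_of_root_eq (hz 0 (by omega)).1
  refine S.not_mem_bad_of_mem_good hgood
    (S.mem_bad_of_closed (b := !v.1.2) (r := r) (by omega) (e := e) ?_ ?_ ?_)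
  · intro k hk
    have hk' : k < m := by omega
    have hb : (xor (!v.1.2) k.bodd) = (g (k + 1)).1.2 := by
      rw [hpar (k + 1) hk', Nat.bodd_succ]
      cases v.1.2 <;> cases k.bodd <;> rfl
    rw [hb, hek k hk', (hz k hk').2]
    rcases Nat.lt_or_ge (k + 1) m with h1 | h1
    · rw [hek _ h1, (hz _ h1).1]
    · have h2 : k + 1 = m := by omega
      have h3 := (hz 0 (by omega)).1
      rw [hg0] at h3
      rw [h2, hem, hgm, h3]
  · rw [← hr, hem, he0]
  · intro k h0 h1 h
    have hk' : k < m := by omega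
    rw [hek k hk', he0] at h
    have hmem : ∀ l, l ≤ m → S.root (g l).1.2 (z 0) = (g l).1.1 → g l = g 0 ∨ g l = g 1 := by
      intro l hl hroot
      have hb : (g l).1.2 = (g 0).1.2 ∨ (g l).1.2 = (g 1).1.2 := by
        rw [hpar l hl, hpar 0 (by omega), hpar 1 (by omega)]
        cases v.1.2 <;> cases l.bodd <;> simp
      rcases hb with hb | hb
      · left
        exact Subtype.ext (Prod.ext (by rw [← hroot, hb, (hz 0 (by omega)).1]) hb)
      · right
        exact Subtype.ext (Prod.ext (by rw [← hroot, hb, (hz 0 (by omega)).2]) hb)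
    have hinj : ∀ i j, i < m → j < m → g i = g j → i = j := fun i j hi hj hij =>
      hc.getVert_injOn' (by simp; omega) (by simp; omega) hij
    have hk1 : k = 1 := by
      rcases hmem k hk'.le (h ▸ (hz k hk').1) with h2 | h2
      · exact absurd (hinj _ _ hk' (by omega) h2) h0.ne'
      · exact hinj _ _ hk' (by omega) h2
    subst hk1
    rcases hmem 2 (by omega) (h ▸ (hz 1 hk').2) with h2 | h2
    · exact absurd (hinj _ _ (by omega) (by omega) h2) (by omega)
    · exact absurd (hinj _ _ (by omega) (by omega) h2) (by omega)

lemma measurableSet_adj [StandardBorelSpace X] :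
    MeasurableSet {p : S.Vertex × S.Vertex | S.graph.Adj p.1 p.2} := by
  have h : {p : S.Vertex × S.Vertex | S.graph.Adj p.1 p.2} =
      ⋃ (b : Bool) (k : ℕ), {p : S.Vertex × S.Vertex | p.1.1.2 = b} ∩
        ({p : S.Vertex × S.Vertex | p.2.1.2 = !b} ∩
          {p : S.Vertex × S.Vertex | S.root (!b) ((S.T b)^[k] p.1.1.1) = p.2.1.1}) := by
    ext ⟨p, q⟩
    simp only [mem_iUnion, mem_inter_iff, mem_ofPred_eq]
    constructor
    · intro h
      obtain ⟨z, hz, hp, hq⟩ := S.exists_of_adj h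
      refine ⟨p.1.2, S.label p.1.2 z, rfl, by rw [hq]; rfl, ?_⟩
      rw [hq]
      conv_lhs => rw [hp]
      simp only [vert]
      rw [S.iterate_root]
    · rintro ⟨b, k, rfl, hq, hk⟩
      refine ⟨by rw [hq]; simp, (S.T p.1.2)^[k] p.1.1, ?_, ?_⟩
      · rw [root_iterate, S.root_of_label_eq_zero p.2.2]
      · rw [hq, hk]
  rw [h]
  have m1 : Measurable fun p : S.Vertex × S.Vertex => p.1.1.2 := by fun_prop
  have m2 : Measurable fun p : S.Vertex × S.Vertex => p.2.1.2 := by fun_prop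
  have m3 : Measurable fun p : S.Vertex × S.Vertex => p.1.1.1 := by fun_prop
  have m4 : Measurable fun p : S.Vertex × S.Vertex => p.2.1.1 := by fun_prop
  refine .iUnion fun b => .iUnion fun k => .inter (m1 (measurableSet_singleton b))
    (.inter (m2 (measurableSet_singleton (!b))) (measurableSet_eq_fun ?_ m4))
  exact (S.measurable_root _).comp (((S.T_pres b).measurable.iterate k).comp m3)

lemma standardBorelSpace_vertex [StandardBorelSpace X] : StandardBorelSpace S.Vertex := by
  apply MeasurableSet.standardBorel
  have h : {p : X × Bool | p.1 ∈ S.good ∧ S.label p.2 p.1 = 0} =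
      Prod.fst ⁻¹' S.good ∩
        ⋃ b : Bool, Prod.snd ⁻¹' {b} ∩ (fun p : X × Bool => S.label b p.1) ⁻¹' {0} := by
    ext ⟨x, b⟩
    cases b <;> simp
  change MeasurableSet {p : X × Bool | p.1 ∈ S.good ∧ S.label p.2 p.1 = 0}
  rw [h]
  exact (measurable_fst S.measurableSet_good).inter (.iUnion fun b =>
    (measurable_snd (measurableSet_singleton b)).inter
      (((S.label_meas b).comp measurable_fst) (measurableSet_singleton 0)))

/-- A set meeting almost every orbit of `T b` in one point captures the fraction `1 / n` of the
integral of every invariant function. -/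
lemma mul_setIntegral_of_transversal {b : Bool} {Y : Set X} (hY : MeasurableSet Y)
    (h : ∀ᵐ x ∂S.μ, ∃! i : Fin n, (S.T b)^[i] x ∈ Y) {f : X → ℝ} (hfi : Integrable f S.μ)
    (hf : ∀ x, f (S.T b x) = f x) : n * ∫ x in Y, f x ∂S.μ = ∫ x, f x ∂S.μ := by
  have hYi : Integrable (Y.indicator f) S.μ := hfi.indicator hY
  have hp : ∀ i : Fin n, MeasurePreserving ((S.T b)^[i]) S.μ S.μ := fun i => (S.T_pres b).iterate _
  have h1 : ∀ i : Fin n, ∫ x, Y.indicator f ((S.T b)^[i] x) ∂S.μ = ∫ x in Y, f x ∂S.μ := by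
    intro i
    rw [← integral_map (f := Y.indicator f) (hp i).measurable.aemeasurable, (hp i).map_eq,
      integral_indicator hY]
    rw [(hp i).map_eq]
    exact hYi.aestronglyMeasurable
  have h2 : ∫ x, ∑ i : Fin n, Y.indicator f ((S.T b)^[i] x) ∂S.μ = n * ∫ x in Y, f x ∂S.μ := by
    rw [integral_finsetSum Finset.univ fun (i : Fin n) _ =>
      show Integrable (fun x => Y.indicator f ((S.T b)^[i] x)) S.μ from
        (hp i).integrable_comp_of_integrable hYi]
    simp [h1]
  rw [← h2]
  refine integral_congr_ae ?_
  filter_upwards [h] with x hx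
  obtain ⟨i, hi, hu⟩ := hx
  rw [Finset.sum_eq_single i]
  · rw [indicator_of_mem hi, S.invariant_iterate hf]
  · intro j _ hj
    exact indicator_of_notMem (fun hjY => hj (hu j hjY)) _
  · simp

/-- No measurable set meets almost every orbit of both maps in exactly one point. -/
lemma not_transversal (hn : 1 < n) {Y : Set X} (hY : MeasurableSet Y)
    (h : ∀ b, ∀ᵐ x ∂S.μ, ∃! i : Fin n, (S.T b)^[i] x ∈ Y) : False := by
  have := S.isProb
  have hC : ∀ j, n * S.μ.real (Y ∩ S.C j) = S.μ.real (S.C j) := by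
    intro j
    by_contra hne
    obtain ⟨f, hfi, hf, hlt⟩ := S.rigid j (|n * S.μ.real (Y ∩ S.C j) - S.μ.real (S.C j)| / (n + 1))
      (div_pos (abs_pos.2 (sub_ne_zero.2 hne)) (by positivity))
    have hCi : Integrable ((S.C j).indicator (1 : X → ℝ)) S.μ :=
      (integrable_const (1 : ℝ)).indicator (S.C_meas j)
    set err : X → ℝ := (S.C j).indicator 1 - f false - f true with herr
    replace hlt : ∫ x, |err x| ∂S.μ <
      |n * S.μ.real (Y ∩ S.C j) - S.μ.real (S.C j)| / (n + 1) := hlt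
    have herri : Integrable err S.μ := (hCi.sub (hfi false)).sub (hfi true)
    have e1 : ∫ x, err x ∂S.μ =
        S.μ.real (S.C j) - ∫ x, f false x ∂S.μ - ∫ x, f true x ∂S.μ := by
      rw [herr, integral_sub' (hCi.sub (hfi false)) (hfi true), integral_sub' hCi (hfi false),
        integral_indicator_one (S.C_meas j)]
    have e2 : ∫ x in Y, err x ∂S.μ = S.μ.real (Y ∩ S.C j) -
        ∫ x in Y, f false x ∂S.μ - ∫ x in Y, f true x ∂S.μ := by
      rw [herr, integral_sub' (hCi.sub (hfi false)).integrableOn (hfi true).integrableOn,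
        integral_sub' hCi.integrableOn (hfi false).integrableOn,
        integral_indicator_one (S.C_meas j), measureReal_restrict_apply (S.C_meas j), inter_comm]
    have e3 : n * S.μ.real (Y ∩ S.C j) - S.μ.real (S.C j) =
        n * ∫ x in Y, err x ∂S.μ - ∫ x, err x ∂S.μ := by
      rw [e1, e2, ← S.mul_setIntegral_of_transversal hY (h false) (hfi false) (hf false),
        ← S.mul_setIntegral_of_transversal hY (h true) (hfi true) (hf true)]
      ring
    have e4 : |∫ x in Y, err x ∂S.μ| ≤ ∫ x, |err x| ∂S.μ :=
      abs_integral_le_integral_abs.trans (setIntegral_le_integral herri.abs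
        (Filter.Eventually.of_forall fun _ => abs_nonneg _))
    have e5 : |∫ x, err x ∂S.μ| ≤ ∫ x, |err x| ∂S.μ := abs_integral_le_integral_abs
    have e6 : |n * S.μ.real (Y ∩ S.C j) - S.μ.real (S.C j)| ≤ (n + 1) * ∫ x, |err x| ∂S.μ := by
      rw [e3]
      refine (abs_sub _ _).trans ?_
      rw [abs_mul, Nat.abs_cast, add_mul, one_mul]
      gcongr
    rw [lt_div_iff₀ (by positivity)] at hlt
    linarith
  have hμ : (n : ENNReal) • S.μ.restrict Y = S.μ := by
    have hC' : ∀ j, ((n : ENNReal) • S.μ.restrict Y) (S.C j) = S.μ (S.C j) := by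
      intro j
      have := hC j
      rw [Measure.smul_apply, Measure.restrict_apply (S.C_meas j), inter_comm, smul_eq_mul]
      rw [← ENNReal.toReal_eq_toReal_iff' (by finiteness) (by finiteness)]
      simpa [Measure.real] using this
    have hfin : IsFiniteMeasure ((n : ENNReal) • S.μ.restrict Y) :=
      Measure.smul_finite _ (by simp)
    refine ext_of_generate_finite _ S.C_gen S.C_pi ?_ ?_
    · rintro _ ⟨j, rfl⟩
      exact hC' j
    · obtain ⟨j, hj⟩ := S.C_univ
      rw [← hj]
      exact hC' j
  have h1 : S.μ Yᶜ = 0 := by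
    rw [← hμ]
    simp [Measure.restrict_apply hY.compl]
  have h2 : n * S.μ Y = 1 := by
    have := congrArg (fun ν : Measure X => ν univ) hμ
    simpa using this
  rw [(prob_compl_eq_zero_iff hY).1 h1, mul_one] at h2
  have : n = 1 := by exact_mod_cast h2
  omega

lemma not_exists_matching [Countable J] [StandardBorelSpace X] (hn : 1 < n) :
    ¬∃ M : Set (S.Vertex × S.Vertex), MeasurableSet M ∧ (∀ p ∈ M, S.graph.Adj p.1 p.2) ∧
      (∀ x y, (x, y) ∈ M → (y, x) ∈ M) ∧ (∀ x, ∃! y, (x, y) ∈ M) := by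
  rintro ⟨M, hM, hadj, hsymm, hM1⟩
  set φ : S.good → S.Vertex × S.Vertex := fun z => (S.vert false z z.2, S.vert true z z.2) with hφ
  have hφm : Measurable φ := by
    have hv : ∀ b, Measurable fun z : S.good => S.vert b z z.2 := fun b =>
      (((S.measurable_root b).comp measurable_subtype_coe).prodMk measurable_const).subtype_mk
    exact (hv false).prodMk (hv true)
  set Y : Set X := Subtype.val '' (φ ⁻¹' M) with hYdef
  have hY : MeasurableSet Y := S.measurableSet_good.subtype_image (hφm hM)
  have hYmem : ∀ (b : Bool) (z : X) (hz : z ∈ S.good),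
      z ∈ Y ↔ (S.vert b z hz, S.vert (!b) z hz) ∈ M := by
    intro b z hz
    have h1 : z ∈ Y ↔ (S.vert false z hz, S.vert true z hz) ∈ M := by
      simp [hYdef, hφ, hz]
    rw [h1]
    cases b
    · rfl
    · exact ⟨hsymm _ _, hsymm _ _⟩
  refine S.not_transversal hn hY fun b => ?_
  filter_upwards [S.ae_mem_good] with x hx
  obtain ⟨w, hw, hu⟩ := hM1 (S.vert b x hx)
  obtain ⟨z, hz, hp, hq⟩ := S.exists_of_adj (hadj _ hw)
  simp only [vert] at hp hq
  have hp' : S.vert b x hx = S.vert b z hz := hp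
  have hq' : w = S.vert (!b) z hz := hq
  obtain ⟨i, hi⟩ := S.exists_fin_iterate hp'
  refine ⟨i, ?_, fun j hj => ?_⟩
  · simp only [hi]
    rw [hYmem b z hz, ← hp', ← hq']
    exact hw
  · have hjg := S.iterate_mem_good hx b j
    have hj' := (hYmem b _ hjg).1 hj
    rw [S.vert_iterate b j hx] at hj'
    have h3 := hu _ hj'
    refine S.fin_iterate_injective b x ?_
    simp only [hi]
    refine S.vert_injective (b := b) (hz := hjg) (hz' := hz) ?_ (h3.trans hq')
    rw [S.vert_iterate b j hx, hp']

end RigidSystem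

/-- The coordinates of a configuration: a word in the two moves together with the name of a
colour. The colours named by `Bool` play the role of equivariant labels for the two moves. -/
abbrev ConfigIdx := List Bool × (Bool ⊕ ℕ)

/-- Families of colours along words that are compatible with both moves having order `n` and with
the two equivariant labels. -/
def configSet (n : ℕ) [NeZero n] : Set (ConfigIdx → Fin n) :=
  {x | ∀ w b, (∀ v k, x (w ++ List.replicate n b ++ v, k) = x (w ++ v, k)) ∧
    x (w ++ [b], .inl b) = x (w, .inl b) + 1}

/-- The compact space of configurations. -/
abbrev Config (n : ℕ) [NeZero n] := configSet n

namespace Config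

variable {n : ℕ} [NeZero n]

lemma isClosed_configSet : IsClosed (configSet n) := by
  simp only [configSet, ofPred_forall, ofPred_and]
  refine isClosed_iInter fun w => isClosed_iInter fun b => IsClosed.inter
    (isClosed_iInter fun v => isClosed_iInter fun k => ?_) ?_
  · exact isClosed_eq (continuous_apply _) (continuous_apply _)
  · exact isClosed_eq (continuous_apply _) ((continuous_of_discreteTopology
      (f := fun a : Fin n => a + 1)).comp (continuous_apply _))

instance : CompactSpace (Config n) := isCompact_iff_compactSpace.1 isClosed_configSet.isCompact

instance : StandardBorelSpace (Config n) := isClosed_configSet.measurableSet.standardBorel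

lemma continuous_coord (p : ConfigIdx) : Continuous fun x : Config n => x.1 p :=
  (continuous_apply p).comp continuous_subtype_val

/-- The action of a move on configurations. -/
def move (b : Bool) (x : Config n) : Config n :=
  ⟨fun p => x.1 (b :: p.1, p.2), fun w c =>
    ⟨fun v k => (x.2 (b :: w) c).1 v k, (x.2 (b :: w) c).2⟩⟩

lemma continuous_move (b : Bool) : Continuous (move b : Config n → Config n) :=
  (continuous_pi fun _ => continuous_coord _).subtype_mk _

lemma move_iterate_apply (b : Bool) (k : ℕ) (x : Config n) (p : ConfigIdx) :
    ((move b)^[k] x).1 p = x.1 (List.replicate k b ++ p.1, p.2) := by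
  induction k generalizing x with
  | zero => simp
  | succ k ih =>
    rw [Function.iterate_succ_apply, ih]
    simp [move, List.replicate_succ]

lemma move_iterate (b : Bool) (x : Config n) : (move b)^[n] x = x := by
  ext p : 2
  rw [move_iterate_apply]
  simpa using (x.2 [] b).1 p.1 p.2

/-- The equivariant label of a configuration for a move. -/
def lab (b : Bool) (x : Config n) : Fin n := x.1 ([], .inl b)

lemma lab_move (b : Bool) (x : Config n) : lab b (move b x) = lab b x + 1 :=
  (x.2 [] b).2

/-- The configurations with prescribed values at finitely many coordinates. -/
def cyl (I : Finset (ConfigIdx × Fin n)) : Set (Config n) := {x | ∀ p ∈ I, x.1 p.1 = p.2}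

lemma isClopen_cyl (I : Finset (ConfigIdx × Fin n)) : IsClopen (cyl I) := by
  have : cyl I = ⋂ p ∈ I, (fun x : Config n => x.1 p.1) ⁻¹' {p.2} := by
    ext x
    simp [cyl]
  rw [this]
  exact isClopen_biInter_finset fun p _ =>
    (isClopen_discrete {p.2}).preimage (continuous_coord p.1)

lemma isPiSystem_cyl : IsPiSystem (range (cyl (n := n))) := by
  rintro _ ⟨I, rfl⟩ _ ⟨J, rfl⟩ -
  refine ⟨I ∪ J, ?_⟩
  ext x
  simp only [cyl, mem_inter_iff, Set.mem_ofPred_eq, Finset.mem_union]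
  grind

lemma generateFrom_cyl :
    (inferInstance : MeasurableSpace (Config n)) =
      MeasurableSpace.generateFrom (range (cyl (n := n))) := by
  refine le_antisymm ?_ ?_
  · have h : @Measurable _ _ (MeasurableSpace.generateFrom (range (cyl (n := n))))
        MeasurableSpace.pi (Subtype.val : Config n → ConfigIdx → Fin n) := by
      refine @measurable_pi_lambda _ _ _ (MeasurableSpace.generateFrom _) _ _ fun p => ?_
      refine @measurable_to_countable' _ _ _ _ (MeasurableSpace.generateFrom _) _ fun a => ?_
      refine MeasurableSpace.measurableSet_generateFrom ⟨{(p, a)}, ?_⟩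
      ext x
      simp [cyl]
    exact h.comap_le
  · refine MeasurableSpace.generateFrom_le ?_
    rintro _ ⟨I, rfl⟩
    exact (isClopen_cyl I).isClosed.measurableSet

lemma exists_cyl_separating (x : Config n) (F : Finset (Config n)) (hx : x ∉ F) :
    ∃ I, x ∈ cyl I ∧ ∀ y ∈ F, y ∉ cyl I := by
  have h : ∀ y : Config n, ∃ p, y ∈ F → x.1 p ≠ y.1 p := fun y => by
    by_contra! h
    have hy := (h ([], .inl true)).1
    exact hx ((Subtype.ext (funext fun p => (h p).2) : x = y) ▸ hy)
  choose p hp using h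
  refine ⟨F.image fun y => (p y, x.1 (p y)), ?_, fun y hy hc => hp y hy ?_⟩
  · simp only [cyl, Set.mem_ofPred_eq, Finset.mem_image]
    rintro _ ⟨y, -, rfl⟩
    rfl
  · exact (hc _ (Finset.mem_image_of_mem _ hy)).symm

/-- The indicator function of a cylinder, as a continuous function. -/
noncomputable def cylFun (I : Finset (ConfigIdx × Fin n)) : C(Config n, ℝ) :=
  ⟨(cyl I).indicator 1, (isClopen_cyl I).continuous_indicator continuous_one⟩

lemma exists_finset_subset_of_mem_nhds {x : Config n} {U : Set (Config n)} (hU : U ∈ nhds x) :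
    ∃ P : Finset ConfigIdx, {y | ∀ p ∈ P, y.1 p = x.1 p} ⊆ U := by
  rw [nhds_subtype, Filter.mem_comap] at hU
  obtain ⟨V, hV, hVU⟩ := hU
  rw [nhds_pi, Filter.mem_pi] at hV
  obtain ⟨P, hP, t, ht, htV⟩ := hV
  refine ⟨hP.toFinset, fun y hy => hVU (htV fun p hp => ?_)⟩
  rw [hy p (hP.mem_toFinset.2 hp)]
  exact mem_of_mem_nhds (ht p)

lemma exists_finset_dist_lt (φ : C(Config n, ℝ)) {η : ℝ} (hη : 0 < η) :
    ∃ P : Finset ConfigIdx, ∀ x y : Config n, (∀ p ∈ P, x.1 p = y.1 p) → |φ x - φ y| < η := by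
  classical
  have h : ∀ x : Config n, ∃ P : Finset ConfigIdx,
      ∀ y : Config n, (∀ p ∈ P, y.1 p = x.1 p) → |φ y - φ x| < η / 2 := fun x =>
    exists_finset_subset_of_mem_nhds
      (φ.continuous.continuousAt.eventually (Metric.ball_mem_nhds (φ x) (half_pos hη)))
  choose P hP using h
  have hnhds : ∀ x : Config n, {y : Config n | ∀ p ∈ P x, y.1 p = x.1 p} ∈ nhds x := fun x =>
    (Filter.eventually_all_finset _).2 fun p _ =>
      ((continuous_coord p).continuousAt.eventually (mem_nhds_discrete.2 rfl :
        ({x.1 p} : Set (Fin n)) ∈ nhds (x.1 p)))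
  obtain ⟨t, -, ht⟩ := isCompact_univ.elim_nhds_subcover _ fun x _ => hnhds x
  refine ⟨t.biUnion P, fun x y hxy => ?_⟩
  obtain ⟨z, hz, hxz⟩ := mem_iUnion₂.1 (ht (mem_univ x))
  have h1 := hP z x hxz
  have h2 := hP z y fun p hp =>
    (hxy p (Finset.mem_biUnion.2 ⟨z, hz, hp⟩)).symm.trans (hxz p hp)
  rw [abs_lt] at h1 h2 ⊢
  constructor <;> linarith

/-- The average of a function along the orbits of a move. -/
noncomputable def moveAverage (b : Bool) (f : C(Config n, ℝ)) : C(Config n, ℝ) :=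
  ⟨fun x => (n : ℝ)⁻¹ * ∑ i ∈ Finset.range n, f ((move b)^[i] x), continuous_const.mul
    (continuous_finsetSum _ fun i _ => f.continuous.comp ((continuous_move b).iterate i))⟩

lemma moveAverage_move (b : Bool) (f : C(Config n, ℝ)) (x : Config n) :
    moveAverage b f (move b x) = moveAverage b f x := by
  simp only [moveAverage, ContinuousMap.coe_mk, ← Function.iterate_succ_apply]
  congr 1
  have h1 := Finset.sum_range_succ (fun i => f ((move b)^[i] x)) n
  have h2 := Finset.sum_range_succ' (fun i => f ((move b)^[i] x)) n
  rw [move_iterate] at h1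
  simp only [Function.iterate_zero, id] at h2
  linarith

end Config

lemma Fin.nsmul_one_self (n : ℕ) [NeZero n] : n • (1 : Fin n) = 0 := by
  simpa using card_nsmul_eq_zero' (x := (1 : Fin n))

/-- A finite set with two maps of order `n`, coloured so that every point determines a
configuration. -/
structure FinSys (n : ℕ) [NeZero n] where
  E : Type
  [fin : Fintype E]
  [ne : Nonempty E]
  σ : Bool → E → E
  col : E → Bool ⊕ ℕ → Fin n
  σ_iter : ∀ b e, (σ b)^[n] e = e
  col_σ : ∀ b e, col (σ b e) (.inl b) = col e (.inl b) + 1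

namespace FinSys

variable {n : ℕ} [NeZero n] (F : FinSys n)

instance : Fintype F.E := F.fin

instance : Nonempty F.E := F.ne

/-- The point reached by following a word of moves. -/
def act (w : List Bool) (e : F.E) : F.E := w.foldl (fun e b => F.σ b e) e

lemma act_replicate (b : Bool) (k : ℕ) (e : F.E) :
    F.act (List.replicate k b) e = (F.σ b)^[k] e := by
  induction k generalizing e with
  | zero => rfl
  | succ k ih => exact ih _

lemma act_append (v w : List Bool) (e : F.E) : F.act (v ++ w) e = F.act w (F.act v e) :=
  List.foldl_append

/-- The configuration determined by a point of a finite system. -/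
def code (e : F.E) : Config n :=
  ⟨fun p => F.col (F.act p.1 e) p.2, fun w b =>
    ⟨fun v k => by simp only [act_append, act_replicate, F.σ_iter],
      by simp only [act_append]; exact F.col_σ _ _⟩⟩

lemma code_σ (b : Bool) (e : F.E) : F.code (F.σ b e) = Config.move b (F.code e) := rfl

lemma code_iterate (b : Bool) (k : ℕ) (e : F.E) :
    F.code ((F.σ b)^[k] e) = (Config.move b)^[k] (F.code e) := by
  induction k generalizing e with
  | zero => rfl
  | succ k ih => rw [Function.iterate_succ_apply, ih, code_σ, Function.iterate_succ_apply]

/-- The distribution of the configuration of a uniformly random point. -/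
noncomputable def measure : ProbabilityMeasure (Config n) :=
  ⟨∑ e : F.E, (Fintype.card F.E : ENNReal)⁻¹ • Measure.dirac (F.code e), ⟨by
    simp [ENNReal.mul_inv_cancel]⟩⟩

lemma integral_measure (φ : C(Config n, ℝ)) :
    ∫ x, φ x ∂(F.measure : Measure (Config n)) =
      (Fintype.card F.E : ℝ)⁻¹ * ∑ e, φ (F.code e) := by
  have h : ∀ e ∈ (Finset.univ : Finset F.E),
      Integrable φ ((Fintype.card F.E : ENNReal)⁻¹ • Measure.dirac (F.code e)) := fun e _ =>
    (integrable_dirac (by simp)).smul_measure (by simp)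
  simp only [measure, ProbabilityMeasure.coe_mk]
  rw [integral_finsetSum_measure h, Finset.mul_sum]
  simp [integral_smul_measure]

lemma integral_move (b : Bool) (φ : C(Config n, ℝ)) :
    ∫ x, φ (Config.move b x) ∂(F.measure : Measure (Config n)) =
      ∫ x, φ x ∂(F.measure : Measure (Config n)) := by
  have h := F.integral_measure (φ.comp ⟨_, Config.continuous_move b⟩)
  simp only [ContinuousMap.comp_apply, ContinuousMap.coe_mk] at h
  rw [h, F.integral_measure]
  congr 1
  have hb : Function.Bijective (F.σ b) := by
    refine Finite.injective_iff_bijective.1 fun e e' he => ?_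
    have hk : ∀ k, k ≠ 0 → (F.σ b)^[k] e = (F.σ b)^[k] e' := fun k hk => by
      cases k with
      | zero => exact absurd rfl hk
      | succ k => rw [Function.iterate_succ_apply, Function.iterate_succ_apply, he]
    rw [← F.σ_iter b e, ← F.σ_iter b e', hk n (NeZero.ne n)]
  exact Fintype.sum_bijective _ hb _ _ fun e => by rw [code_σ]

/-- A function on the points of a finite system whose colours separate points extends to a
continuous function of the configuration. -/
lemma exists_extension
    (hsep : ∀ e, ∃ k, ∀ e', F.col e' (.inr k) = 1 ↔ e' = e) (b : Bool) (u : F.E → ℝ)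
    (hu : ∀ e, u (F.σ b e) = u e) :
    ∃ f : C(Config n, ℝ), (∀ x, f (Config.move b x) = f x) ∧ ∀ e, f (F.code e) = u e := by
  classical
  choose k hk using hsep
  set f₀ : C(Config n, ℝ) := ⟨fun x => ∑ e, if x.1 ([], .inr (k e)) = 1 then u e else 0,
    continuous_finsetSum _ fun e _ => (continuous_of_discreteTopology
      (f := fun a : Fin n => if a = 1 then u e else 0)).comp (Config.continuous_coord _)⟩ with hf₀
  have h₀ : ∀ e, f₀ (F.code e) = u e := fun e => by
    have : ∀ e', (F.code e).1 ([], .inr (k e')) = F.col e (.inr (k e')) := fun _ => rfl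
    simp [hf₀, this, hk]
  refine ⟨Config.moveAverage b f₀, Config.moveAverage_move b f₀, fun e => ?_⟩
  have hi : ∀ i, u ((F.σ b)^[i] e) = u e := fun i => by
    induction i with
    | zero => rfl
    | succ i ih => rw [Function.iterate_succ_apply', hu, ih]
  have hn' : (n : ℝ) ≠ 0 := Nat.cast_ne_zero.2 (NeZero.ne n)
  simp [Config.moveAverage, ← code_iterate, h₀, hi, hn']

/-- The cyclic system on `Fin n`. -/
def cyclic (n : ℕ) [NeZero n] : FinSys n where
  E := Fin n
  σ _ e := e + 1
  col e _ := e
  σ_iter _ e := by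
    simp [Fin.nsmul_one_self]
  col_σ _ _ := rfl

section Blowup

variable (H : Set F.E) (N : ℕ)

open Classical in
/-- The amount by which the interval over a point is displaced: one unit for the move `true` over
a point of `H`, and zero otherwise. -/
noncomputable def offset (b : Bool) (e : F.E) : ℕ := if b = true ∧ e ∈ H then 1 else 0

lemma offset_le (b : Bool) (e : F.E) : F.offset H b e ≤ 1 := by
  unfold offset
  split_ifs <;> simp

/-- The points of `F.E × Fin (N + 1)` that lie in the displaced interval of length `N`. -/
def Inner (b : Bool) (e : F.E) (t : Fin (N + 1)) : Prop :=
  F.offset H b e ≤ t ∧ (t : ℕ) < N + F.offset H b e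

/-- The height over `e'` that has the same displacement as the height `t` over `e`. -/
noncomputable def slide (b : Bool) (e e' : F.E) (t : Fin (N + 1)) : Fin (N + 1) :=
  Fin.ofNat (N + 1) (t - F.offset H b e + F.offset H b e')

variable {H N}

lemma slide_val {b : Bool} {e : F.E} {t : Fin (N + 1)} (ht : F.Inner H N b e t) (e' : F.E) :
    (F.slide H N b e e' t : ℕ) = t - F.offset H b e + F.offset H b e' := by
  have h1 := F.offset_le H b e'
  have h2 := ht.2
  have h3 := ht.1
  simp only [slide, Fin.ofNat]
  exact Nat.mod_eq_of_lt (by omega)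

lemma inner_slide {b : Bool} {e : F.E} {t : Fin (N + 1)} (ht : F.Inner H N b e t) (e' : F.E) :
    F.Inner H N b e' (F.slide H N b e e' t) := by
  have h := F.slide_val ht e'
  have h2 := ht.2
  have h3 := ht.1
  constructor <;> omega

lemma slide_slide {b : Bool} {e : F.E} {t : Fin (N + 1)} (ht : F.Inner H N b e t)
    (e' e'' : F.E) : F.slide H N b e' e'' (F.slide H N b e e' t) = F.slide H N b e e'' t := by
  ext
  rw [F.slide_val (F.inner_slide ht e'), F.slide_val ht, F.slide_val ht]
  omega

lemma slide_self {b : Bool} {e : F.E} {t : Fin (N + 1)} (ht : F.Inner H N b e t) :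
    F.slide H N b e e t = t := by
  ext
  rw [F.slide_val ht]
  have h3 := ht.1
  omega

variable (H N)

open Classical in
/-- The moves of the blowup: inside the displaced interval they follow the moves of the base,
outside they rotate the last coordinate. -/
noncomputable def blowupMove (b : Bool) (q : F.E × Fin (N + 1) × Fin n) :
    F.E × Fin (N + 1) × Fin n :=
  if F.Inner H N b q.1 q.2.1 then (F.σ b q.1, F.slide H N b q.1 (F.σ b q.1) q.2.1, q.2.2)
  else (q.1, q.2.1, q.2.2 + 1)

lemma blowupMove_iterate_of_inner {b : Bool} {q : F.E × Fin (N + 1) × Fin n}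
    (hq : F.Inner H N b q.1 q.2.1) (k : ℕ) : (F.blowupMove H N b)^[k] q =
      ((F.σ b)^[k] q.1, F.slide H N b q.1 ((F.σ b)^[k] q.1) q.2.1, q.2.2) := by
  induction k with
  | zero => simp [F.slide_self hq]
  | succ k ih =>
    rw [Function.iterate_succ_apply', ih, blowupMove, if_pos (F.inner_slide hq _)]
    simp only [F.slide_slide hq, Function.iterate_succ_apply']

lemma blowupMove_iterate_of_not_inner {b : Bool} {q : F.E × Fin (N + 1) × Fin n}
    (hq : ¬F.Inner H N b q.1 q.2.1) (k : ℕ) :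
    (F.blowupMove H N b)^[k] q = (q.1, q.2.1, q.2.2 + k • 1) := by
  induction k with
  | zero => simp
  | succ k ih =>
    rw [Function.iterate_succ_apply', ih, blowupMove, if_neg hq, succ_nsmul, add_assoc]

open Classical in
/-- The blowup of a finite system by intervals of length `N`, with colours that separate
points. -/
noncomputable def blowup : FinSys n where
  E := F.E × Fin (N + 1) × Fin n
  σ := F.blowupMove H N
  col q k := k.elim (fun b => if F.Inner H N b q.1 q.2.1 then F.col q.1 (.inl b) else q.2.2)
    fun m => if m < N then F.col q.1 (.inr m)
      else if m = N + (Fintype.equivFin (F.E × Fin (N + 1) × Fin n) q : ℕ) then 1 else 0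
  σ_iter b q := by
    by_cases hq : F.Inner H N b q.1 q.2.1
    · rw [F.blowupMove_iterate_of_inner H N hq, F.σ_iter, F.slide_self hq]
    · rw [F.blowupMove_iterate_of_not_inner H N hq]
      simp [Fin.nsmul_one_self]
  col_σ b q := by
    by_cases hq : F.Inner H N b q.1 q.2.1
    · simp [blowupMove, hq, F.inner_slide hq, F.col_σ]
    · simp [blowupMove, hq]

lemma blowup_separates (hn : 1 < n) (q : (F.blowup H N).E) :
    ∃ k, ∀ q', (F.blowup H N).col q' (.inr k) = 1 ↔ q' = q := by
  refine ⟨N + (Fintype.equivFin (F.E × Fin (N + 1) × Fin n) q : ℕ), fun q' => ?_⟩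
  have : Nontrivial (Fin n) := Fin.nontrivial_iff_two_le.2 hn
  have h0 : (0 : Fin n) ≠ 1 := by
    intro h
    have := congrArg Fin.val h
    simp [Nat.mod_eq_of_lt hn] at this
  simp only [blowup, Sum.elim_inr, add_lt_iff_neg_left, not_lt_zero, if_false, add_right_inj]
  constructor
  · intro h
    by_contra hne
    rw [if_neg fun he => hne ((Fintype.equivFin _).injective (Fin.ext he)).symm] at h
    exact h0 h
  · rintro rfl
    simp

/-- The potential that is invariant under a move of the blowup. -/
noncomputable def potential (b : Bool) (q : F.E × Fin (N + 1) × Fin n) : ℝ :=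
  if b then F.offset H b q.1 - (q.2.1 : ℕ) else (q.2.1 : ℕ)

lemma potential_blowupMove (b : Bool) (q : F.E × Fin (N + 1) × Fin n) :
    F.potential H N b (F.blowupMove H N b q) = F.potential H N b q := by
  by_cases hq : F.Inner H N b q.1 q.2.1
  · have h := F.slide_val hq (F.σ b q.1)
    have h' : ((F.slide H N b q.1 (F.σ b q.1) q.2.1 : ℕ) : ℝ) + F.offset H b q.1 =
        (q.2.1 : ℕ) + F.offset H b (F.σ b q.1) := by
      have h3 := hq.1
      exact_mod_cast (by omega)
    simp only [blowupMove, if_pos hq, potential]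
    cases b
    · simpa [offset] using h'
    · simp only [if_true]
      linarith
  · simp [blowupMove, hq, potential]

open Classical in
lemma potential_add (q : F.E × Fin (N + 1) × Fin n) :
    F.potential H N false q + F.potential H N true q = if q.1 ∈ H then 1 else 0 := by
  simp [potential, offset]

lemma blowup_act {w : List Bool} {q : (F.blowup H N).E} (h1 : w.length < (q.2.1 : ℕ))
    (h2 : q.2.1 + w.length < N) :
    ∃ q' : (F.blowup H N).E, (F.blowup H N).act w q = q' ∧ q'.1 = F.act w q.1 ∧ 0 < (q'.2.1 : ℕ) ∧
      (q'.2.1 : ℕ) < N := by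
  induction w generalizing q with
  | nil => exact ⟨q, rfl, rfl, by simpa using h1, by simpa using h2⟩
  | cons b w ih =>
    simp only [List.length_cons] at h1 h2
    have hb := F.offset_le H b q.1
    have hb' := F.offset_le H b (F.σ b q.1)
    have hq : F.Inner H N b q.1 q.2.1 := ⟨by omega, by omega⟩
    have hσ : (F.blowup H N).σ b q = (F.σ b q.1, F.slide H N b q.1 (F.σ b q.1) q.2.1, q.2.2) :=
      if_pos hq
    have hs := F.slide_val hq (F.σ b q.1)
    obtain ⟨q', hq', h⟩ := ih (q := (F.blowup H N).σ b q) (by rw [hσ]; simp only; omega)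
      (by rw [hσ]; simp only; omega)
    rw [hσ] at h
    exact ⟨q', hq', h⟩

lemma blowup_code {L : ℕ} {q : (F.blowup H N).E} (h1 : L < (q.2.1 : ℕ)) (h2 : q.2.1 + L < N)
    {p : ConfigIdx} (hp : p.1.length ≤ L) (hp' : ∀ m, p.2 = .inr m → m ≤ L) :
    ((F.blowup H N).code q).1 p = (F.code q.1).1 p := by
  obtain ⟨q', hq', hq1, h3, h4⟩ := F.blowup_act H N (w := p.1) (q := q) (by omega) (by omega)
  simp only [code, hq', ← hq1]
  obtain ⟨w, b | m⟩ := p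
  · have hb := F.offset_le H b q'.1
    have : F.Inner H N b q'.1 q'.2.1 := ⟨by omega, by omega⟩
    simp [blowup, this]
  · have := hp' m rfl
    have hm : m < N := by omega
    simp [blowup, hm]

end Blowup

section Limit

open Filter Topology

variable (H : Set F.E)

lemma card_blowup (N : ℕ) :
    (Fintype.card (F.blowup H N).E : ℝ) = Fintype.card F.E * ((N + 1) * n) := by
  have : Fintype.card (F.blowup H N).E = Fintype.card (F.E × Fin (N + 1) × Fin n) := rfl
  rw [this]
  simp

lemma sum_blowup (N : ℕ) (f : F.E × Fin (N + 1) × Fin n → ℝ) :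
    ∑ q : (F.blowup H N).E, f q = ∑ e, ∑ t, ∑ i, f (e, t, i) := by
  have : ∑ q : (F.blowup H N).E, f q = ∑ q, f q := rfl
  simp only [this, Fintype.sum_prod_type]

lemma sum_boundary_le (L N : ℕ) :
    ∑ t : Fin (N + 1), (if L < (t : ℕ) ∧ t + L < N then (0 : ℝ) else 1) ≤ 2 * (L + 1) := by
  rw [Fin.sum_univ_eq_sum_range (fun t => if L < t ∧ t + L < N then (0 : ℝ) else 1) (N + 1)]
  have h : ∀ t, (if L < t ∧ t + L < N then (0 : ℝ) else 1) =
      if ¬(L < t ∧ t + L < N) then 1 else 0 := fun t => (ite_not _ _ _).symm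
  simp only [h, Finset.sum_boole]
  have hs : (Finset.range (N + 1)).filter (fun t => ¬(L < t ∧ t + L < N)) ⊆
      Finset.range (L + 1) ∪ Finset.Ico (N - L) (N + 1) := fun t => by
    simp only [Finset.mem_filter, Finset.mem_range, Finset.mem_union, Finset.mem_Ico]
    omega
  have hc := (Finset.card_le_card hs).trans (Finset.card_union_le _ _)
  simp only [Finset.card_range, Nat.card_Ico] at hc
  have : ((Finset.range (N + 1)).filter (fun t => ¬(L < t ∧ t + L < N))).card ≤ 2 * (L + 1) := by
    omega
  exact_mod_cast this

lemma tendsto_blowup_code (φ : C(Config n, ℝ)) :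
    Tendsto (fun N => (Fintype.card (F.blowup H N).E : ℝ)⁻¹ * ∑ q : (F.blowup H N).E,
      |φ ((F.blowup H N).code q) - φ (F.code q.1)|) atTop (𝓝 0) := by
  rw [Metric.tendsto_nhds]
  intro ε hε
  obtain ⟨P, hP⟩ := Config.exists_finset_dist_lt φ (half_pos hε)
  set L := P.sup fun p => max p.1.length (p.2.elim (fun _ => 0) id) with hL
  set c : ℝ := 2 * ‖φ‖ * (2 * (L + 1)) with hc
  have hlim : Tendsto (fun N : ℕ => c / ((N + 1 : ℕ) : ℝ)) atTop (𝓝 0) :=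
    (tendsto_const_div_atTop_nhds_zero_nat c).comp (tendsto_add_atTop_nat 1)
  filter_upwards [hlim.eventually_lt_const (half_pos hε)] with N hN
  set r : Fin (N + 1) → ℝ := fun t => if L < (t : ℕ) ∧ t + L < N then (0 : ℝ) else 1 with hr
  have hterm : ∀ q : F.E × Fin (N + 1) × Fin n,
      |φ ((F.blowup H N).code q) - φ (F.code q.1)| ≤ ε / 2 + 2 * ‖φ‖ * r q.2.1 := by
    intro q
    simp only [hr]
    split_ifs with hq
    · rw [mul_zero, add_zero]
      refine (hP _ _ fun p hp => F.blowup_code H N (q := q) hq.1 hq.2 ?_ ?_).le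
      · exact (le_max_left _ _).trans (Finset.le_sup (f := fun p : ConfigIdx =>
          max p.1.length (p.2.elim (fun _ => 0) id)) hp)
      · intro m hm
        have := (le_max_right _ _).trans (Finset.le_sup (f := fun p : ConfigIdx =>
          max p.1.length (p.2.elim (fun _ => 0) id)) hp)
        simpa [hm] using this
    · have h1 := φ.norm_coe_le_norm ((F.blowup H N).code q)
      have h2 := φ.norm_coe_le_norm (F.code q.1)
      have h3 := abs_sub (φ ((F.blowup H N).code q)) (φ (F.code q.1))
      simp only [Real.norm_eq_abs] at h1 h2
      linarith
  have hsum : ∑ q : (F.blowup H N).E, |φ ((F.blowup H N).code q) - φ (F.code q.1)| ≤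
      Fintype.card F.E * (((N + 1) * n) * (ε / 2) + n * c) := by
    refine (Finset.sum_le_sum fun q _ => hterm q).trans ((F.sum_blowup H N
      (fun q => ε / 2 + 2 * ‖φ‖ * r q.2.1)).le.trans ?_)
    simp only [Finset.sum_const, Finset.card_univ, Fintype.card_fin, nsmul_eq_mul]
    simp only [← Finset.mul_sum, Finset.sum_add_distrib, Finset.sum_const, Finset.card_univ,
      Fintype.card_fin, nsmul_eq_mul]
    have := mul_le_mul_of_nonneg_left (sum_boundary_le L N) (by positivity : (0 : ℝ) ≤ 2 * ‖φ‖)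
    have h2 := mul_le_mul_of_nonneg_left this (Nat.cast_nonneg (α := ℝ) n)
    refine mul_le_mul_of_nonneg_left ?_ (Nat.cast_nonneg (α := ℝ) _)
    push_cast
    linarith
  have hE : (0 : ℝ) < Fintype.card F.E := Nat.cast_pos.2 Fintype.card_pos
  have hn : (0 : ℝ) < n := Nat.cast_pos.2 (NeZero.pos n)
  have hN' : (0 : ℝ) < N + 1 := by positivity
  rw [Real.dist_eq, sub_zero, abs_of_nonneg (by positivity), F.card_blowup, inv_mul_lt_iff₀
    (by positivity)]
  refine hsum.trans_lt ?_
  rw [mul_assoc (Fintype.card F.E : ℝ)]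
  refine mul_lt_mul_of_pos_left ?_ hE
  push_cast at hN
  rw [div_lt_iff₀ hN'] at hN
  nlinarith

lemma integral_base (N : ℕ) (φ : C(Config n, ℝ)) :
    ∫ x, φ x ∂(F.measure : Measure (Config n)) =
      (Fintype.card (F.blowup H N).E : ℝ)⁻¹ * ∑ q : (F.blowup H N).E, φ (F.code q.1) := by
  have hn : (n : ℝ) ≠ 0 := Nat.cast_ne_zero.2 (NeZero.ne n)
  rw [F.integral_measure, F.sum_blowup H N (fun q => φ (F.code q.1)), F.card_blowup]
  simp only [Finset.sum_const, Finset.card_univ, Fintype.card_fin, nsmul_eq_mul,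
    ← Finset.mul_sum]
  have hN' : (N + 1 : ℝ) ≠ 0 := by positivity
  push_cast
  field_simp

lemma tendsto_measure_blowup : Tendsto (fun N => (F.blowup H N).measure) atTop (𝓝 F.measure) := by
  rw [ProbabilityMeasure.tendsto_iff_forall_integral_tendsto]
  intro φ
  rw [tendsto_iff_dist_tendsto_zero]
  refine squeeze_zero (fun _ => dist_nonneg) (fun N => ?_)
    (F.tendsto_blowup_code H φ.toContinuousMap)
  have h1 := (F.blowup H N).integral_measure φ.toContinuousMap
  have h2 := F.integral_base H N φ.toContinuousMap
  simp only [BoundedContinuousFunction.coe_toContinuousMap] at h1 h2 ⊢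
  rw [h1, h2, Real.dist_eq, ← mul_sub, ← Finset.sum_sub_distrib, abs_mul,
    abs_of_nonneg (by positivity)]
  exact mul_le_mul_of_nonneg_left (Finset.abs_sum_le_sum_abs _ _) (by positivity)

end Limit

end FinSys

namespace Config

open Filter Topology

variable {n : ℕ} [NeZero n]

/-- The probability measures for which the indicator of a cylinder is, up to an `L¹` error less
than `δ`, a sum of two continuous functions, each invariant under one of the moves. -/
def nearlyRigid (I : Finset (ConfigIdx × Fin n)) (δ : ℝ) : Set (ProbabilityMeasure (Config n)) :=
  {μ | ∃ f : Bool → C(Config n, ℝ), (∀ b x, f b (move b x) = f b x) ∧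
    ∫ x, |cylFun I x - f false x - f true x| ∂(μ : Measure (Config n)) < δ}

lemma continuous_integral (φ : C(Config n, ℝ)) :
    Continuous fun μ : ProbabilityMeasure (Config n) => ∫ x, φ x ∂(μ : Measure (Config n)) :=
  ProbabilityMeasure.continuous_integral_boundedContinuousFunction
    (BoundedContinuousFunction.mkOfCompact φ)

lemma isOpen_nearlyRigid (I : Finset (ConfigIdx × Fin n)) (δ : ℝ) :
    IsOpen (nearlyRigid I δ) := by
  have h : nearlyRigid I δ = ⋃ (f : Bool → C(Config n, ℝ)) (_ : ∀ b x, f b (move b x) = f b x),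
      {μ : ProbabilityMeasure (Config n) |
        ∫ x, |cylFun I x - f false x - f true x| ∂(μ : Measure (Config n)) < δ} := by
    ext μ
    simp [nearlyRigid]
  rw [h]
  exact isOpen_biUnion fun f _ => isOpen_lt
    (continuous_integral |cylFun I - f false - f true|) continuous_const

lemma eventually_nearlyRigid (hn : 1 < n) (F : FinSys n) (I : Finset (ConfigIdx × Fin n))
    {δ : ℝ} (hδ : 0 < δ) :
    ∀ᶠ N in atTop, (F.blowup (F.code ⁻¹' cyl I) N).measure ∈ nearlyRigid I δ := by
  set H := F.code ⁻¹' cyl I with hH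
  filter_upwards [(F.tendsto_blowup_code H (cylFun I)).eventually_lt_const hδ] with N hN
  choose f hf hfc using fun b => (F.blowup H N).exists_extension (F.blowup_separates H N hn) b
    (F.potential H N b) (F.potential_blowupMove H N b)
  refine ⟨f, hf, ?_⟩
  refine lt_of_eq_of_lt ?_ hN
  refine ((F.blowup H N).integral_measure |cylFun I - f false - f true|).trans ?_
  congr 1
  refine Finset.sum_congr rfl fun q _ => ?_
  have h := F.potential_add H N q
  have h' : cylFun I (F.code q.1) = F.potential H N false q + F.potential H N true q := by
    classical
    rw [h]
    simp [cylFun, indicator, hH]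
  simp only [ContinuousMap.abs_apply, ContinuousMap.sub_apply, hfc]
  rw [h', sub_sub]

/-- There is a probability measure that is invariant under both moves and rigid. -/
lemma exists_rigid_measure (hn : 1 < n) : ∃ μ : ProbabilityMeasure (Config n),
    (∀ b, MeasurePreserving (move b) (μ : Measure (Config n)) μ) ∧
      ∀ I, ∀ δ : ℝ, 0 < δ → μ ∈ nearlyRigid I δ := by
  set R := range (FinSys.measure (n := n)) with hR
  have : CompactSpace (closure R) := isCompact_iff_compactSpace.1 isClosed_closure.isCompact
  set V : Finset (ConfigIdx × Fin n) × ℕ → Set (closure R) := fun p =>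
    Subtype.val ⁻¹' nearlyRigid p.1 (1 / (p.2 + 1 : ℝ)) with hV
  have hopen : ∀ p, IsOpen (V p) := fun p =>
    (isOpen_nearlyRigid _ _).preimage continuous_subtype_val
  have hdense : ∀ p, Dense (V p) := by
    intro p
    rw [Subtype.dense_iff]
    refine closure_minimal ?_ isClosed_closure
    rintro _ ⟨F, rfl⟩
    refine mem_closure_of_tendsto (F.tendsto_measure_blowup (F.code ⁻¹' cyl p.1)) ?_
    filter_upwards [eventually_nearlyRigid hn F p.1 (δ := 1 / (p.2 + 1 : ℝ)) (by positivity)]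
      with N hN
    exact ⟨⟨_, subset_closure ⟨_, rfl⟩⟩, hN, rfl⟩
  have : Nonempty (closure R) := ⟨⟨_, subset_closure ⟨FinSys.cyclic n, rfl⟩⟩⟩
  obtain ⟨⟨μ, hμR⟩, hμ⟩ := (dense_iInter_of_isOpen hopen hdense).nonempty
  rw [mem_iInter] at hμ
  refine ⟨μ, fun b => ⟨(continuous_move b).measurable, ?_⟩, fun I δ hδ => ?_⟩
  · have hmap : IsFiniteMeasure ((μ : Measure (Config n)).map (move b)) := inferInstance
    refine ext_of_forall_integral_eq_of_IsFiniteMeasure fun φ => ?_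
    rw [integral_map (continuous_move b).measurable.aemeasurable
      φ.continuous.aestronglyMeasurable]
    have hclosed : IsClosed {ν : ProbabilityMeasure (Config n) |
        ∫ x, φ (move b x) ∂(ν : Measure (Config n)) = ∫ x, φ x ∂(ν : Measure (Config n))} :=
      isClosed_eq (continuous_integral (φ.toContinuousMap.comp ⟨_, continuous_move b⟩))
        (continuous_integral φ.toContinuousMap)
    refine closure_minimal ?_ hclosed hμR
    rintro _ ⟨F, rfl⟩
    exact F.integral_move b φ.toContinuousMap
  · obtain ⟨k, hk⟩ := exists_nat_one_div_lt hδ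
    obtain ⟨f, hf, hfI⟩ := hμ (I, k)
    exact ⟨f, hf, hfI.trans hk⟩

end Config

lemma exists_rigidSystem (n : ℕ) [NeZero n] (hn : 1 < n) :
    Nonempty (RigidSystem n (Config n) (Finset (ConfigIdx × Fin n))) := by
  obtain ⟨μ, hμ, hr⟩ := Config.exists_rigid_measure hn
  exact ⟨{
    μ := μ
    isProb := inferInstance
    T := Config.move
    label := Config.lab
    C := Config.cyl
    T_pres := hμ
    T_iter := Config.move_iterate
    label_meas := fun b => (Config.continuous_coord _).measurable
    label_T := Config.lab_move
    C_meas := fun I => (Config.isClopen_cyl I).isClosed.measurableSet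
    C_gen := Config.generateFrom_cyl
    C_pi := Config.isPiSystem_cyl
    C_univ := ⟨∅, by simp [Config.cyl]⟩
    C_sep := Config.exists_cyl_separating
    rigid := fun I ε hε => by
      obtain ⟨f, hf, h⟩ := hr I ε hε
      exact ⟨fun b => f b, fun b => (BoundedContinuousFunction.mkOfCompact (f b)).integrable _,
        hf, h⟩ }⟩

end

/-- For every `n > 1`, there exists an `n`-regular acyclic Borel bipartite graph with no
Borel perfect matching. A perfect matching is given as a symmetric Borel set `M` of
(ordered pairs representing) edges such that every vertex is incident to exactly one
edge of `M`. -/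
theorem stmt_8 (n : ℕ) (hn : 1 < n) :
    ∃ (X : Type) (mX : MeasurableSpace X) (G : SimpleGraph X),
      @StandardBorelSpace X mX ∧
      @MeasurableSet (X × X) (@Prod.instMeasurableSpace X X mX mX)
        {p : X × X | G.Adj p.1 p.2} ∧
      (∀ x, (G.neighborSet x).encard = n) ∧
      G.IsAcyclic ∧
      (∃ A : Set X, @MeasurableSet X mX A ∧ ∀ x y, G.Adj x y → (x ∈ A ↔ y ∉ A)) ∧
      ¬∃ M : Set (X × X),
        @MeasurableSet (X × X) (@Prod.instMeasurableSpace X X mX mX) M ∧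
        (∀ p ∈ M, G.Adj p.1 p.2) ∧
        (∀ x y, (x, y) ∈ M → (y, x) ∈ M) ∧
        (∀ x, ∃! y, (x, y) ∈ M) := by
  have : NeZero n := ⟨by omega⟩
  obtain ⟨S⟩ := exists_rigidSystem n hn
  refine ⟨S.Vertex, inferInstance, S.graph, S.standardBorelSpace_vertex, S.measurableSet_adj,
    S.encard_neighborSet, S.isAcyclic, ⟨{p | p.1.2 = true}, ?_, fun p q h => ?_⟩,
    S.not_exists_matching hn⟩
  · exact (measurable_snd.comp measurable_subtype_coe) (MeasurableSet.singleton true)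
  · have := h.1
    simp only [Set.mem_ofPred_eq]
    grind
end
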